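/- In the setup below, if dim(r₀ ↾ (A_* ∪ c₀), M_a) is finite, then w_P(q(M_a), A_*) is finite. -/

import Mathlib

open FirstOrder Language Cardinal

universe u

namespace Benign

variable {L : FirstOrder.Language.{u, u}} {M : Type u} [L.Structure M]

/-- Two tuples (indexed by a type `α`) realize the same complete `L`-type over the
parameter set `A`. -/
def SameTypeOver (A : Set M) {α : Type} (x y : α → M) : Prop :=
  ∀ φ : L.Formula (α ⊕ ↥A),
    φ.Realize (Sum.elim x Subtype.val) ↔ φ.Realize (Sum.elim y Subtype.val)

/-- Two tuples realize the same strong type over `A`: they realize the same type over `A`,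
and they are equivalent under every `A`-definable equivalence relation with finitely many
classes. -/
def SameStrongTypeOver (A : Set M) {α : Type} (x y : α → M) : Prop :=
  SameTypeOver (L := L) A x y ∧
    ∀ φ : L.Formula ((α ⊕ α) ⊕ ↥A),
      (Equivalence fun u v : α → M => φ.Realize (Sum.elim (Sum.elim u v) Subtype.val)) →
      (∃ k : ℕ, ∀ g : Fin (k + 1) → α → M, ∃ i j, i ≠ j ∧
          φ.Realize (Sum.elim (Sum.elim (g i) (g j)) Subtype.val)) →
      φ.Realize (Sum.elim (Sum.elim x y) Subtype.val)

/-- The language consisting of a single unary predicate symbol `P`. -/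
def unaryLang : FirstOrder.Language.{0, 0} := ⟨fun _ => Empty, fun n => PLift (n = 1)⟩

/-- The interpretation of the unary predicate `P` as membership in `A`. -/
def unaryStructure (A : Set M) : unaryLang.Structure M where
  funMap := fun f _ => f.elim
  RelMap := fun {n} r v => v (Fin.cast r.down.symm 0) ∈ A

/-- Two tuples realize the same type over `A` in the expanded language
`L* = L ∪ {P}` where the new unary predicate `P` is interpreted as `A`. -/
def SameLstarTypeOver (A : Set M) {α : Type} (x y : α → M) : Prop :=
  letI : unaryLang.Structure M := unaryStructure A
  SameTypeOver (L := L.sum unaryLang) A x y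

/-- `A` is benign in `M`: tuples with the same `L`-type over `A` have the same `L*`-type
over `A`. -/
def IsBenign (A : Set M) : Prop :=
  ∀ (n : ℕ) (x y : Fin n → M),
    SameTypeOver (L := L) A x y → SameLstarTypeOver (L := L) A x y

/-- `A` is weakly benign in `M`: tuples with the same strong type over `A` have the same
`L*`-type over `A`. -/
def IsWeaklyBenign (A : Set M) : Prop :=
  ∀ (n : ℕ) (x y : Fin n → M),
    SameStrongTypeOver (L := L) A x y → SameLstarTypeOver (L := L) A x y

/-- The cardinality of the theory: `|T| = |L| + ℵ₀`. -/
noncomputable def cardL (L : FirstOrder.Language.{u, u}) : Cardinal.{u} :=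
  L.card ⊔ ℵ₀

/-- `T` is stable in `κ`: over every parameter set of size at most `κ` in a model of `T`
there are at most `κ` complete types. -/
def StableIn (L : FirstOrder.Language.{u, u}) (T : L.Theory) (κ : Cardinal.{u}) : Prop :=
  ∀ (N : Type u) (_ : L.Structure N), N ⊨ T → ∀ A : Set N, #A ≤ κ →
    ∀ n : ℕ, #(((L[[↥A]]).completeTheory N).CompleteType (Fin n)) ≤ κ

/-- `T` is stable: stable in some cardinal. -/
def Stable (L : FirstOrder.Language.{u, u}) (T : L.Theory) : Prop :=
  ∃ κ, StableIn L T κ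

/-- `T` is superstable: stable in every cardinal `κ ≥ 2 ^ |T|`. -/
def Superstable (L : FirstOrder.Language.{u, u}) (T : L.Theory) : Prop :=
  ∀ κ : Cardinal.{u}, 2 ^ cardL L ≤ κ → StableIn L T κ

/-- `T` is `ω`-stable. -/
def OmegaStable (L : FirstOrder.Language.{u, u}) (T : L.Theory) : Prop :=
  StableIn L T ℵ₀

/-- `M` is `κ`-saturated as an `L'`-structure: every finitely satisfiable set of
`L'`-formulas in one free variable over fewer than `κ` parameters is realized. -/
def SaturatedIn (L' : FirstOrder.Language.{u, u}) [L'.Structure M] (κ : Cardinal.{u}) : Prop :=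
  ∀ S : Set M, #S < κ →
    ∀ p : Set (L'.Formula (Fin 1 ⊕ ↥S)),
      (∀ fs : Finset (L'.Formula (Fin 1 ⊕ ↥S)), ↑fs ⊆ p →
        ∃ x : M, ∀ φ ∈ fs, φ.Realize (Sum.elim ![x] Subtype.val)) →
      ∃ x : M, ∀ φ ∈ p, φ.Realize (Sum.elim ![x] Subtype.val)

/-- The pair `(M, A)` is `κ`-saturated as a structure in the language `L* = L ∪ {P}`. -/
def PairSaturated (A : Set M) (κ : Cardinal.{u}) : Prop :=
  letI : unaryLang.Structure M := unaryStructure A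
  SaturatedIn (M := M) (L.sum unaryLang) κ

/-- A subset `N ⊆ M` is (the universe of) an elementary substructure of `M`
(Tarski–Vaught test). -/
def ElemSubset (N : Set M) : Prop :=
  N.Nonempty ∧
    ∀ (n : ℕ) (φ : L.BoundedFormula (Fin n) 1) (a : Fin n → M), (∀ i, a i ∈ N) →
      (∃ x : M, φ.Realize a ![x]) → ∃ x ∈ N, φ.Realize a ![x]

/-- `B` is relatively `κ`-saturated in `A`: every type over a subset of `B` of size `< κ`
which is realized (by a finite tuple) in `A` is realized in `B`. -/
def RelKappaSaturated (κ : Cardinal.{u}) (B A : Set M) : Prop :=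
  B ⊆ A ∧
    ∀ S : Set M, S ⊆ B → #S < κ →
      ∀ (n : ℕ) (a : Fin n → M), (∀ i, a i ∈ A) →
        ∃ b : Fin n → M, (∀ i, b i ∈ B) ∧ SameTypeOver (L := L) S a b

/-- A subset `N ⊆ M` is `κ`-saturated (as a structure in its own right, computed inside
`M`): every set of formulas over `< κ` parameters from `N` which is finitely satisfiable
in `N` is realized in `N`. -/
def SubsetSaturated (κ : Cardinal.{u}) (N : Set M) : Prop :=
  ∀ S : Set M, S ⊆ N → #S < κ →
    ∀ p : Set (L.Formula (Fin 1 ⊕ ↥S)),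
      (∀ fs : Finset (L.Formula (Fin 1 ⊕ ↥S)), ↑fs ⊆ p →
        ∃ x ∈ N, ∀ φ ∈ fs, φ.Realize (Sum.elim ![x] Subtype.val)) →
      ∃ x ∈ N, ∀ φ ∈ p, φ.Realize (Sum.elim ![x] Subtype.val)

/-- `f` is a sequence of `m`-tuples which is indiscernible over `C`. -/
def IndiscOver (C : Set M) {m : ℕ} (f : ℕ → Fin m → M) : Prop :=
  ∀ (k : ℕ) (i j : Fin k → ℕ), StrictMono i → StrictMono j →
    SameTypeOver (L := L) C
      (fun s : Fin k × Fin m => f (i s.1) s.2) (fun s : Fin k × Fin m => f (j s.1) s.2)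

/-- The formula `φ(x̄, b)` divides over `C`: there is a `C`-indiscernible sequence starting
with `b` along which the instances of `φ` are `k`-inconsistent. -/
def Divides (C : Set M) {n m : ℕ} (φ : L.Formula (Fin n ⊕ Fin m)) (b : Fin m → M) : Prop :=
  ∃ f : ℕ → Fin m → M, f 0 = b ∧ IndiscOver (L := L) C f ∧
    ∃ k : ℕ, 0 < k ∧ ∀ i : Fin k → ℕ, StrictMono i →
      ¬ ∃ a : Fin n → M, ∀ j : Fin k, φ.Realize (Sum.elim a (f (i j)))

/-- `tp(a / B)` forks over `C`: the type implies a finite disjunction of formulas,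
each of which divides over `C`. -/
def TupForksOver {n : ℕ} (a : Fin n → M) (B C : Set M) : Prop :=
  ∃ (r : ℕ) (ms : Fin r → ℕ) (φ : ∀ i : Fin r, L.Formula (Fin n ⊕ Fin (ms i)))
    (b : ∀ i : Fin r, Fin (ms i) → M),
    (∀ i, Divides (L := L) C (φ i) (b i)) ∧
    ∀ a' : Fin n → M, SameTypeOver (L := L) B a a' →
      ∃ i, (φ i).Realize (Sum.elim a' (b i))

/-- The tuple `a` is independent from `X` over `C` (nonforking independence). -/
def TupIndepOver {n : ℕ} (a : Fin n → M) (X C : Set M) : Prop :=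
  ¬ TupForksOver (L := L) a (X ∪ C) C

/-- The set `Y` is independent from `X` over `C`: the type of every finite tuple from `Y`
over `X ∪ C` does not fork over `C`. -/
def IndepOver (Y X C : Set M) : Prop :=
  ∀ (n : ℕ) (a : Fin n → M), (∀ i, a i ∈ Y) → TupIndepOver (L := L) a X C

/-- `g` is an elementary map on the set `D`. -/
def ElemOn (D : Set M) (g : M → M) : Prop :=
  ∀ (n : ℕ) (a : Fin n → M), (∀ i, a i ∈ D) →
    SameTypeOver (L := L) (∅ : Set M) a (g ∘ a)

/-- The algebraic closure of `B` inside `M`. -/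
def aclSet (B : Set M) : Set M :=
  {x | ∃ φ : L.Formula (Fin 1 ⊕ ↥B), φ.Realize (Sum.elim ![x] Subtype.val) ∧
        {y : M | φ.Realize (Sum.elim ![y] Subtype.val)}.Finite}

/-- The type `tp(d / B)` is algebraic. -/
def AlgebraicTp (B : Set M) {n : ℕ} (d : Fin n → M) : Prop :=
  {d' : Fin n → M | SameTypeOver (L := L) B d d'}.Finite

/-- The types `tp(d / B)` and `tp(e / C)` are orthogonal: over any common extension `D`
of the domains, realizations of the respective nonforking extensions are independent. -/
def TypesOrthogonal {n m : ℕ} (B : Set M) (d : Fin n → M) (C : Set M) (e : Fin m → M) :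
    Prop :=
  ∀ (D : Set M) (d' : Fin n → M) (e' : Fin m → M), B ⊆ D → C ⊆ D →
    SameTypeOver (L := L) B d d' → ¬ TupForksOver (L := L) d' D B →
    SameTypeOver (L := L) C e e' → ¬ TupForksOver (L := L) e' D C →
    ¬ TupForksOver (L := L) d' (D ∪ Set.range e') D

/-- The type `tp(d / B)` is orthogonal to the set `A`: it is orthogonal to every complete
type over `acl(A)`. -/
def TypeOrthSet (B : Set M) {n : ℕ} (d : Fin n → M) (A : Set M) : Prop :=
  ∀ (m : ℕ) (e : Fin m → M), TypesOrthogonal (L := L) B d (aclSet (L := L) A) e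

/-- `tp(Na / Ma)` is orthogonal to the type `tp(e / Ma)`: the type over `Ma` of every
finite tuple from `Na` is orthogonal to it. -/
def SetTpOrth (Na Ma : Set M) {m : ℕ} (e : Fin m → M) : Prop :=
  ∀ (n : ℕ) (d : Fin n → M), (∀ i, d i ∈ Na) →
    TypesOrthogonal (L := L) Ma d Ma e

/-- The type `tp(d / B)` is regular: it is orthogonal to all of its forking extensions. -/
def TypeRegular (B : Set M) {n : ℕ} (d : Fin n → M) : Prop :=
  ∀ (D : Set M) (d' : Fin n → M), B ⊆ D →
    SameTypeOver (L := L) B d d' → TupForksOver (L := L) d' D B →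
    TypesOrthogonal (L := L) B d D d'

/-- The type `tp(d / B)` is stationary: it has a unique nonforking extension to every
superset of its domain. -/
def TypeStationary (B : Set M) {n : ℕ} (d : Fin n → M) : Prop :=
  ∀ D : Set M, B ⊆ D → ∀ d₁ d₂ : Fin n → M,
    SameTypeOver (L := L) B d d₁ → SameTypeOver (L := L) B d d₂ →
    ¬ TupForksOver (L := L) d₁ D B → ¬ TupForksOver (L := L) d₂ D B →
    SameTypeOver (L := L) D d₁ d₂

/-- `D` is `κ`-atomic over `B`: the type of every finite tuple from `D` over `B` is
implied by its restriction to a subset of `B` of size `< κ`. -/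
def KappaAtomicOver (κ : Cardinal.{u}) (D B : Set M) : Prop :=
  ∀ (n : ℕ) (d : Fin n → M), (∀ i, d i ∈ D) →
    ∃ S : Set M, S ⊆ B ∧ #S < κ ∧
      ∀ d' : Fin n → M, SameTypeOver (L := L) S d d' → SameTypeOver (L := L) B d d'

/-- `N` is `κ`-prime over `X`: `N` is a `κ`-saturated elementary substructure containing
`X` which elementarily embeds over `X` into every `κ`-saturated elementary substructure
containing `X`. -/
def KappaPrimeOver (κ : Cardinal.{u}) (N X : Set M) : Prop :=
  ElemSubset (L := L) N ∧ X ⊆ N ∧ SubsetSaturated (L := L) κ N ∧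
    ∀ N' : Set M, ElemSubset (L := L) N' → X ⊆ N' → SubsetSaturated (L := L) κ N' →
      ∃ g : M → M, ElemOn (L := L) N g ∧ (∀ x ∈ X, g x = x) ∧ g '' N ⊆ N'

/-- `Ma` is `A`-full in `M`. -/
def AFull (A Ma : Set M) (κ : Cardinal.{u}) : Prop :=
  ∀ N : Set M, KappaPrimeOver (L := L) κ N (Ma ∪ A) →
    ∀ C0 C1 C2 : Set M, C0 ⊆ Ma → C1 ⊆ A → C0 ⊆ C2 → C1 ⊆ C2 → C2 ⊆ N →
      #C0 ≤ cardL L → #C1 ≤ cardL L → #C2 ≤ cardL L →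
      ∃ f : M → M, ElemOn (L := L) (C1 ∪ C2) f ∧ (∀ x ∈ C0, f x = x) ∧
        f '' (C1 ∪ C2) ⊆ Ma ∧ f '' C1 ⊆ A ∧
        (IndepOver (L := L) C2 A C1 → IndepOver (L := L) (f '' C2) A (f '' C1))

/-- `(M₁, A₁) ∈ K_c`. -/
structure Kc (κ : Cardinal.{u}) (A : Set M) (c : M) (M₁ A₁ : Set M) : Prop where
  elem : ElemSubset (L := L) M₁
  mem : c ∈ M₁
  relSat : RelKappaSaturated (L := L) κ A₁ A
  sub : A₁ ⊆ M₁
  indep : IndepOver (L := L) M₁ A A₁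
  cardA₁ : #A₁ ≤ κ
  cardM₁ : #M₁ ≤ κ
  sat : SubsetSaturated (L := L) κ M₁

/-- `⟨A₁, Ma, Mb, Na, g⟩ ∈ K¹_{a,b}`. -/
structure K1 (κ : Cardinal.{u}) (A : Set M) (a b : M) (A₁ Ma Mb Na : Set M)
    (g : M → M) : Prop where
  ka : Kc (L := L) κ A a Ma A₁
  kb : Kc (L := L) κ A b Mb A₁
  gBij : Set.BijOn g Ma Mb
  gFix : ∀ x ∈ A₁, g x = x
  gElem : ElemOn (L := L) Ma g
  gab : g a = b
  sub : Ma ⊆ Na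
  elemNa : ElemSubset (L := L) Na
  satNa : SubsetSaturated (L := L) κ Na
  cardNa : #Na = κ
  indepNa : IndepOver (L := L) Na A A₁

/-- `⟨A₁, Ma, Mb, Na, g⟩ ∈ K²_{a,b}`: additionally `g` is an isomorphism of `Ma^eq` onto
`Mb^eq` over `A₁^eq`, i.e. `g` preserves strong types over `A₁`. -/
def K2 (κ : Cardinal.{u}) (A : Set M) (a b : M) (A₁ Ma Mb Na : Set M)
    (g : M → M) : Prop :=
  K1 (L := L) κ A a b A₁ Ma Mb Na g ∧
    ∀ (n : ℕ) (t : Fin n → M), (∀ i, t i ∈ Ma) →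
      SameStrongTypeOver (L := L) A₁ t (g ∘ t)

/-- `K^i_{a,b}` for `i ∈ {1,2}` (`two = false` gives `K¹`, `two = true` gives `K²`). -/
def Ki (two : Bool) (κ : Cardinal.{u}) (A : Set M) (a b : M) (A₁ Ma Mb Na : Set M)
    (g : M → M) : Prop :=
  if two then K2 (L := L) κ A a b A₁ Ma Mb Na g
  else K1 (L := L) κ A a b A₁ Ma Mb Na g

/-- `d'` realizes `g(tp(d / Ma))`. -/
def RealizesGType (Ma : Set M) (g : M → M) {n : ℕ} (d d' : Fin n → M) : Prop :=
  ∀ (k : ℕ) (m : Fin k → M), (∀ i, m i ∈ Ma) →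
    ∀ φ : L.Formula (Fin n ⊕ Fin k),
      φ.Realize (Sum.elim d m) ↔ φ.Realize (Sum.elim d' (g ∘ m))

/-- The data `⟨A₁, Ma, Mb, Na, g⟩ ∈ K²_{a,b}` satisfies the conclusion of the
characterization of failure of weak benignity (conditions (a)–(f) of the main lemma). -/
structure CharWitness (κ : Cardinal.{u}) (A : Set M) (a b : M) (Astar Ma Mb Na : Set M)
    (g : M → M) : Prop where
  k2 : K2 (L := L) κ A a b Astar Ma Mb Na g
  ne : Ma ≠ Na
  full : AFull (L := L) A Ma κ
  indepNa : IndepOver (L := L) Na A Astar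
  orth : ∀ (n : ℕ) (e : Fin n → M), ¬ AlgebraicTp (L := L) Ma e →
    TypeOrthSet (L := L) Ma e A → SetTpOrth (L := L) Na Ma e
  noCopy : ∀ (n : ℕ) (d : Fin n → M), (∀ i, d i ∈ Na) → ¬ (∀ i, d i ∈ Ma) →
    ¬ ∃ d' : Fin n → M, RealizesGType (L := L) Ma g d d' ∧
        TupIndepOver (L := L) d' A Mb
  gStrong : ∀ (n : ℕ) (t : Fin n → M), (∀ i, t i ∈ Ma) →
    SameStrongTypeOver (L := L) Astar t (g ∘ t)

/-- An `L*`-elementary map from `(M, A)` to `(M', A')`. -/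
def LstarElementary {M' : Type u} [L.Structure M'] (A : Set M) (A' : Set M')
    (h : M → M') : Prop :=
  ∀ (n : ℕ) (φ : (L.sum unaryLang).Formula (Fin n)) (v : Fin n → M),
    (letI : unaryLang.Structure M := unaryStructure A; φ.Realize v) ↔
    (letI : unaryLang.Structure M' := unaryStructure A'; φ.Realize (h ∘ v))

/-- The family `I` of tuples is independent over `Y`: each member is independent over `Y`
from the union of the other members. -/
def IndepFamily (Y : Set M) (I : Set (Σ m : ℕ, Fin m → M)) : Prop :=
  ∀ t ∈ I, TupIndepOver (L := L) t.2 (⋃ s ∈ I \ {t}, Set.range s.2) Y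

/-- `tp(t / Y)` belongs to the family `P` of regular stationary types nonorthogonal to
`p* = tp(dstar / Pbase)`. -/
def InP {nd : ℕ} (Pbase : Set M) (dstar : Fin nd → M) {m : ℕ} (Y : Set M)
    (t : Fin m → M) : Prop :=
  TypeRegular (L := L) Y t ∧ TypeStationary (L := L) Y t ∧
    ¬ TypesOrthogonal (L := L) Y t Pbase dstar

/-- The `P`-weight `w_P(X, Y)` of the set `X` over the set `Y`, where
`P = {p : p regular, stationary, nonorthogonal to p* = tp(dstar / Pbase)}`: the supremum
of cardinalities of `Y`-independent families of tuples realizing types in `P` over `Y`,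
each of which forks with `X` over `Y`. -/
noncomputable def wP {nd : ℕ} (Pbase : Set M) (dstar : Fin nd → M) (X Y : Set M) :
    Cardinal.{u} :=
  sSup { c : Cardinal.{u} | ∃ I : Set (Σ m : ℕ, Fin m → M), #I = c ∧
    IndepFamily (L := L) Y I ∧
    ∀ t ∈ I, InP (L := L) Pbase dstar Y t.2 ∧
      TupForksOver (L := L) t.2 (Y ∪ X) Y }

/-- The set of realizations in `X` of the (1-)type `tp(e / B)`. -/
def qSet (B : Set M) (e : M) (X : Set M) : Set M :=
  {x ∈ X | SameTypeOver (L := L) B ![x] ![e]}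

/-- `dim(tp(d / B), N)` is finite: there is no infinite sequence of realizations of the
type in `N`, chosen successively independent. -/
def DimFinite (B : Set M) {n : ℕ} (d : Fin n → M) (N : Set M) : Prop :=
  ¬ ∃ f : ℕ → Fin n → M,
    ∀ j : ℕ, (∀ i, f j i ∈ N) ∧ SameTypeOver (L := L) B d (f j) ∧
      ¬ TupForksOver (L := L) (f j) (B ∪ ⋃ l ∈ Set.Iio j, Set.range (f l)) B

/-- The definable subsets (with parameters) of `N^n`. -/
def DefSet (N : Type u) [L.Structure N] (n : ℕ) : Set (Set (Fin n → N)) :=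
  {X | ∃ (m : ℕ) (φ : L.Formula (Fin n ⊕ Fin m)) (b : Fin m → N),
    X = {v | φ.Realize (Sum.elim v b)}}

/-- The Morley rank of the (definable) set `X` is at least `α`. -/
def MRge {N : Type u} [L.Structure N] {n : ℕ} (X : Set (Fin n → N)) (α : Ordinal.{u}) :
    Prop :=
  X.Nonempty ∧ ∀ β, β < α → ∃ f : ℕ → Set (Fin n → N),
    (∀ i, f i ∈ DefSet (L := L) N n ∧ f i ⊆ X ∧ MRge (f i) β) ∧
    Pairwise (Function.onFun Disjoint f)
termination_by α
decreasing_by exact ‹β < α›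

/-- The theory `T` has Morley rank `2`: in every `ℵ₀`-saturated model, the rank of the
whole universe (in one variable) is exactly `2`. -/
def MorleyRankTwo (L : FirstOrder.Language.{u, u}) (T : L.Theory) : Prop :=
  ∀ (N : Type u) (_ : L.Structure N), N ⊨ T → SaturatedIn (M := N) L ℵ₀ →
    MRge (L := L) (Set.univ : Set (Fin 1 → N)) 2 ∧
      ¬ MRge (L := L) (Set.univ : Set (Fin 1 → N)) 3

/-- `T` has NDOP: in any sufficiently saturated model, for elementary substructures
`N₁, N₂` independent over a common elementary substructure `N₀`, and `N₃` prime over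
`N₁ ∪ N₂`, every nonalgebraic type over `N₃` is nonorthogonal to `N₁` or to `N₂`. -/
def NDOP (L : FirstOrder.Language.{u, u}) (T : L.Theory) : Prop :=
  ∀ (N : Type u) (_ : L.Structure N), N ⊨ T →
    SaturatedIn (M := N) L (Order.succ ℵ₀) →
    ∀ N₀ N₁ N₂ N₃ : Set N,
      ElemSubset (L := L) N₀ → ElemSubset (L := L) N₁ → ElemSubset (L := L) N₂ →
      N₀ ⊆ N₁ → N₀ ⊆ N₂ → IndepOver (L := L) N₁ N₂ N₀ →
      KappaPrimeOver (L := L) ℵ₀ N₃ (N₁ ∪ N₂) →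
      ∀ (n : ℕ) (d : Fin n → N), ¬ AlgebraicTp (L := L) N₃ d →
        ¬ TypeOrthSet (L := L) N₃ d N₁ ∨ ¬ TypeOrthSet (L := L) N₃ d N₂

/-- The setup of Section 2 of the paper: a witness to the failure of weak benignity for a
superstable theory, refined as in the characterization lemma, together with the tuple
`c`, the regular type `p* = tp(dstar / Ma)`, the base `C` (with `B = acl(C)`), the
`B`-indiscernible sequence `cseq` of copies of `c`, and the `P`-simple type
`q = tp(e / B)` of positive finite `P`-weight. -/
structure WSetup (L : FirstOrder.Language.{u, u}) (M : Type u) [L.Structure M] where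
  κ : Cardinal.{u}
  A : Set M
  a : M
  b : M
  Astar : Set M
  Ma : Set M
  Mb : Set M
  Na : Set M
  g : M → M
  nc : ℕ
  c : Fin nc → M
  nd : ℕ
  dstar : Fin nd → M
  C : Set M
  cseq : ℕ → Fin nc → M
  e : M
  k : ℕ
  superstable : Superstable L (L.completeTheory M)
  reg : κ.IsRegular
  pow : κ ^ cardL L = κ
  pairSat : PairSaturated (L := L) A (Order.succ κ)
  witness : CharWitness (L := L) κ A a b Astar Ma Mb Na g
  hc : ∀ i, c i ∈ Ma
  hdNa : ∀ i, dstar i ∈ Na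
  hdnotMa : ¬ ∀ i, dstar i ∈ Ma
  regularP : TypeRegular (L := L) Ma dstar
  statP : TypeStationary (L := L) (Set.range c) dstar
  nfP : ¬ TupForksOver (L := L) dstar Ma (Set.range c)
  nonorthAstar : ¬ TypeOrthSet (L := L) Ma dstar Astar
  hCsub : C ⊆ Astar
  cardC : #C ≤ cardL L
  cIndep : TupIndepOver (L := L) c Astar C
  cseq0 : cseq 0 = c
  cseqMa : ∀ j i, cseq j i ∈ Ma
  indisc : IndiscOver (L := L) (aclSet (L := L) C) cseq
  cseqTp : ∀ j, SameTypeOver (L := L) (aclSet (L := L) C) (cseq j) c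
  qSimple : wP (L := L) Ma dstar {e} (aclSet (L := L) C) < ℵ₀
  qPos : 0 < wP (L := L) Ma dstar {e} (aclSet (L := L) C)
  qAcl : ∀ x : M, SameTypeOver (L := L) (aclSet (L := L) C) ![x] ![e] →
    x ∈ aclSet (L := L) (aclSet (L := L) C ∪ (⋃ i ∈ Set.Iio k, Set.range (cseq i)) ∪
      {y | ∃ (d : Fin nd → M) (i : ℕ), i < k ∧
        SameTypeOver (L := L) (aclSet (L := L) C)
          (Sum.elim d (cseq i)) (Sum.elim dstar c) ∧ y ∈ Set.range d})
  omitted : ¬ ∃ y : Fin nd → M, RealizesGType (L := L) Ma g dstar y ∧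
    TupIndepOver (L := L) y A Mb

end Benign

set_option linter.unusedSectionVars false

namespace Benign

open FirstOrder Language Cardinal

section Toolkit

open Set

variable (L : FirstOrder.Language.{u, u}) {M : Type u} [L.Structure M]

/-- Equality of types over `A`, in terms of definable sets. -/
def EqTp (A : Set M) {α : Type} (x y : α → M) : Prop :=
  ∀ s : Set (α → M), A.Definable L s → (x ∈ s ↔ y ∈ s)

theorem elim_comp_swap {α β γ : Type*} (f : α → γ) (g : β → γ) :
    Sum.elim f g ∘ Sum.swap = Sum.elim g f := by
  ext (i | i) <;> rfl

variable {L} {A B C D : Set M} {α β γ δ : Type}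

theorem sameTypeOver_iff {x y : α → M} : SameTypeOver (L := L) A x y ↔ EqTp L A x y := by
  constructor
  · intro h s hs
    obtain ⟨φ, rfl⟩ := definable_iff_exists_formula_sum.1 hs
    have := h (φ.relabel Sum.swap)
    simpa [Formula.realize_relabel, elim_comp_swap] using this
  · intro h φ
    have := h {v | (φ.relabel Sum.swap).Realize (Sum.elim ((↑) : A → M) v)}
      (definable_iff_exists_formula_sum.2 ⟨_, rfl⟩)
    simpa [Formula.realize_relabel, elim_comp_swap] using this

theorem EqTp.refl (x : α → M) : EqTp L A x x := fun _ _ => Iff.rfl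

theorem EqTp.symm {x y : α → M} (h : EqTp L A x y) : EqTp L A y x := fun s hs => (h s hs).symm

theorem EqTp.trans {x y z : α → M} (h : EqTp L A x y) (h' : EqTp L A y z) : EqTp L A x z :=
  fun s hs => (h s hs).trans (h' s hs)

theorem EqTp.mono {x y : α → M} (h : EqTp L B x y) (hAB : A ⊆ B) : EqTp L A x y :=
  fun s hs => h s (hs.mono hAB)

theorem EqTp.comp {x y : α → M} (h : EqTp L A x y) (f : β → α) : EqTp L A (x ∘ f) (y ∘ f) :=
  fun s hs => h ((fun g : α → M => g ∘ f) ⁻¹' s) (hs.preimage_comp f)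

theorem EqTp.inl {x y : α → M} {z w : β → M} (h : EqTp L A (Sum.elim x z) (Sum.elim y w)) :
    EqTp L A x y := by simpa using h.comp Sum.inl

theorem EqTp.inr {x y : α → M} {z w : β → M} (h : EqTp L A (Sum.elim x z) (Sum.elim y w)) :
    EqTp L A z w := by simpa using h.comp Sum.inr

/-- The fibre of a set of tuples. -/
def fib (s : Set (α ⊕ β → M)) (b : β → M) : Set (α → M) := {a | Sum.elim a b ∈ s}

@[simp] theorem mem_fib {s : Set (α ⊕ β → M)} {b : β → M} {a : α → M} :
    a ∈ fib s b ↔ Sum.elim a b ∈ s := Iff.rfl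

theorem definable_fib {s : Set (α ⊕ β → M)} (hs : A.Definable L s) (b : β → M) :
    (A ∪ range b).Definable L (fib s b) := by
  obtain ⟨φ, rfl⟩ := definable_iff_exists_formula_sum.1 hs
  refine definable_iff_exists_formula_sum.2
    ⟨φ.relabel (Sum.elim (fun p => Sum.inl ⟨p.1, Or.inl p.2⟩)
      (Sum.elim Sum.inr (fun j => Sum.inl ⟨b j, Or.inr ⟨j, rfl⟩⟩))), ?_⟩
  ext a
  simp only [mem_fib, Set.mem_ofPred_eq, Formula.realize_relabel]
  apply iff_of_eq
  congr 1
  ext (p | i | j) <;> simp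

theorem exists_fib {s : Set (α → M)} {b : β → M} (hs : (A ∪ range b).Definable L s) :
    ∃ t : Set (α ⊕ β → M), A.Definable L t ∧ s = fib t b := by
  classical
  obtain ⟨φ, rfl⟩ := definable_iff_exists_formula_sum.1 hs
  have key : ∀ p : ↥(A ∪ range b), ∃ q : A ⊕ (α ⊕ β), ∀ a : α → M,
      Sum.elim (fun x : A => (x : M)) (Sum.elim a b) q = p := by
    rintro ⟨p, hp | ⟨j, rfl⟩⟩
    · exact ⟨Sum.inl ⟨p, hp⟩, fun a => rfl⟩
    · exact ⟨Sum.inr (Sum.inr j), fun a => rfl⟩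
  choose q hq using key
  refine ⟨_, definable_iff_exists_formula_sum.2
    ⟨φ.relabel (Sum.elim q (fun i => Sum.inr (Sum.inl i))), rfl⟩, ?_⟩
  ext a
  simp only [mem_fib, Set.mem_ofPred_eq, Formula.realize_relabel]
  apply iff_of_eq
  congr 1
  ext (p | i)
  · simp [hq]
  · simp

theorem eqTp_sum_iff {a a' : α → M} {b : β → M} :
    EqTp L A (Sum.elim a b) (Sum.elim a' b) ↔ EqTp L (A ∪ range b) a a' := by
  constructor
  · intro h s hs
    obtain ⟨t, ht, rfl⟩ := exists_fib hs
    exact h t ht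
  · intro h s hs
    exact h _ (definable_fib hs b)

theorem exists_fib_fin {s : Set (α → M)} (hs : B.Definable L s) :
    ∃ (n : ℕ) (e : Fin n → M) (t : Set (α ⊕ Fin n → M)), range e ⊆ B ∧
      (∅ : Set M).Definable L t ∧ s = fib t e := by
  obtain ⟨A0, hA0, h⟩ := definable_iff_finitely_definable.1 hs
  have hr : (∅ : Set M) ∪ range (fun i => (A0.equivFin.symm i : M)) = A0 := by
    ext x
    simp only [empty_union, mem_range, Finset.mem_coe]
    constructor
    · rintro ⟨i, rfl⟩; exact (A0.equivFin.symm i).2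
    · intro hx; exact ⟨A0.equivFin ⟨x, hx⟩, by simp⟩
  rw [← hr] at h
  obtain ⟨t, ht, rfl⟩ := exists_fib h
  exact ⟨_, _, t, by rw [← empty_union (range _), hr]; exact hA0, ht, rfl⟩

theorem exists_fib_fin' {s : Set (α → M)} (hs : (A ∪ B).Definable L s) :
    ∃ (n : ℕ) (e : Fin n → M) (t : Set (α ⊕ Fin n → M)), range e ⊆ B ∧
      A.Definable L t ∧ s = fib t e := by
  classical
  obtain ⟨n, e, t, he, ht, rfl⟩ := exists_fib_fin hs
  have : (A ∪ (B ∩ range e)).Definable L (fib t e) := (definable_fib ht e).mono (by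
    rintro x (hx | hx)
    · exact hx.elim
    · rcases he hx with h | h
      · exact Or.inl h
      · exact Or.inr ⟨h, hx⟩)
  have hfin : (B ∩ range e).Finite := (finite_range e).inter_of_right _
  obtain ⟨m, f, hf⟩ := hfin.fin_param
  rw [← hf.2] at this
  obtain ⟨t', ht', h⟩ := exists_fib this
  exact ⟨m, f, t', by rw [hf.2]; exact inter_subset_left, ht', h⟩

theorem eqTp_iff_fin {x y : α → M} : EqTp L B x y ↔
    ∀ (n : ℕ) (e : Fin n → M), range e ⊆ B → EqTp L ∅ (Sum.elim x e) (Sum.elim y e) := by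
  constructor
  · intro h n e he
    rw [eqTp_sum_iff]
    exact h.mono (by simpa using he)
  · intro h s hs
    obtain ⟨n, e, t, he, ht, rfl⟩ := exists_fib_fin hs
    exact h n e he t ht

variable (L M) in
/-- The standing assumptions: `M` is `κ⁺`-saturated and its theory is superstable. -/
structure Ctx (κ : Cardinal.{u}) : Prop where
  inf : ℵ₀ ≤ κ
  sat : SaturatedIn (M := M) L (Order.succ κ)
  ss : Superstable L (L.completeTheory M)

variable {κ : Cardinal.{u}}

theorem small_union (H : ℵ₀ ≤ κ) (hA : #A ≤ κ) (hB : #B ≤ κ) : #↥(A ∪ B) ≤ κ :=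
  (mk_union_le A B).trans (add_le_of_le H hA hB)

theorem small_range (H : ℵ₀ ≤ κ) {ι : Type} [Countable ι] (f : ι → M) : #(range f) ≤ κ :=
  (mk_le_aleph0_iff.2 (countable_range f).to_subtype).trans H

theorem small_finite (H : ℵ₀ ≤ κ) (hA : A.Finite) : #A ≤ κ :=
  (hA.lt_aleph0.le).trans H

theorem small_iUnion (H : ℵ₀ ≤ κ) {ι : Type} [Countable ι] (f : ι → Set M)
    (h : ∀ i, #(f i) ≤ κ) : #(⋃ i, f i) ≤ κ := by
  have h1 := mk_iUnion_le_sum_mk_lift (f := f)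
  have h2 : Cardinal.sum (fun i => #(f i)) ≤ Cardinal.sum (fun _ : ι => κ) := sum_le_sum _ _ h
  rw [sum_const] at h2
  have h3 : lift.{u} #ι ≤ ℵ₀ := by simp [mk_le_aleph0]
  simp only [lift_id'] at h1 h2
  exact h1.trans (h2.trans ((mul_le_mul' h3 le_rfl).trans (mul_le_of_le H H le_rfl)))

theorem small_mono (h : A ⊆ B) (hB : #B ≤ κ) : #A ≤ κ := (mk_le_mk_of_subset h).trans hB

theorem sat_one (H : SaturatedIn (M := M) L (Order.succ κ)) (hC : #C ≤ κ) (F : Set (Set (Fin 1 → M)))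
    (hF : ∀ s ∈ F, C.Definable L s)
    (hfip : ∀ G : Set (Set (Fin 1 → M)), G.Finite → G ⊆ F → (⋂₀ G).Nonempty) :
    ∃ x : Fin 1 → M, ∀ s ∈ F, x ∈ s := by
  classical
  have h1 : ∀ x : Fin 1 → M, ![x 0] = x := fun x => by ext i; fin_cases i; rfl
  let R : L.Formula (Fin 1 ⊕ ↥C) → Set (Fin 1 → M) :=
    fun φ => {x | φ.Realize (Sum.elim x Subtype.val)}
  obtain ⟨x, hx⟩ := H C (Order.lt_succ_iff.2 hC) {φ | R φ ∈ F} (by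
    intro fs hfs
    obtain ⟨x, hx⟩ := hfip (R '' fs) (fs.finite_toSet.image _) (by
      rintro _ ⟨φ, hφ, rfl⟩; exact hfs hφ)
    refine ⟨x 0, fun φ hφ => ?_⟩
    rw [h1]
    exact hx (R φ) ⟨φ, hφ, rfl⟩)
  refine ⟨![x], fun s hs => ?_⟩
  obtain ⟨φ, rfl⟩ := definable_iff_exists_formula_sum.1 (hF s hs)
  have h2 : {v | φ.Realize (Sum.elim (↑) v)} = R (φ.relabel Sum.swap) := by
    ext v; simp [R, Formula.realize_relabel]
  rw [h2] at hs ⊢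
  exact hx _ hs

theorem realize_ultrafilter (H : Ctx L M κ) [Finite α] :
    ∀ (C : Set M), #C ≤ κ → ∀ u : Ultrafilter (α → M),
      ∃ a : α → M, ∀ s, C.Definable L s → (a ∈ s ↔ s ∈ u) := by
  suffices ∀ (C : Set M), #C ≤ κ → ∀ u : Ultrafilter (α → M),
      ∃ a : α → M, ∀ s, C.Definable L s → s ∈ u → a ∈ s by
    intro C hC u
    obtain ⟨a, ha⟩ := this C hC u
    refine ⟨a, fun s hs => ⟨fun h => ?_, ha s hs⟩⟩
    by_contra h'
    exact ha _ hs.compl (Ultrafilter.compl_mem_iff_notMem.2 h') h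
  refine Finite.induction_empty_option (P := fun α : Type => ∀ (C : Set M), #C ≤ κ →
    ∀ u : Ultrafilter (α → M), ∃ a : α → M, ∀ s, C.Definable L s → s ∈ u → a ∈ s) ?_ ?_ ?_ α
  · intro α β e ih C hC u
    obtain ⟨a, ha⟩ := ih C hC (u.map (fun g => g ∘ e))
    refine ⟨a ∘ e.symm, fun s hs hsu => ?_⟩
    refine ha ((fun g => g ∘ e.symm) ⁻¹' s) (hs.preimage_comp _) ?_
    rw [Ultrafilter.mem_map]
    convert hsu
    ext g
    simp [Function.comp_assoc]
  · intro C hC u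
    refine ⟨PEmpty.elim, fun s hs hsu => ?_⟩
    obtain ⟨x, hx⟩ := u.nonempty_of_mem hsu
    rwa [Subsingleton.elim x PEmpty.elim] at hx
  · intro α _ ih C hC u
    obtain ⟨a, ha⟩ := ih C hC (u.map (fun g => g ∘ some))
    let ρ : Option α → Fin 1 ⊕ α := fun o => o.elim (Sum.inl 0) Sum.inr
    let T : Set (Option α → M) → Set (Fin 1 → M) :=
      fun s => fib ((fun g : Fin 1 ⊕ α → M => g ∘ ρ) ⁻¹' s) a
    obtain ⟨x, hx⟩ := sat_one H.sat (C := C ∪ range a)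
      (small_union H.inf hC (small_range H.inf a)) {t | ∃ s, C.Definable L s ∧ s ∈ u ∧ t = T s}
      (by
        rintro _ ⟨s, hs, _, rfl⟩
        exact definable_fib (hs.preimage_comp _) a)
      (by
        intro G hG hGF
        have : ∃ s, C.Definable L s ∧ s ∈ u ∧ T s ⊆ ⋂₀ G := by
          induction G, hG using Set.Finite.induction_on with
          | empty => exact ⟨univ, definable_univ, Filter.univ_mem, by simp⟩
          | insert _ _ ih' =>
            obtain ⟨s, hs, hsu, hsG⟩ := ih' (fun t ht => hGF (Or.inr ht))
            obtain ⟨s', hs', hsu', rfl⟩ := hGF (Or.inl rfl)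
            refine ⟨s ∩ s', hs.inter hs', Filter.inter_mem hsu hsu', ?_⟩
            rw [sInter_insert]
            exact fun x hx => ⟨hx.2, hsG hx.1⟩
        obtain ⟨s, hs, hsu, hsG⟩ := this
        have := ha ((fun g : Option α → M => g ∘ some) '' s) (hs.image_comp _)
          (by
            rw [Ultrafilter.mem_map]
            exact Filter.mem_of_superset hsu (subset_preimage_image _ _))
        obtain ⟨g, hg, hga⟩ := this
        refine ⟨fun _ => g none, hsG ?_⟩
        change Sum.elim _ a ∘ ρ ∈ s
        convert hg using 1
        ext (_ | i)
        · rfl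
        · simp [ρ, ← hga])
    refine ⟨fun o => o.elim (x 0) a, fun s hs hsu => ?_⟩
    have := hx _ ⟨s, hs, hsu, rfl⟩
    change Sum.elim _ a ∘ ρ ∈ s at this
    convert this using 1
    ext (_ | i) <;> rfl

/-- Finitely satisfiable families of definable sets over a small set are realized. -/
theorem realize_fip (H : Ctx L M κ) [Finite α] (hC : #C ≤ κ) (F : Set (Set (α → M)))
    (hF : ∀ s ∈ F, C.Definable L s)
    (hfip : ∀ G : Set (Set (α → M)), G.Finite → G ⊆ F → (⋂₀ G).Nonempty) :
    ∃ x : α → M, ∀ s ∈ F, x ∈ s := by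
  have : (Filter.generate F).NeBot := Filter.generate_neBot_iff.2 (fun t ht htf => hfip t htf ht)
  obtain ⟨a, ha⟩ := realize_ultrafilter H C hC (Ultrafilter.of (Filter.generate F))
  exact ⟨a, fun s hs => (ha s (hF s hs)).2
    (Ultrafilter.of_le _ (Filter.mem_generate_of_mem hs))⟩

theorem copy_finite (H : Ctx L M κ) [Finite α] [Countable β] (hC : #C ≤ κ) {b b' : β → M}
    (hb : EqTp L C b b') (a : α → M) :
    ∃ a' : α → M, EqTp L C (Sum.elim a b) (Sum.elim a' b') := by
  obtain ⟨a', ha'⟩ := realize_fip H (C := C ∪ range b')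
    (small_union H.inf hC (small_range H.inf b'))
    {t | ∃ s : Set (α ⊕ β → M), C.Definable L s ∧ Sum.elim a b ∈ s ∧ t = fib s b'}
    (by rintro _ ⟨s, hs, _, rfl⟩; exact definable_fib hs b')
    (by
      intro G hG hGF
      have : ∃ s : Set (α ⊕ β → M), C.Definable L s ∧ Sum.elim a b ∈ s ∧ fib s b' ⊆ ⋂₀ G := by
        induction G, hG using Set.Finite.induction_on with
        | empty => exact ⟨univ, definable_univ, mem_univ _, by simp⟩
        | insert _ _ ih' =>
          obtain ⟨s, hs, hsu, hsG⟩ := ih' (fun t ht => hGF (Or.inr ht))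
          obtain ⟨s', hs', hsu', rfl⟩ := hGF (Or.inl rfl)
          refine ⟨s ∩ s', hs.inter hs', ⟨hsu, hsu'⟩, ?_⟩
          rw [sInter_insert]
          exact fun x hx => ⟨hx.2, hsG hx.1⟩
      obtain ⟨s, hs, hsu, hsG⟩ := this
      obtain ⟨g, hg⟩ := (hb {w | ∃ g : α → M, Sum.elim g w ∈ s} (by
        have := (hs.preimage_comp (Sum.swap : α ⊕ β → β ⊕ α)).exists_of_finite
        simpa [elim_comp_swap] using this)).1 ⟨_, hsu⟩
      exact ⟨g, hsG hg⟩)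
  refine ⟨a', fun s hs => ⟨fun h => ha' _ ⟨s, hs, h, rfl⟩, fun h => ?_⟩⟩
  by_contra h'
  exact ha' _ ⟨sᶜ, hs.compl, h', rfl⟩ h

theorem dc {X : Type*} (P : ℕ → (ℕ → X) → Prop)
    (loc : ∀ n g g', (∀ i < n, g' i = g i) → P n g → P n g') {g₀ : ℕ → X} (h0 : P 0 g₀)
    (step : ∀ n g, P n g → ∃ g', (∀ i < n, g' i = g i) ∧ P (n + 1) g') : ∃ g, ∀ n, P n g := by
  choose! F hF hP using step
  let G : ℕ → ℕ → X := fun n => Nat.rec g₀ F n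
  have hG : ∀ n, P n (G n) := fun n => by
    induction n with
    | zero => exact h0
    | succ n ih => exact hP n _ ih
  have hstep : ∀ m n, m ≤ n → ∀ i < m, G n i = G m i := by
    intro m n hmn
    induction n, hmn using Nat.le_induction with
    | base => exact fun _ _ => rfl
    | succ n hmn ih =>
      intro i hi
      rw [← ih i hi]
      exact hF n _ (hG n) i (hi.trans_le hmn)
  refine ⟨fun i => G (i + 1) i, fun n => loc n (G n) _ (fun i hi => ?_) (hG n)⟩
  exact (hstep (i + 1) n hi i (Nat.lt_succ_self i)).symm

theorem dc_greedy {X : Type*} [Nonempty X] (Q : ℕ → (ℕ → X) → X → Prop)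
    (loc : ∀ n g g', (∀ i < n, g' i = g i) → ∀ x, Q n g x → Q n g' x)
    (step : ∀ n g, (∀ i < n, Q i g (g i)) → ∃ x, Q n g x) : ∃ g, ∀ n, Q n g (g n) := by
  obtain ⟨g, hg⟩ := dc (fun n g => ∀ i < n, Q i g (g i)) (g₀ := fun _ => Classical.arbitrary X)
    (fun n g g' h hP i hi => by
      rw [h i hi]; exact loc i g g' (fun j hj => h j (hj.trans hi)) _ (hP i hi))
    (by simp)
    (fun n g hP => by
      obtain ⟨x, hx⟩ := step n g hP
      refine ⟨Function.update g n x, fun i hi => by simp [hi.ne], fun i hi => ?_⟩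
      rcases Nat.lt_succ_iff_lt_or_eq.1 hi with h | rfl
      · rw [Function.update_of_ne h.ne]
        exact loc i g _ (fun j hj => by simp [(hj.trans h).ne]) _ (hP i h)
      · rw [Function.update_self]
        exact loc i g _ (fun j hj => by simp [hj.ne]) _ hx)
  exact ⟨g, fun n => hg (n + 1) n (Nat.lt_succ_self n)⟩

theorem definable_eq (i j : α) : A.Definable L {x : α → M | x i = x j} := by
  refine (Set.Definable.mono (A := ∅) ?_ (empty_subset A))
  exact empty_definable_iff.2 ⟨Term.equal (Term.var i) (Term.var j), by
    ext x; simp [Formula.realize_equal]⟩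

theorem EqTp.eq_iff {x y : α → M} (h : EqTp L A x y) (i j : α) : x i = x j ↔ y i = y j :=
  h {x | x i = x j} (definable_eq i j)

theorem exists_finite_support {s : Set (α → M)} (hs : A.Definable L s) :
    ∃ (F : Finset α) (t : Set (F → M)), A.Definable L t ∧ s = (fun x => x ∘ (↑)) ⁻¹' t := by
  classical
  obtain ⟨φ, rfl⟩ := hs
  refine ⟨φ.freeVarFinset, {v | Formula.Realize (φ.restrictFreeVar id) v}, ⟨_, rfl⟩, ?_⟩
  ext x
  simp only [mem_preimage, mem_ofPred_eq, Formula.Realize]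
  exact (BoundedFormula.realize_restrictFreeVar (φ := φ) (f := id)
    (v := x ∘ Subtype.val) x (fun _ => rfl)).symm

theorem eqTp_iff_finset {x y : α → M} :
    EqTp L A x y ↔ ∀ F : Finset α, EqTp L A (x ∘ ((↑) : F → α)) (y ∘ ((↑) : F → α)) := by
  refine ⟨fun h F => h.comp _, fun h s hs => ?_⟩
  obtain ⟨F, t, ht, rfl⟩ := exists_finite_support hs
  exact h F t ht

theorem eqTp_nat {x y : ℕ → M} {b b' : β → M}
    (h : ∀ n, EqTp L A (Sum.elim (fun i : Fin n => x i) b) (Sum.elim (fun i : Fin n => y i) b')) :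
    EqTp L A (Sum.elim x b) (Sum.elim y b') := by
  classical
  rw [eqTp_iff_finset]
  intro F
  obtain ⟨n, hn⟩ : ∃ n : ℕ, ∀ i : ℕ, Sum.inl i ∈ F → i < n := by
    refine ⟨F.sup (Sum.elim (fun i => i + 1) (fun _ => 0)), fun i hi => ?_⟩
    exact Finset.le_sup (f := Sum.elim (fun i => i + 1) (fun _ => 0)) hi
  let ρ : F → Fin n ⊕ β := fun p => match p with
    | ⟨Sum.inl i, hi⟩ => Sum.inl ⟨i, hn i hi⟩
    | ⟨Sum.inr j, _⟩ => Sum.inr j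
  have := (h n).comp ρ
  convert this using 1 <;> · ext ⟨i | j, hi⟩ <;> rfl

theorem copy (H : Ctx L M κ) [Countable α] [Countable β] (hC : #C ≤ κ) {b b' : β → M}
    (hb : EqTp L C b b') (a : α → M) :
    ∃ a' : α → M, EqTp L C (Sum.elim a b) (Sum.elim a' b') := by
  rcases isEmpty_or_nonempty α with hα | hα
  · exact copy_finite H hC hb a
  obtain ⟨e, he⟩ := exists_surjective_nat α
  obtain ⟨f, hf⟩ := dc (fun n g => EqTp L C (Sum.elim (fun i : Fin n => a (e i)) b)
      (Sum.elim (fun i : Fin n => g i) b')) (g₀ := a ∘ e)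
    (fun n g g' h hP => by
      have : (fun i : Fin n => g' i) = fun i : Fin n => g i := by
        ext i; exact h i i.2
      rwa [this])
    (by
      have := hb.comp (Sum.elim Fin.elim0 id : Fin 0 ⊕ β → β)
      convert this using 1 <;> · ext (i | i); exact i.elim0; rfl)
    (fun n g hP => by
      obtain ⟨x, hx⟩ := copy_finite H hC hP (fun _ : Fin 1 => a (e n))
      refine ⟨Function.update g n (x 0), fun i hi => by simp [hi.ne], ?_⟩
      have := hx.comp (Sum.elim (fun i : Fin (n + 1) => if h : (i : ℕ) < n then
        Sum.inr (Sum.inl ⟨i, h⟩) else Sum.inl 0) (Sum.inr ∘ Sum.inr) : Fin (n + 1) ⊕ β →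
          Fin 1 ⊕ (Fin n ⊕ β))
      convert this using 1
      · ext (i | i)
        · by_cases h : (i : ℕ) < n
          · simp [h]
          · have h' : (i : ℕ) = n := by omega
            simp [h']
        · rfl
      · ext (i | i)
        · by_cases h : (i : ℕ) < n
          · simp [h, h.ne]
          · have h' : (i : ℕ) = n := by omega
            simp [h']
        · rfl)
  have h := eqTp_nat (x := a ∘ e) hf
  obtain ⟨σ, hσ⟩ := he.hasRightInverse
  refine ⟨f ∘ σ, ?_⟩
  have := h.comp (Sum.elim (Sum.inl ∘ σ) Sum.inr : α ⊕ β → ℕ ⊕ β)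
  convert this using 1
  · ext (i | i)
    · simp [hσ i]
    · rfl
  · ext (i | i) <;> rfl

theorem realize_ultrafilter_countable (H : Ctx L M κ) [Countable α] (hC : #C ≤ κ)
    (u : Ultrafilter (α → M)) : ∃ a : α → M, ∀ s, C.Definable L s → (a ∈ s ↔ s ∈ u) := by
  rcases isEmpty_or_nonempty α with hα | hα
  · exact realize_ultrafilter H C hC u
  obtain ⟨e, he⟩ := exists_surjective_nat α
  obtain ⟨σ, hσ⟩ := he.hasRightInverse
  obtain ⟨f, hf⟩ := dc (fun n g => ∀ s : Set (Fin n → M), C.Definable L s →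
      ((fun i : Fin n => g i) ∈ s ↔ {x : α → M | (fun i : Fin n => x (e i)) ∈ s} ∈ u))
    (g₀ := (Classical.choice u.neBot.nonempty : α → M) ∘ e)
    (fun n g g' h hP => by
      have : (fun i : Fin n => g' i) = fun i : Fin n => g i := by
        ext i; exact h i i.2
      rwa [this])
    (by
      intro s hs
      have h1 : ∀ x : α → M, (fun i : Fin 0 => x (e i)) = fun i => i.elim0 :=
        fun x => Subsingleton.elim _ _
      simp only [h1]
      rw [Subsingleton.elim (fun i : Fin 0 => _) (fun i => i.elim0 : Fin 0 → M)]
      by_cases h : (fun i => i.elim0 : Fin 0 → M) ∈ s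
      · simp only [h, true_iff]; exact Filter.univ_mem
      · simp [h])
    (fun n g hP => by
      obtain ⟨a, ha⟩ := realize_ultrafilter H C hC
        (u.map (fun x => (fun i : Fin (n + 1) => x (e i))))
      have hab : EqTp L C (fun i : Fin n => a i.castSucc) (fun i : Fin n => g i) := by
        intro s hs
        rw [hP s hs]
        exact ha ((fun x => x ∘ Fin.castSucc) ⁻¹' s) (hs.preimage_comp _)
      obtain ⟨x, hx⟩ := copy_finite H hC hab (fun _ : Fin 1 => a (Fin.last n))
      refine ⟨Function.update g n (x 0), fun i hi => by simp [hi.ne], fun s hs => ?_⟩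
      have := hx.comp (fun i : Fin (n + 1) => if h : (i : ℕ) < n then
        Sum.inr ⟨i, h⟩ else Sum.inl 0)
      rw [← show ((fun i : Fin (n + 1) => a i) ∈ s ↔
        {x : α → M | (fun i : Fin (n + 1) => x (e i)) ∈ s} ∈ u) from ha s hs]
      convert (this s hs).symm using 2
      · ext i
        by_cases h : (i : ℕ) < n
        · simp [h, h.ne]
        · have h' : (i : ℕ) = n := by omega
          simp [h']
      · ext i
        by_cases h : (i : ℕ) < n
        · simp [h]
        · have h' : i = Fin.last n := by ext; simp; omega
          simp [h'])
  refine ⟨f ∘ σ, fun s hs => ?_⟩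
  classical
  obtain ⟨F, t, ht, rfl⟩ := exists_finite_support hs
  obtain ⟨n, hn⟩ : ∃ n : ℕ, ∀ i ∈ F, σ i < n := by
    refine ⟨F.sup (fun i => σ i + 1), fun i hi => ?_⟩
    exact Finset.le_sup (f := fun i => σ i + 1) hi
  have := hf n ((fun x => x ∘ (fun i : F => ⟨σ i, hn i i.2⟩)) ⁻¹' t) (ht.preimage_comp _)
  refine this.trans ?_
  simp only [mem_preimage]
  have h2 : ∀ x : α → M, (fun i : Fin n => x (e i)) ∘ (fun i : F => ⟨σ i, hn i i.2⟩)
    = x ∘ ((↑) : F → α) := fun x => by ext i; simp [hσ (i : α)]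
  simp only [h2]
  rfl

end Toolkit

section Forking

open Set

variable {L : FirstOrder.Language.{u, u}} {M : Type u} [L.Structure M]
  {κ : Cardinal.{u}} {A B C D E : Set M} {α β γ δ ι : Type}

/-- The instances of `t` along `f` are `k`-inconsistent. -/
def KInc (t : Set (α ⊕ ι → M)) (k : ℕ) (f : ℕ → ι → M) : Prop :=
  ∀ S : Finset ℕ, S.card = k → ¬ ∃ a : α → M, ∀ j ∈ S, Sum.elim a (f j) ∈ t

variable (L) in
/-- The fibre of `t` at `b` divides over `C`. -/
def Div (C : Set M) (t : Set (α ⊕ ι → M)) (b : ι → M) : Prop :=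
  ∃ f : ℕ → ι → M, (∀ i, EqTp L C (f i) b) ∧ ∃ k > 0, KInc t k f

theorem definable_forall_mem {t : Set (α ⊕ ι → M)} (ht : A.Definable L t) (S : Finset ℕ) :
    A.Definable L {x : α ⊕ (ℕ × ι) → M | ∀ j ∈ S,
      Sum.elim (x ∘ Sum.inl) (fun i => x (Sum.inr (j, i))) ∈ t} := by
  have := definable_biInter_finset (s := S) (fun j : ℕ => ht.preimage_comp
    (Sum.elim Sum.inl (fun i => Sum.inr (j, i)) : α ⊕ ι → α ⊕ (ℕ × ι)))
  convert this using 1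
  ext x
  simp only [mem_ofPred_eq, mem_iInter, mem_preimage]
  refine forall₂_congr fun j _ => ?_
  have : Sum.elim (x ∘ Sum.inl) (fun i => x (Sum.inr (j, i))) =
    x ∘ Sum.elim Sum.inl (fun i => Sum.inr (j, i)) := by ext (i | i) <;> rfl
  rw [this]

theorem definable_exists_fib [Finite α] {t : Set (α ⊕ β → M)} (ht : A.Definable L t) :
    A.Definable L {b : β → M | (fib t b).Nonempty} := by
  have := (ht.preimage_comp (Sum.swap : α ⊕ β → β ⊕ α)).exists_of_finite
  simpa [elim_comp_swap, Set.Nonempty] using this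

theorem KInc.congr [Finite α] {t : Set (α ⊕ ι → M)} (ht : A.Definable L t) {k : ℕ}
    {f g : ℕ → ι → M} (h : EqTp L A (fun p : ℕ × ι => f p.1 p.2) (fun p : ℕ × ι => g p.1 p.2))
    (hf : KInc t k f) : KInc t k g := by
  intro S hS hg
  exact hf S hS ((h _ (definable_exists_fib (definable_forall_mem ht S))).2 hg)

theorem definable_fib_subset [Finite α] {s : Set (α ⊕ β → M)} {t : Set (α ⊕ γ → M)}
    (hs : A.Definable L s) (ht : A.Definable L t) :
    A.Definable L {x : β ⊕ γ → M | fib s (x ∘ Sum.inl) ⊆ fib t (x ∘ Sum.inr)} := by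
  have := ((hs.preimage_comp (Sum.map id Sum.inl : α ⊕ β → α ⊕ (β ⊕ γ))).inter
    (ht.preimage_comp (Sum.map id Sum.inr : α ⊕ γ → α ⊕ (β ⊕ γ))).compl)
  convert (definable_exists_fib this).compl using 1
  ext x
  simp only [mem_ofPred_eq, mem_compl_iff, Set.not_nonempty_iff_eq_empty, Set.eq_empty_iff_forall_notMem]
  refine forall_congr' fun a => ?_
  simp [Sum.elim_comp_map]

theorem fib_subset_congr [Finite α] {s : Set (α ⊕ β → M)} {t : Set (α ⊕ γ → M)}
    (hs : A.Definable L s) (ht : A.Definable L t) {b b' : β → M} {d d' : γ → M}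
    (h : EqTp L A (Sum.elim b d) (Sum.elim b' d')) (hst : fib s b ⊆ fib t d) :
    fib s b' ⊆ fib t d' := by
  have := (h _ (definable_fib_subset hs ht)).1 (by simpa using hst)
  simpa using this

theorem EqTp.of_sum {a a' : α → M} {b : β → M} (h : EqTp L A (Sum.elim a b) (Sum.elim a' b)) :
    EqTp L (A ∪ range b) a a' := eqTp_sum_iff.1 h

theorem EqTp.swap {a a' : α → M} {b b' : β → M}
    (h : EqTp L A (Sum.elim a b) (Sum.elim a' b')) : EqTp L A (Sum.elim b a) (Sum.elim b' a') := by
  simpa [elim_comp_swap] using h.comp Sum.swap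

theorem Div.mono_base {t : Set (α ⊕ ι → M)} {b : ι → M} (h : Div L D t b) (hCD : C ⊆ D) :
    Div L C t b :=
  let ⟨f, hf, hk⟩ := h; ⟨f, fun i => (hf i).mono hCD, hk⟩

theorem Div.congr (H : Ctx L M κ) (hC : #C ≤ κ) [Finite α] [Countable ι] [Countable β]
    {t : Set (α ⊕ ι → M)} (ht : C.Definable L t) {b b' : β → M} {d d' : ι → M}
    (h : EqTp L C (Sum.elim b d) (Sum.elim b' d')) (hd : Div L (C ∪ range b) t d) :
    Div L (C ∪ range b') t d' := by
  obtain ⟨f, hf, k, hk, hinc⟩ := hd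
  obtain ⟨g, hg⟩ := copy H hC h (fun p : ℕ × ι => f p.1 p.2)
  refine ⟨fun n i => g (n, i), fun n => ?_, k, hk, hinc.congr ht hg.inl⟩
  have h1 := eqTp_sum_iff.2 (hf n)
  have h2 := hg.comp (Sum.elim (fun i => Sum.inl (n, i)) (Sum.inr ∘ Sum.inl) :
    ι ⊕ β → (ℕ × ι) ⊕ (β ⊕ ι))
  rw [← eqTp_sum_iff]
  have e1 : ∀ (x : ℕ × ι → M) (y : β → M) (z : ι → M), Sum.elim x (Sum.elim y z) ∘
    (Sum.elim (fun i => Sum.inl (n, i)) (Sum.inr ∘ Sum.inl)) =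
      Sum.elim (fun i => x (n, i)) y := by
    intro x y z; ext (i | i) <;> rfl
  rw [e1, e1] at h2
  exact h2.symm.trans (h1.trans h.swap)

theorem Div.of_subset (H : Ctx L M κ) (hC : #C ≤ κ) [Finite α] [Countable ι] [Countable β]
    {t : Set (α ⊕ ι → M)} {d : ι → M} (ht : C.Definable L t) {t' : Set (α ⊕ β → M)} {d' : β → M}
    (ht' : C.Definable L t') (hd : Div L C t d) (hsub : fib t' d' ⊆ fib t d) :
    Div L C t' d' := by
  obtain ⟨f, hf, k, hk, hinc⟩ := hd
  have : ∀ i, ∃ e : β → M, EqTp L C (Sum.elim d' d) (Sum.elim e (f i)) := fun i =>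
    copy H hC (hf i).symm d'
  choose e he using this
  refine ⟨e, fun i => (he i).inl.symm, k, hk, fun S hS ⟨a, ha⟩ => hinc S hS ⟨a, fun j hj => ?_⟩⟩
  exact fib_subset_congr ht' ht (he j) hsub (ha j hj)

variable (L) in
/-- `W` is covered by finitely many sets dividing over `C`. -/
def FI (C : Set M) (W : Set (α → M)) : Prop :=
  ∃ (ι : Type) (_ : Finite ι) (d : ι → M) (T : Set (Set (α ⊕ ι → M))), T.Finite ∧
    (∀ t ∈ T, (∅ : Set M).Definable L t ∧ Div L C t d) ∧ W ⊆ fib (⋃₀ T) d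

theorem FI.subset {W W' : Set (α → M)} (h : FI L C W) (hW : W' ⊆ W) : FI L C W' :=
  let ⟨ι, hι, d, T, hT, h1, h2⟩ := h; ⟨ι, hι, d, T, hT, h1, hW.trans h2⟩

theorem FI.mono_base {W : Set (α → M)} (h : FI L D W) (hCD : C ⊆ D) : FI L C W :=
  let ⟨ι, hι, d, T, hT, h1, h2⟩ := h
  ⟨ι, hι, d, T, hT, fun t ht => ⟨(h1 t ht).1, (h1 t ht).2.mono_base hCD⟩, h2⟩

theorem FI.empty : FI L C (∅ : Set (α → M)) :=
  ⟨Empty, inferInstance, Empty.elim, ∅, finite_empty, by simp, empty_subset _⟩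

theorem FI.of_div [Finite ι] {t : Set (α ⊕ ι → M)} (ht : (∅ : Set M).Definable L t) {d : ι → M}
    (h : Div L C t d) : FI L C (fib t d) :=
  ⟨ι, inferInstance, d, {t}, finite_singleton _,
    by simp only [mem_singleton_iff, forall_eq]; exact ⟨ht, h⟩, by simp⟩

theorem definable_sUnion {T : Set (Set (α → M))} (hT : T.Finite)
    (h : ∀ t ∈ T, A.Definable L t) : A.Definable L (⋃₀ T) := by
  induction T, hT using Set.Finite.induction_on with
  | empty => simp
  | insert _ _ ih =>
    rw [sUnion_insert]
    exact (h _ (mem_insert _ _)).union (ih fun t ht => h t (mem_insert_of_mem _ ht))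

theorem empty_small : #(∅ : Set M) ≤ κ := by simp

theorem FI.union (H : Ctx L M κ) (hC : #C ≤ κ) [Finite α] {W W' : Set (α → M)}
    (h : FI L C W) (h' : FI L C W') : FI L C (W ∪ W') := by
  obtain ⟨ι, hι, d, T, hT, h1, h2⟩ := h
  obtain ⟨ι', hι', d', T', hT', h1', h2'⟩ := h'
  have e1 : ∀ x : α → M, Sum.elim x (Sum.elim d d') ∘ (Sum.map id Sum.inl : α ⊕ ι → α ⊕ (ι ⊕ ι'))
      = Sum.elim x d := fun x => by ext (i | i) <;> rfl
  have e2 : ∀ x : α → M, Sum.elim x (Sum.elim d d') ∘ (Sum.map id Sum.inr : α ⊕ ι' → α ⊕ (ι ⊕ ι'))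
      = Sum.elim x d' := fun x => by ext (i | i) <;> rfl
  refine ⟨ι ⊕ ι', inferInstance, Sum.elim d d',
    ((fun t => (fun x => x ∘ Sum.map id Sum.inl) ⁻¹' t) '' T) ∪
    ((fun t => (fun x => x ∘ Sum.map id Sum.inr) ⁻¹' t) '' T'),
    (hT.image _).union (hT'.image _), ?_, ?_⟩
  · rintro _ (⟨t, ht, rfl⟩ | ⟨t, ht, rfl⟩)
    · refine ⟨(h1 t ht).1.preimage_comp _, (h1 t ht).2.of_subset H hC
        ((h1 t ht).1.mono (empty_subset _)) (((h1 t ht).1.preimage_comp _).mono (empty_subset _)) ?_⟩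
      intro x hx
      simpa only [mem_fib, mem_preimage, e1] using hx
    · refine ⟨(h1' t ht).1.preimage_comp _, (h1' t ht).2.of_subset H hC
        ((h1' t ht).1.mono (empty_subset _)) (((h1' t ht).1.preimage_comp _).mono (empty_subset _)) ?_⟩
      intro x hx
      simpa only [mem_fib, mem_preimage, e2] using hx
  · rintro x (hx | hx)
    · obtain ⟨t, ht, hxt⟩ := h2 hx
      exact ⟨_, Or.inl ⟨t, ht, rfl⟩, by simpa only [mem_preimage, e1] using hxt⟩
    · obtain ⟨t, ht, hxt⟩ := h2' hx
      exact ⟨_, Or.inr ⟨t, ht, rfl⟩, by simpa only [mem_preimage, e2] using hxt⟩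

theorem FI.comp {W : Set (β → M)} (h : FI L C W) (f : β → α) :
    FI L C ((fun x : α → M => x ∘ f) ⁻¹' W) := by
  obtain ⟨ι, hι, d, T, hT, h1, h2⟩ := h
  have e1 : ∀ (x : α → M) (d : ι → M), Sum.elim x d ∘ (Sum.map f id : β ⊕ ι → α ⊕ ι)
      = Sum.elim (x ∘ f) d := fun x d => by ext (i | i) <;> rfl
  refine ⟨ι, hι, d, (fun t => (fun x => x ∘ Sum.map f id) ⁻¹' t) '' T, hT.image _, ?_, ?_⟩
  · rintro _ ⟨t, ht, rfl⟩
    refine ⟨(h1 t ht).1.preimage_comp _, ?_⟩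
    obtain ⟨g, hg, k, hk, hinc⟩ := (h1 t ht).2
    refine ⟨g, hg, k, hk, fun S hS ⟨a, ha⟩ => hinc S hS ⟨a ∘ f, fun j hj => ?_⟩⟩
    simpa only [mem_preimage, e1] using ha j hj
  · intro x hx
    obtain ⟨t, ht, hxt⟩ := h2 hx
    exact ⟨_, ⟨t, ht, rfl⟩, by simpa only [mem_preimage, e1] using hxt⟩

variable (L) in
/-- Nonforking independence of the tuple `a` from `B` over `C`. -/
def Ind (a : α → M) (C B : Set M) : Prop :=
  ∀ W : Set (α → M), (C ∪ B).Definable L W → a ∈ W → ¬ FI L C W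

theorem Ind.mono {a : α → M} (h : Ind L a C B) {B' : Set M} (hB : B' ⊆ C ∪ B) : Ind L a C B' :=
  fun W hW => h W (hW.mono (union_subset subset_union_left hB))

theorem Ind.base_mono {a : α → M} (h : Ind L a C B) {C' : Set M} (h1 : C ⊆ C')
    (h2 : C' ⊆ C ∪ B) : Ind L a C' B :=
  fun W hW ha hF => h W (hW.mono (union_subset h2 subset_union_right)) ha (hF.mono_base h1)

theorem Ind.comp {a : α → M} (h : Ind L a C B) (f : β → α) : Ind L (a ∘ f) C B :=
  fun _ hW ha hF => h _ (hW.preimage_comp f) ha (hF.comp f)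

theorem Ind.eqTp {a a' : α → M} (h : Ind L a C B) (h' : EqTp L (C ∪ B) a a') : Ind L a' C B :=
  fun W hW ha => h W hW ((h' W hW).2 ha)

theorem ind_iff_fin {a : α → M} :
    Ind L a C B ↔ ∀ (n : ℕ) (e : Fin n → M), range e ⊆ B → Ind L a C (range e) := by
  refine ⟨fun h n e he => h.mono (he.trans subset_union_right), fun h W hW ha => ?_⟩
  obtain ⟨n, e, t, he, ht, rfl⟩ := exists_fib_fin' hW
  exact h n e he _ (definable_fib ht e) ha

theorem exists_enum {F : Set M} (hF : F.Finite) : ∃ (n : ℕ) (e : Fin n → M), range e = F := by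
  obtain ⟨n, f, hf⟩ := hF.fin_param
  exact ⟨n, f, hf.2⟩

theorem Ind.congr (H : Ctx L M κ) (hC : #C ≤ κ) (hB : #B ≤ κ) [Finite α] [Countable β] [Countable γ]
    {a a' : α → M} {b b' : β → M} {e e' : γ → M}
    (h : EqTp L (C ∪ B) (Sum.elim a (Sum.elim b e)) (Sum.elim a' (Sum.elim b' e')))
    (hi : Ind L a (C ∪ range b) (B ∪ range e)) : Ind L a' (C ∪ range b') (B ∪ range e') := by
  intro W hW ha' hF
  have hCB := small_union H.inf hC hB
  have : (C ∪ B ∪ range (Sum.elim b' e')).Definable L W := hW.mono (by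
    rw [Sum.elim_range]; intro x; simp only [mem_union]; tauto)
  obtain ⟨s, hs, rfl⟩ := exists_fib this
  refine hi (fib s (Sum.elim b e)) ((definable_fib hs _).mono ?_) ((h s hs).2 ha') ?_
  · rw [Sum.elim_range]; intro x; simp only [mem_union]; tauto
  obtain ⟨ι, hι, d', T, hT, h1, h2⟩ := hF
  obtain ⟨d, hd⟩ := copy H hCB h.inr.symm d'
  refine ⟨ι, hι, d, T, hT, fun t ht => ⟨(h1 t ht).1, ?_⟩, ?_⟩
  · refine Div.congr H hC ((h1 t ht).1.mono (empty_subset _)) ?_ (h1 t ht).2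
    have := hd.comp (Sum.elim (Sum.inr ∘ Sum.inl) Sum.inl : β ⊕ ι → ι ⊕ (β ⊕ γ))
    convert this.mono subset_union_left using 1 <;> · ext (i | i) <;> rfl
  · exact fib_subset_congr hs ((definable_sUnion hT fun t ht => (h1 t ht).1).mono (empty_subset _))
      hd.swap h2

/-- Extension of nonforking types. -/
theorem Ind.ext (H : Ctx L M κ) (hC : #C ≤ κ) (hB : #B ≤ κ) [Finite α] {a : α → M}
    (h : Ind L a C B) (hD : #D ≤ κ) : ∃ a', EqTp L (C ∪ B) a a' ∧ Ind L a' C (B ∪ D) := by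
  have hBD := small_union H.inf hC (small_union H.inf hB hD)
  obtain ⟨a', ha'⟩ := realize_fip H hBD
    ({W | (C ∪ B).Definable L W ∧ a ∈ W} ∪ {W | (C ∪ (B ∪ D)).Definable L W ∧ FI L C Wᶜ}) (by
      rintro s (⟨hs, _⟩ | ⟨hs, _⟩)
      · exact hs.mono (by intro x; simp only [mem_union]; tauto)
      · exact hs) (by
      intro G hG hGF
      have : ∃ W W' : Set (α → M), (C ∪ B).Definable L W ∧ a ∈ W ∧ FI L C W'ᶜ ∧ W ∩ W' ⊆ ⋂₀ G := by
        induction G, hG using Set.Finite.induction_on with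
        | empty => exact ⟨univ, univ, definable_univ, mem_univ _, by simpa using FI.empty, by simp⟩
        | @insert X _ _ _ ih' =>
          obtain ⟨W, W', hW, haW, hFI, hsub⟩ := ih' (fun t ht => hGF (Or.inr ht))
          rcases hGF (mem_insert _ _) with ⟨h1, h2⟩ | ⟨h1, h2⟩
          · refine ⟨_, W', hW.inter h1, ⟨haW, h2⟩, hFI, ?_⟩
            rw [sInter_insert]
            exact fun x hx => ⟨hx.1.2, hsub ⟨hx.1.1, hx.2⟩⟩
          · refine ⟨W, W' ∩ X, hW, haW, ?_, ?_⟩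
            · rw [compl_inter]; exact hFI.union H hC h2
            · rw [sInter_insert]
              exact fun x hx => ⟨hx.2.2, hsub ⟨hx.1, hx.2.1⟩⟩
      obtain ⟨W, W', hW, haW, hFI, hsub⟩ := this
      by_contra hne
      rw [not_nonempty_iff_eq_empty] at hne
      refine h W hW haW (hFI.subset fun x hx hx' => ?_)
      have : x ∈ ⋂₀ G := hsub ⟨hx, hx'⟩
      rw [hne] at this
      exact this)
  refine ⟨a', fun s hs => ⟨fun h => ha' s (Or.inl ⟨hs, h⟩), fun h => ?_⟩, fun W hW haW hF => ?_⟩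
  · by_contra h'
    exact ha' sᶜ (Or.inl ⟨hs.compl, h'⟩) h
  · exact ha' Wᶜ (Or.inr ⟨hW.compl, by rwa [_root_.compl_compl]⟩) haW

variable (L) in
/-- Indiscernible sequences. -/
def Indisc (C : Set M) (f : ℕ → ι → M) : Prop :=
  ∀ (k : ℕ) (i j : Fin k → ℕ), StrictMono i → StrictMono j →
    EqTp L C (fun s : Fin k × ι => f (i s.1) s.2) (fun s : Fin k × ι => f (j s.1) s.2)

theorem Indisc.mono {f : ℕ → ι → M} (h : Indisc L D f) (hCD : C ⊆ D) : Indisc L C f :=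
  fun k i j hi hj => (h k i j hi hj).mono hCD

theorem Indisc.congr {f g : ℕ → ι → M} (hf : Indisc L C f)
    (h : EqTp L C (fun p : ℕ × ι => f p.1 p.2) (fun p : ℕ × ι => g p.1 p.2)) : Indisc L C g := by
  intro k i j hi hj
  have h1 : ∀ i : Fin k → ℕ, EqTp L C (fun s : Fin k × ι => f (i s.1) s.2)
      (fun s : Fin k × ι => g (i s.1) s.2) :=
    fun i => h.comp (fun s : Fin k × ι => (i s.1, s.2))
  exact (h1 i).symm.trans ((hf k i j hi hj).trans (h1 j))

theorem Indisc.zero {f : ℕ → ι → M} (hf : Indisc L C f) (n : ℕ) : EqTp L C (f n) (f 0) :=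
  (hf 1 (fun _ => n) (fun _ => 0) (Subsingleton.strictMono _) (Subsingleton.strictMono _)).comp
    (fun i => ((0 : Fin 1), i))

theorem definable_biInter_finset' {σ : Type} (S : Finset σ) {f : σ → Set (α → M)}
    (h : ∀ j ∈ S, A.Definable L (f j)) : A.Definable L {a | ∀ j ∈ S, a ∈ f j} := by
  classical
  induction S using Finset.induction_on with
  | empty => simp
  | insert m S _ ih =>
    have := (h m (Finset.mem_insert_self _ _)).inter
      (ih fun j hj => h j (Finset.mem_insert_of_mem hj))
    convert this using 1
    ext a
    simp

theorem definable_exists_mem [Finite α] {Y : Set (α → M)} {t : Set (α ⊕ ι → M)}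
    (hY : A.Definable L Y) (ht : A.Definable L t) :
    A.Definable L {y : ι → M | ∃ a, a ∈ Y ∧ Sum.elim a y ∈ t} := by
  convert definable_exists_fib ((hY.preimage_comp (Sum.inl : α → α ⊕ ι)).inter ht) using 1
  ext y
  simp [Set.Nonempty]

/-- From any sequence one extracts an indiscernible one over a small set. -/
theorem exists_indisc (H : Ctx L M κ) (hF : #E ≤ κ) [Finite ι] (f : ℕ → ι → M) :
    ∃ v : ℕ → ι → M, Indisc L E v ∧
      (∀ s : Set (ι → M), E.Definable L s → (∀ n, f n ∈ s) → ∀ n, v n ∈ s) ∧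
      ∀ (α : Type) [Finite α] (t : Set (α ⊕ ι → M)), E.Definable L t →
        ∀ k, KInc t k f → KInc t k v := by
  let u : Ultrafilter (ι → M) := (Filter.hyperfilter ℕ).map f
  let F := E ∪ range (fun p : ℕ × ι => f p.1 p.2)
  have hF' : #F ≤ κ := small_union H.inf hF (small_range H.inf _)
  have hne : Nonempty (ι → M) := ⟨f 0⟩
  obtain ⟨v, hv⟩ := dc_greedy (X := ι → M)
    (fun n v x => ∀ s, (F ∪ range (fun p : Fin n × ι => v p.1 p.2)).Definable L s →
      (x ∈ s ↔ s ∈ u))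
    (fun n g g' h x => by
      have : (fun p : Fin n × ι => g' p.1 p.2) = fun p : Fin n × ι => g p.1 p.2 := by
        ext p; rw [h _ p.1.2]
      rw [this]; exact id)
    (fun n g _ => realize_ultrafilter H _ (small_union H.inf hF' (small_range H.inf _)) u)
  have hfF : ∀ n i, f n i ∈ F := fun n i => Or.inr ⟨(n, i), rfl⟩
  -- indiscernibility
  have hind : Indisc L F v := by
    intro k
    induction k with
    | zero => intro i j _ _; rw [Subsingleton.elim i j]; exact EqTp.refl _
    | succ k ih =>
      intro i j hi hj
      have key : ∀ (i : Fin (k + 1) → ℕ), StrictMono i → ∀ s : Set (ι ⊕ (Fin k × ι) → M),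
          F.Definable L s → (Sum.elim (v (i (Fin.last k)))
            (fun p : Fin k × ι => v (i p.1.castSucc) p.2) ∈ s ↔
          {n | Sum.elim (f n) (fun p : Fin k × ι => v (i p.1.castSucc) p.2) ∈ s} ∈
            Filter.hyperfilter ℕ) := by
        intro i hi s hs
        refine hv (i (Fin.last k)) (fib s (fun p : Fin k × ι => v (i p.1.castSucc) p.2))
          ((definable_fib hs _).mono (union_subset_union_right _ ?_))
        rintro _ ⟨p, rfl⟩
        exact ⟨(⟨i p.1.castSucc, hi (Fin.castSucc_lt_last _)⟩, p.2), rfl⟩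
      have h1 : EqTp L F (Sum.elim (v (i (Fin.last k)))
            (fun p : Fin k × ι => v (i p.1.castSucc) p.2)) (Sum.elim (v (j (Fin.last k)))
            (fun p : Fin k × ι => v (j p.1.castSucc) p.2)) := by
        intro s hs
        rw [key i hi s hs, key j hj s hs]
        have h2 := ih (fun p => i p.castSucc) (fun p => j p.castSucc)
          (hi.comp Fin.strictMono_castSucc) (hj.comp Fin.strictMono_castSucc)
        have : ∀ n, Sum.elim (f n) (fun p : Fin k × ι => v (i p.1.castSucc) p.2) ∈ s ↔
            Sum.elim (f n) (fun p : Fin k × ι => v (j p.1.castSucc) p.2) ∈ s := by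
          intro n
          have hs' := definable_fib (hs.preimage_comp (Sum.swap : ι ⊕ (Fin k × ι) → _)) (f n)
          have h3 := h2 _ (hs'.mono (union_subset le_rfl (by rintro _ ⟨i, rfl⟩; exact hfF n i)))
          simpa [elim_comp_swap] using h3
        simp only [this]
      have := h1.comp (fun p : Fin (k + 1) × ι => if h : (p.1 : ℕ) < k then
        Sum.inr (⟨p.1, h⟩, p.2) else Sum.inl p.2)
      convert this using 1
      · ext p
        by_cases h : (p.1 : ℕ) < k
        · simp [h]
        · have h' : p.1 = Fin.last k := by ext; simp; omega
          simp [h']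
      · ext p
        by_cases h : (p.1 : ℕ) < k
        · simp [h]
        · have h' : p.1 = Fin.last k := by ext; simp; omega
          simp [h']
  refine ⟨v, hind.mono subset_union_left, ?_, ?_⟩
  · intro s hs h n
    refine (hv n s (hs.mono fun x hx => Or.inl (Or.inl hx))).2 ?_
    exact Filter.mem_map.2 (Filter.univ_mem' h)
  · intro α _ t ht k hinc
    have claim : ∀ S : Finset ℕ, ∀ N : Finset ℕ,
        (∃ a : α → M, (∀ j ∈ S, Sum.elim a (v j) ∈ t) ∧ ∀ n ∈ N, Sum.elim a (f n) ∈ t) →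
        ∃ N' : Finset ℕ, N'.card = S.card + N.card ∧ ∃ a : α → M, ∀ n ∈ N', Sum.elim a (f n) ∈ t := by
      intro S
      induction S using Finset.induction_on_max with
      | empty => rintro N ⟨a, -, ha⟩; exact ⟨N, by simp, a, ha⟩
      | insert m S hmS ih =>
        rintro N ⟨a, haS, haN⟩
        let Y : Set (α → M) := {a | (∀ j ∈ S, Sum.elim a (v j) ∈ t) ∧ ∀ n ∈ N, Sum.elim a (f n) ∈ t}
        have hmF : ∀ j ∈ S, range (v j) ⊆ range (fun p : Fin m × ι => v p.1 p.2) := by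
          rintro j hj _ ⟨i, rfl⟩
          exact ⟨(⟨j, hmS j hj⟩, i), rfl⟩
        have hY : (F ∪ range (fun p : Fin m × ι => v p.1 p.2)).Definable L Y := by
          refine (definable_biInter_finset' S (f := fun j => fib t (v j)) fun j hj =>
            (definable_fib ht (v j)).mono ?_).inter (definable_biInter_finset' N
              (f := fun n => fib t (f n)) fun n _ => (definable_fib ht (f n)).mono ?_)
          · exact union_subset_union subset_union_left (hmF j hj)
          · rintro x (hx | ⟨i, rfl⟩)
            · exact Or.inl (Or.inl hx)
            · exact Or.inl (hfF n i)
        have hYv : (F ∪ range (fun p : Fin m × ι => v p.1 p.2)).Definable L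
            {y : ι → M | ∃ a, a ∈ Y ∧ Sum.elim a y ∈ t} :=
          definable_exists_mem hY (ht.mono fun x hx => Or.inl (Or.inl hx))
        have h2 := (hv m _ hYv).1 ⟨a, ⟨fun j hj => haS j (Finset.mem_insert_of_mem hj), haN⟩,
          haS m (Finset.mem_insert_self _ _)⟩
        have h3 : {n | f n ∈ {y : ι → M | ∃ a, a ∈ Y ∧ Sum.elim a y ∈ t}} ∈
          Filter.hyperfilter ℕ := h2
        have h4 : ((N : Set ℕ)ᶜ) ∈ Filter.hyperfilter ℕ :=
          Filter.compl_mem_hyperfilter_of_finite N.finite_toSet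
        obtain ⟨n, ⟨a', ha', han⟩, hnN⟩ := (Filter.hyperfilter ℕ).nonempty_of_mem
          (Filter.inter_mem h3 h4)
        have hnN' : n ∉ N := hnN
        obtain ⟨N', hN', h5⟩ := ih (insert n N) ⟨a', ha'.1, by
          intro n' hn'
          rcases Finset.mem_insert.1 hn' with rfl | h
          · exact han
          · exact ha'.2 n' h⟩
        refine ⟨N', ?_, h5⟩
        have : m ∉ S := fun h => (hmS m h).false
        rw [hN', Finset.card_insert_of_notMem hnN', Finset.card_insert_of_notMem this]
        ring
    intro S hS ⟨a, ha⟩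
    obtain ⟨N', hN', h⟩ := claim S ∅ ⟨a, ha, by simp⟩
    exact hinc N' (by simpa [hS] using hN') h

theorem EqTp.of_comp {x y : α → M} (h : EqTp L A x y) (f : β → α) {x' y' : β → M}
    (hx : x ∘ f = x') (hy : y ∘ f = y') : EqTp L A x' y' := hx ▸ hy ▸ h.comp f

theorem EqTp.add {x y : α → M} (h : EqTp L A x y) {b : β → M} (hb : range b ⊆ A) :
    EqTp L A (Sum.elim x b) (Sum.elim y b) :=
  eqTp_sum_iff.2 (by rwa [union_eq_self_of_subset_right hb])

theorem EqTp.eq_of_mem {x y : α → M} (h : EqTp L A x y) {i : α} (hi : x i ∈ A) : y i = x i := by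
  have h1 := h.add (b := fun _ : Unit => x i) (by rintro _ ⟨_, rfl⟩; exact hi)
  exact (h1.eq_iff (Sum.inl i) (Sum.inr ())).1 rfl

theorem EqTp.eq_of_elim {x : α → M} {y x' : α → M} (h : EqTp L A (Sum.elim x x) (Sum.elim y x')) :
    y = x' := by
  ext i
  exact (h.eq_iff (Sum.inl i) (Sum.inr i)).1 rfl

/-- A definable set over `C`, written with parameters. -/
theorem FI.of_definable [Finite ι] {t : Set (α ⊕ ι → M)} (ht : C.Definable L t)
    {d : ι → M} (h : Div L C t d) : FI L C (fib t d) := by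
  obtain ⟨n, e, t', he, ht', rfl⟩ := exists_fib_fin ht
  obtain ⟨f, hf, k, hk, hinc⟩ := h
  have hr : ∀ (x : α → M) (y : ι → M), Sum.elim x (Sum.elim y e) ∘
      (Sum.elim (Sum.map id Sum.inl) (Sum.inr ∘ Sum.inr) : (α ⊕ ι) ⊕ Fin n → α ⊕ (ι ⊕ Fin n)) =
      Sum.elim (Sum.elim x y) e := by
    intro x y; ext ((i | i) | i) <;> rfl
  let t'' := (fun x : α ⊕ (ι ⊕ Fin n) → M =>
    x ∘ (Sum.elim (Sum.map id Sum.inl) (Sum.inr ∘ Sum.inr) : (α ⊕ ι) ⊕ Fin n → _)) ⁻¹' t'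
  have hd : Div L C t'' (Sum.elim d e) := by
    refine ⟨fun i => Sum.elim (f i) e, fun i => (hf i).add he, k, hk, fun S hS ⟨a, ha⟩ =>
      hinc S hS ⟨a, fun j hj => ?_⟩⟩
    have := ha j hj
    simpa only [t'', mem_preimage, hr, mem_fib] using this
  refine (FI.of_div (ht'.preimage_comp _) hd).subset fun x hx => ?_
  simpa only [t'', mem_preimage, hr, mem_fib] using hx

theorem Ind.not_div {a : α → M} (h : Ind L a C B) [Finite ι] {t : Set (α ⊕ ι → M)}
    (ht : C.Definable L t) {d : ι → M} (hd : range d ⊆ C ∪ B) (had : Sum.elim a d ∈ t) :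
    ¬ Div L C t d := fun hD =>
  h (fib t d) ((definable_fib ht d).mono (union_subset subset_union_left hd)) had
    (FI.of_definable ht hD)

/-- Dividing is witnessed by sequences indiscernible over any small set. -/
theorem Div.indisc (H : Ctx L M κ) (hE : #E ≤ κ) [Finite α] [Finite ι] {t : Set (α ⊕ ι → M)}
    (ht : C.Definable L t) {d : ι → M} (hd : Div L C t d) (hCE : C ⊆ E) :
    ∃ v : ℕ → ι → M, Indisc L E v ∧ (∀ n, EqTp L C (v n) d) ∧ ∃ k > 0, KInc t k v := by
  obtain ⟨f, hf, k, hk, hinc⟩ := hd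
  obtain ⟨v, hv, hv1, hv2⟩ := exists_indisc H hE f
  have h1 : ∀ n s, C.Definable L s → d ∈ s → v n ∈ s := fun n s hs hds =>
    hv1 s (hs.mono hCE) (fun n => (hf n s hs).2 hds) n
  refine ⟨v, hv, fun n s hs => ⟨fun h => ?_, h1 n s hs⟩, k, hk, hv2 α t (ht.mono hCE) k hinc⟩
  by_contra h'
  exact h1 n sᶜ hs.compl h' h

theorem Div.indisc_zero (H : Ctx L M κ) (hC : #C ≤ κ) [Finite α] [Finite ι] {t : Set (α ⊕ ι → M)}
    (ht : C.Definable L t) {d : ι → M} (hd : Div L C t d) :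
    ∃ v : ℕ → ι → M, Indisc L C v ∧ v 0 = d ∧ ∃ k > 0, KInc t k v := by
  obtain ⟨v, hv, hvd, k, hk, hinc⟩ := hd.indisc H hC ht le_rfl
  obtain ⟨g, hg⟩ := copy H hC (hvd 0) (fun p : ℕ × ι => v p.1 p.2)
  refine ⟨fun n i => g (n, i), hv.congr hg.inl, ?_, k, hk, hinc.congr ht hg.inl⟩
  exact (hg.of_comp (Sum.elim (fun i => Sum.inl (0, i)) Sum.inr) (x' := Sum.elim (v 0) (v 0))
    (y' := Sum.elim (fun i => g (0, i)) d) (by ext (i | i) <;> rfl)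
    (by ext (i | i) <;> rfl)).eq_of_elim

theorem Div.copy (H : Ctx L M κ) (hE : #E ≤ κ) (hF : #A ≤ κ) [Finite α] [Finite ι] [Countable β]
    {t : Set (α ⊕ ι → M)} (ht : E.Definable L t) {w : β → M} {g : ι → β}
    (hd : Div L E t (w ∘ g)) : ∃ w', EqTp L E w w' ∧ Div L (E ∪ A) t (w' ∘ g) := by
  obtain ⟨v, hv, hvd, k, hk, hinc⟩ := hd.indisc H (small_union H.inf hE hF) ht subset_union_left
  obtain ⟨w', hw'⟩ := Benign.copy H hE (hvd 0).symm w
  have : w' ∘ g = v 0 := (hw'.of_comp (Sum.elim (Sum.inl ∘ g) Sum.inr)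
    (x' := Sum.elim (w ∘ g) (w ∘ g)) (y' := Sum.elim (w' ∘ g) (v 0))
    (by ext (i | i) <;> rfl) (by ext (i | i) <;> rfl)).eq_of_elim
  exact ⟨w', hw'.inl, this ▸ ⟨v, fun n => hv.zero n, k, hk, hinc⟩⟩

theorem Indisc.kInc_of (f : ℕ → ι → M) (hf : Indisc L C f) [Finite α] {t : Set (α ⊕ ι → M)}
    (ht : C.Definable L t) {N : Finset ℕ} (hN : ¬ ∃ a : α → M, ∀ j ∈ N, Sum.elim a (f j) ∈ t) :
    KInc t N.card f := by
  intro S hS hS'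
  apply hN
  have h1 : ∀ (S : Finset ℕ) (hS : S.card = N.card), (∃ a : α → M, ∀ j ∈ S, Sum.elim a (f j) ∈ t) ↔
      (fun s : Fin N.card × ι => f (S.orderEmbOfFin hS s.1) s.2) ∈
      {x : Fin N.card × ι → M | ∃ a : α → M, ∀ j, Sum.elim a (fun i => x (j, i)) ∈ t} := by
    intro S hS
    refine exists_congr fun a => ⟨fun h j => h _ (S.orderEmbOfFin_mem hS j), fun h j hj => ?_⟩
    have : j ∈ Set.range (S.orderEmbOfFin hS) := by rw [Finset.range_orderEmbOfFin]; exact hj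
    obtain ⟨i, rfl⟩ := this
    exact h i
  have h2 : C.Definable L
      {x : Fin N.card × ι → M | ∃ a : α → M, ∀ j, Sum.elim a (fun i => x (j, i)) ∈ t} := by
    have := definable_exists_fib (definable_biInter_finset' (A := C) (L := L)
      (Finset.univ : Finset (Fin N.card)) (fun j _ => ht.preimage_comp
      (Sum.map id (fun i => (j, i)) : α ⊕ ι → α ⊕ (Fin N.card × ι))))
    convert this using 1
    ext x
    refine exists_congr fun a => ?_
    simp only [Finset.mem_univ, true_imp_iff, mem_fib, mem_ofPred_eq, mem_preimage]
    refine forall_congr' fun j => ?_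
    have : Sum.elim a (fun i => x (j, i)) = Sum.elim a x ∘ Sum.map id (fun i => (j, i)) := by
      ext (i | i) <;> rfl
    rw [this]
  rw [h1 N rfl]
  exact (hf _ _ _ (S.orderEmbOfFin hS).strictMono (N.orderEmbOfFin rfl).strictMono _ h2).1
    ((h1 S hS).1 hS')

/-- A nonforking realization can be moved to sit uniformly over an indiscernible sequence. -/
theorem Indisc.common (H : Ctx L M κ) (hC : #C ≤ κ) [Finite α] [Finite ι] {c : ℕ → ι → M}
    (hc : Indisc L C c) {y : α → M} (hy : Ind L y C (range (c 0))) :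
    ∃ y', ∀ j, EqTp L C (Sum.elim y' (c j)) (Sum.elim y (c 0)) := by
  have hsm := small_union H.inf hC (small_range H.inf (fun p : ℕ × ι => c p.1 p.2))
  obtain ⟨y', hy'⟩ := realize_fip H hsm
    {W | ∃ j s, C.Definable L s ∧ Sum.elim y (c 0) ∈ s ∧ W = fib s (c j)} (by
      rintro _ ⟨j, s, hs, -, rfl⟩
      refine (definable_fib hs _).mono (union_subset_union_right _ ?_)
      rintro _ ⟨i, rfl⟩
      exact ⟨(j, i), rfl⟩) (by
    intro G hG hGF
    have : ∃ (N : Finset ℕ) (s : Set (α ⊕ ι → M)), C.Definable L s ∧ Sum.elim y (c 0) ∈ s ∧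
        ∀ x, (∀ j ∈ N, Sum.elim x (c j) ∈ s) → x ∈ ⋂₀ G := by
      induction G, hG using Set.Finite.induction_on with
      | empty => exact ⟨∅, univ, definable_univ, mem_univ _, by simp⟩
      | insert _ _ ih =>
        obtain ⟨N, s, hs, hys, hN⟩ := ih fun t ht => hGF (Or.inr ht)
        obtain ⟨j, s', hs', hys', rfl⟩ := hGF (mem_insert _ _)
        refine ⟨insert j N, s ∩ s', hs.inter hs', ⟨hys, hys'⟩, fun x hx => ?_⟩
        rw [sInter_insert]
        exact ⟨(hx j (Finset.mem_insert_self _ _)).2,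
          hN x fun j hj => (hx j (Finset.mem_insert_of_mem hj)).1⟩
    obtain ⟨N, s, hs, hys, hN⟩ := this
    by_contra hne
    have h1 : ¬ ∃ a : α → M, ∀ j ∈ N, Sum.elim a (c j) ∈ s :=
      fun ⟨a, ha⟩ => hne ⟨a, hN a ha⟩
    refine hy.not_div hs subset_union_right hys ⟨c, hc.zero, N.card, ?_, hc.kInc_of c hs h1⟩
    rw [gt_iff_lt, Finset.card_pos, Finset.nonempty_iff_ne_empty]
    rintro rfl
    exact h1 ⟨y, by simp⟩)
  have h1 : ∀ j s, C.Definable L s → Sum.elim y (c 0) ∈ s → Sum.elim y' (c j) ∈ s :=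
    fun j s hs h => hy' _ ⟨j, s, hs, h, rfl⟩
  refine ⟨y', fun j s hs => ⟨fun h => ?_, h1 j s hs⟩⟩
  by_contra h'
  exact h1 j sᶜ hs.compl h' h

theorem Div.left_trans (H : Ctx L M κ) (hC : #C ≤ κ) [Finite α] [Finite β] [Finite ι]
    {t : Set ((α ⊕ β) ⊕ ι → M)} (ht : C.Definable L t) {b : β → M} {e : ι → M}
    (hd : Div L C t e) (hb : Ind L b C (range e)) :
    Div L (C ∪ range b) ((fun x => x ∘ (Equiv.sumAssoc α β ι)) ⁻¹' t : Set (α ⊕ (β ⊕ ι) → M))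
      (Sum.elim b e) := by
  obtain ⟨v, hv, rfl, k, hk, hinc⟩ := hd.indisc_zero H hC ht
  obtain ⟨b', hb'⟩ := hv.common H hC hb
  obtain ⟨v', hv'⟩ := Benign.copy H hC (hb' 0) (fun p : ℕ × ι => v p.1 p.2)
  have h1 : ∀ n, EqTp L C (Sum.elim b (fun i => v' (n, i))) (Sum.elim b (v 0)) := fun n =>
    (hv'.of_comp (Sum.elim (Sum.inr ∘ Sum.inl) (fun i => Sum.inl (n, i)))
      (x' := Sum.elim b' (v n)) (by ext (i | i) <;> rfl) (by ext (i | i) <;> rfl)).symm.trans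
      (hb' n)
  have hinc' : KInc t k (fun n i => v' (n, i)) := hinc.congr ht hv'.inl
  refine ⟨fun n => Sum.elim b (fun i => v' (n, i)), fun n => ?_, k, hk, ?_⟩
  · have := eqTp_sum_iff.1 (h1 n).swap
    exact (this.add (b := b) subset_union_right).swap
  · rintro S hS ⟨a, ha⟩
    refine hinc' S hS ⟨Sum.elim a b, fun j hj => ?_⟩
    have := ha j hj
    simp only [mem_preimage] at this
    convert this using 1
    ext ((i | i) | i) <;> rfl

/-- It is enough to check nondividing of all extensions. -/
theorem ind_of_not_div {a : α → M}
    (h : ∀ (ι : Type) (_ : Finite ι) (d : ι → M), ∃ a', EqTp L (C ∪ B) a a' ∧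
      ∀ t : Set (α ⊕ ι → M), (∅ : Set M).Definable L t → Sum.elim a' d ∈ t → ¬ Div L C t d) :
    Ind L a C B := by
  rintro W hW ha ⟨ι, hι, d, T, hT, h1, h2⟩
  obtain ⟨a', ha', h3⟩ := h ι hι d
  obtain ⟨t, ht, hat⟩ := h2 ((ha' W hW).1 ha)
  exact h3 t (h1 t ht).1 hat (h1 t ht).2

theorem Ind.congr' (H : Ctx L M κ) (hC : #C ≤ κ) (hB : #B ≤ κ) [Finite α] [Countable β]
    {a a' : α → M} {b b' : β → M} (hi : Ind L a (C ∪ range b) B)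
    (h : EqTp L (C ∪ B) (Sum.elim a b) (Sum.elim a' b')) : Ind L a' (C ∪ range b') B := by
  have hE : range (Empty.elim : Empty → M) = ∅ := range_eq_empty _
  have := Ind.congr H hC hB (e := Empty.elim) (e' := Empty.elim) (b := b) (b' := b') (a := a)
    (a' := a') (h.of_comp (Sum.elim Sum.inl (Sum.elim Sum.inr Empty.elim))
      (by ext (i | i | i) <;> first | rfl | exact i.elim)
      (by ext (i | i | i) <;> first | rfl | exact i.elim)) (by rwa [hE, union_empty])
  rwa [hE, union_empty] at this

/-- Left transitivity of nonforking. -/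
theorem Ind.pair (H : Ctx L M κ) (hC : #C ≤ κ) (hD : #D ≤ κ) [Finite α] [Finite β]
    {a : α → M} {b : β → M} (hb : Ind L b C D) (ha : Ind L a (C ∪ range b) D) :
    Ind L (Sum.elim a b) C D := by
  refine ind_of_not_div fun ι hι d => ?_
  have hd : #(range d) ≤ κ := small_range H.inf d
  have hCD := small_union H.inf hC hD
  obtain ⟨b1, hbb1, hb1⟩ := hb.ext H hC hD hd
  obtain ⟨a1, ha1⟩ := Benign.copy H hCD hbb1 a
  have h1 : Ind L a1 (C ∪ range b1) D := ha.congr' H hC hD ha1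
  obtain ⟨a2, ha2, ha2'⟩ := h1.ext H (small_union H.inf hC (small_range H.inf _)) hD hd
  refine ⟨Sum.elim a2 b1, ha1.trans (eqTp_sum_iff.2 (ha2.mono ?_)), fun t ht hat hdiv => ?_⟩
  · intro x; simp only [mem_union]; tauto
  · have := hdiv.left_trans H hC (ht.mono (empty_subset _))
      (hb1.mono (subset_union_right.trans subset_union_right))
    refine ha2'.not_div ((ht.preimage_comp _).mono (empty_subset _)) ?_ ?_ this
    · rw [Sum.elim_range]; intro x; simp only [mem_union]; tauto
    · simp only [mem_preimage]
      convert hat using 1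
      ext ((i | i) | i) <;> rfl

theorem exists_lt_power_aleph0 (μ : Cardinal.{u}) (hμ : ℵ₀ ≤ μ) :
    ∃ c : Cardinal.{u}, μ ≤ c ∧ c < c ^ (ℵ₀ : Cardinal.{u}) := by
  obtain ⟨o, rfl⟩ := mem_range_aleph_iff.2 hμ
  refine ⟨ℵ_ (o + Ordinal.omega0), aleph_le_aleph.2 le_self_add, ?_⟩
  have h := lt_power_cof_ord (aleph0_le_aleph (o + Ordinal.omega0))
  rwa [ord_aleph, Ordinal.cof_omega (Ordinal.isSuccLimit_add _ Ordinal.isSuccLimit_omega0),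
    Ordinal.cof_add _ Ordinal.omega0_ne_zero, Ordinal.cof_omega0] at h

theorem tree_bound {T : L.Theory} (hss : Superstable L T) {N : Type u} [Nonempty N] [L.Structure N]
    (hN : N ⊨ T) {Λ : Type u} (hΛ : 2 ^ cardL L ≤ #Λ) [Finite α] {l : ℕ → Type}
    [∀ n, Finite (l n)] (t : ∀ n, Set (α ⊕ l n → N))
    (ht : ∀ n, (∅ : Set N).Definable L (t n)) (d : (ℕ → Λ) → ∀ n, l n → N)
    (e : (ℕ → Λ) → α → N) (he : ∀ σ n, Sum.elim (e σ) (d σ n) ∈ t n)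
    (hd : ∀ σ σ' n, (∀ m ≤ n, σ m = σ' m) → d σ n = d σ' n)
    (hinc : ∀ σ n, ∃ k, ∀ S : Finset Λ, S.card = k →
      ¬ ∃ a, ∀ j ∈ S, Sum.elim a (d (Function.update σ n j) n) ∈ t n) :
    #(ℕ → Λ) ≤ #Λ := by
  classical
  have hω : ℵ₀ ≤ cardL L := le_sup_right
  have hc : (2 : Cardinal.{u}) ^ (ℵ₀ : Cardinal.{u}) ≤ #Λ :=
    (power_le_power_left two_ne_zero hω).trans hΛ
  have hΛ0 : ℵ₀ ≤ #Λ := (cantor _).le.trans hc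
  let A : Set N := ⋃ σ, ⋃ n, range (d σ n)
  have hdA : ∀ σ n, range (d σ n) ⊆ A := fun σ n =>
    (subset_iUnion (fun n => range (d σ n)) n).trans
      (subset_iUnion (fun σ => ⋃ n, range (d σ n)) σ)
  have hne : Nonempty Λ := by
    rw [← mk_ne_zero_iff]; exact (aleph0_pos.trans_le hΛ0).ne'
  have hA : #A ≤ #Λ := by
    let F : (Σ n : ℕ, (Fin (n + 1) → Λ) × l n) → N := fun p =>
      d (fun i => if h : i < p.1 + 1 then p.2.1 ⟨i, h⟩ else Classical.arbitrary Λ) p.1 p.2.2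
    have h1 : A ⊆ range F := by
      intro x hx
      simp only [A, mem_iUnion, mem_range] at hx
      obtain ⟨σ, n, i, rfl⟩ := hx
      refine ⟨⟨n, fun j => σ j, i⟩, ?_⟩
      simp only [F]
      rw [hd _ σ n fun m hm => by simp [Nat.lt_succ_of_le hm] ]
    refine (mk_le_mk_of_subset h1).trans (mk_range_le.trans ?_)
    rw [mk_sigma]
    refine (sum_le_lift_mk_mul_iSup _).trans ?_
    refine (mul_le_mul' (by simpa using hΛ0) (ciSup_le' fun n => ?_)).trans (mul_eq_self hΛ0).le
    rw [mk_prod]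
    refine (mul_le_mul' (b := #Λ) (d := #Λ) ?_ ?_).trans (mul_eq_self hΛ0).le
    · simp only [mk_pi, prod_const, mk_fin, lift_natCast, lift_uzero]
      exact power_nat_le hΛ0
    · exact ((lift_lt_aleph0.2 (lt_aleph0_of_finite (l n))).le).trans hΛ0
  obtain ⟨m, ⟨eq⟩⟩ := Finite.exists_equiv_fin α
  have hst := hss _ hΛ N inferInstance hN A hA m
  let tp : (ℕ → Λ) → ((L[[↥A]]).completeTheory N).CompleteType (Fin m) := fun σ =>
    Theory.typeOf _ (e σ ∘ eq.symm)
  have htp : ∀ σ σ', tp σ = tp σ' → ∀ s : Set (α → N), A.Definable L s → e σ ∈ s → e σ' ∈ s := by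
    intro σ σ' h s hs hσ
    obtain ⟨φ, hφ⟩ := hs.preimage_comp eq
    have h1 : ∀ σ, Formula.equivSentence φ ∈ tp σ ↔ e σ ∈ s := fun σ => by
      refine Theory.CompleteType.formula_mem_typeOf.trans ?_
      change e σ ∘ eq.symm ∈ {v | φ.Realize v} ↔ _
      rw [← hφ]
      simp [Function.comp_assoc]
    rw [← h1, ← h, h1]
    exact hσ
  have henc : ∀ S : Set Λ, ∃ f : Λ → ℕ, S.Finite → InjOn f S := fun S => by
    by_cases hS : S.Finite
    · obtain ⟨f, hf⟩ := Set.countable_iff_exists_injOn.1 hS.countable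
      exact ⟨f, fun _ => hf⟩
    · exact ⟨fun _ => 0, fun h => (hS h).elim⟩
  choose enc henc using henc
  let S : (ℕ → Λ) → ℕ → Set Λ := fun σ n =>
    {j | Sum.elim (e σ) (d (Function.update σ n j) n) ∈ t n}
  have hSfin : ∀ σ n, (S σ n).Finite := by
    intro σ n
    obtain ⟨k, hk⟩ := hinc σ n
    by_contra hinf
    obtain ⟨F, hF, hcard⟩ := Set.Infinite.exists_subset_card_eq hinf k
    exact hk F hcard ⟨e σ, fun j hj => hF hj⟩
  have hSmem : ∀ σ n, σ n ∈ S σ n := by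
    intro σ n
    simp only [S, mem_ofPred_eq, Function.update_eq_self]
    exact he σ n
  let G : (ℕ → Λ) → ((L[[↥A]]).completeTheory N).CompleteType (Fin m) × (ℕ → ℕ) := fun σ =>
    (tp σ, fun n => enc (S σ n) (σ n))
  have hG : Function.Injective G := by
    intro σ σ' h
    simp only [G, Prod.mk.injEq] at h
    ext n
    induction n using Nat.strong_induction_on with
    | _ n ih =>
      have hup : ∀ j, d (Function.update σ n j) n = d (Function.update σ' n j) n := by
        intro j
        refine hd _ _ n fun m hm => ?_
        rcases hm.lt_or_eq with h | rfl
        · rw [Function.update_of_ne h.ne, Function.update_of_ne h.ne, ih m h]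
        · simp
      have hS : S σ n = S σ' n := by
        ext j
        have hdef : A.Definable L (fib (t n) (d (Function.update σ n j) n)) :=
          (definable_fib (ht n) _).mono (by rw [empty_union]; exact hdA _ _)
        simp only [S, mem_ofPred_eq, ← hup j]
        exact ⟨htp _ _ h.1 _ hdef, htp _ _ h.1.symm _ hdef⟩
      have := congrFun h.2 n
      simp only [hS] at this
      exact henc _ (hSfin σ' n) (hS ▸ hSmem σ n) (hSmem σ' n) this
  refine (mk_le_of_injective hG).trans ?_
  rw [mk_prod]
  refine (mul_le_mul' (by simpa using hst) ?_).trans (mul_eq_self hΛ0).le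
  simp only [mk_pi, prod_const, mk_nat, lift_power, lift_aleph0, lift_id]
  rw [aleph0_power_aleph0, ← two_power_aleph0]
  simpa using hc

/-- The part of a tuple at level `n`. -/
def lvl {l : ℕ → Type} (x : (Σ n, l n) → M) (n : ℕ) : l n → M := fun i => x ⟨n, i⟩

theorem tree_step (H : Ctx L M κ) [Finite α] {l : ℕ → Type} [∀ n, Finite (l n)]
    {n : ℕ} {t : Set (α ⊕ l n → M)} (ht : (∅ : Set M).Definable L t) (d : (Σ n, l n) → M)
    (hd : Div L {m | ∃ p : Σ n, l n, p.1 < n ∧ d p = m} t (lvl d n)) :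
    ∃ k, ∀ x : (Σ n, l n) → M, EqTp L ∅ d x → ∃ y : ℕ → (Σ n, l n) → M,
      (∀ j, EqTp L ∅ d (y j)) ∧ (∀ j p, p.1 < n → y j p = x p) ∧
      KInc t k (fun j => lvl (y j) n) := by
  obtain ⟨f, hf, k, hk, hinc⟩ := hd
  refine ⟨k, fun x hx => ?_⟩
  let P := {p : Σ n, l n // p.1 < n}
  have hr : {m | ∃ p : Σ n, l n, p.1 < n ∧ d p = m} = range (fun p : P => d p) := by
    ext m; simp [P]
  have h0 : #(∅ : Set M) ≤ κ := empty_small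
  have h1 : ∀ j, ∃ y : (Σ n, l n) → M, EqTp L ∅ (Sum.elim d (Sum.elim (lvl d n) (fun p : P => d p)))
      (Sum.elim y (Sum.elim (f j) (fun p : P => d p))) := fun j => by
    refine copy H h0 ?_ d
    rw [eqTp_sum_iff, empty_union, ← hr]
    exact (hf j).symm
  choose y hy using h1
  have hyl : ∀ j, lvl (y j) n = f j := fun j => by
    ext i
    exact ((hy j).eq_iff (Sum.inl ⟨n, i⟩) (Sum.inr (Sum.inl i))).1 rfl
  have hyp : ∀ j p, p.1 < n → y j p = d p := fun j p hp =>
    ((hy j).eq_iff (Sum.inl p) (Sum.inr (Sum.inr ⟨p, hp⟩))).1 rfl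
  obtain ⟨z, hz⟩ := copy H h0 hx (fun p : ℕ × (Σ n, l n) => y p.1 p.2)
  refine ⟨fun j p => z (j, p), fun j => (hy j).inl.trans (hz.inl.comp fun p => (j, p)),
    fun j p hp => ?_, ?_⟩
  · exact (hz.eq_iff (Sum.inl (j, p)) (Sum.inr p)).1 (hyp j p hp)
  · have h2 : KInc t k (fun j => lvl (y j) n) := by simpa only [hyl] using hinc
    exact h2.congr ht (hz.inl.comp fun p : ℕ × l n => (p.1, ⟨n, p.2⟩))

theorem exists_tree (H : Ctx L M κ) [Finite α] {l : ℕ → Type} [∀ n, Finite (l n)]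
    {t : ∀ n, Set (α ⊕ l n → M)} (ht : ∀ n, (∅ : Set M).Definable L (t n)) (d : (Σ n, l n) → M)
    (hd : ∀ n, Div L {m | ∃ p : Σ n, l n, p.1 < n ∧ d p = m} (t n) (lvl d n)) :
    ∃ (k : ℕ → ℕ) (X : (ℕ → ℕ) → ℕ → (Σ n, l n) → M), (∀ σ n, EqTp L ∅ d (X σ n)) ∧
      (∀ σ σ' n, (∀ m < n, σ m = σ' m) → X σ n = X σ' n) ∧
      (∀ σ m n, m < n → lvl (X σ n) m = lvl (X σ (m + 1)) m) ∧
      ∀ σ n, KInc (t n) (k n) (fun j => lvl (X (Function.update σ n j) (n + 1)) n) := by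
  choose k hk using fun n => tree_step H (ht n) d (hd n)
  choose! Y hY1 hY2 hY3 using hk
  let X : (ℕ → ℕ) → ℕ → (Σ n, l n) → M := fun σ n => Nat.rec d (fun n x => Y n x (σ n)) n
  have hX : ∀ σ n, EqTp L ∅ d (X σ n) := by
    intro σ n
    induction n with
    | zero => exact EqTp.refl _
    | succ n ih => exact hY1 n _ ih _
  have hX' : ∀ σ σ' n, (∀ m < n, σ m = σ' m) → X σ n = X σ' n := by
    intro σ σ' n
    induction n with
    | zero => intro _; rfl
    | succ n ih =>
      intro h
      change Y n (X σ n) (σ n) = Y n (X σ' n) (σ' n)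
      rw [ih fun m hm => h m (hm.trans n.lt_succ_self), h n n.lt_succ_self]
  refine ⟨k, X, hX, hX', fun σ m n hmn => ?_, fun σ n => ?_⟩
  · induction n, hmn using Nat.le_induction with
    | base => rfl
    | succ n hmn ih =>
      rw [← ih]
      ext i
      exact hY2 n _ (hX σ n) _ ⟨m, i⟩ hmn
  · have : ∀ j, X (Function.update σ n j) (n + 1) = Y n (X σ n) j := fun j => by
      change Y n (X (Function.update σ n j) n) _ = _
      rw [Function.update_self, hX' _ σ n fun m hm => Function.update_of_ne hm.ne _ _]
    simp only [this]
    exact hY3 n _ (hX σ n)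

/-- In a superstable theory there is no infinite dividing chain. -/
theorem no_chain (H : Ctx L M κ) [Finite α] {l : ℕ → Type} [∀ n, Finite (l n)]
    {t : ∀ n, Set (α ⊕ l n → M)} (ht : ∀ n, (∅ : Set M).Definable L (t n)) (d : (Σ n, l n) → M)
    (hd : ∀ n, Div L {m | ∃ p : Σ n, l n, p.1 < n ∧ d p = m} (t n) (lvl d n))
    (hne : ∀ N, ∃ a : α → M, ∀ n < N, Sum.elim a (lvl d n) ∈ t n) : False := by
  classical
  obtain ⟨k, X, hX, hX', hX2, hinc⟩ := exists_tree H ht d hd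
  have hM : Nonempty M := by
    by_contra hM
    rw [not_nonempty_iff] at hM
    obtain ⟨f, hf, k, hk, h⟩ := hd 0
    obtain ⟨a, ha⟩ := hne 1
    obtain ⟨S, hS⟩ := Infinite.exists_subset_card_eq ℕ k
    refine h S hS ⟨a, fun j _ => ?_⟩
    have : Sum.elim a (f j) = Sum.elim a (lvl d 0) := by
      ext i; exact hM.elim (Sum.elim a (f j) i)
    rw [this]; exact ha 0 one_pos
  have hbr : ∀ σ N, ∃ a : α → M, ∀ n < N, Sum.elim a (lvl (X σ N) n) ∈ t n := by
    intro σ N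
    have hdef : (∅ : Set M).Definable L {x : (Σ n, l n) → M | ∃ a : α → M,
        ∀ n < N, Sum.elim a (lvl x n) ∈ t n} := by
      have := definable_exists_fib (definable_biInter_finset' (A := ∅) (L := L)
        (Finset.range N) (fun n _ => (ht n).preimage_comp
        (Sum.map id (fun i => ⟨n, i⟩) : α ⊕ l n → α ⊕ (Σ n, l n))))
      convert this using 1
      ext x
      refine exists_congr fun a => ?_
      simp only [mem_fib, mem_ofPred_eq, mem_preimage, Finset.mem_range]
      refine forall₂_congr fun n _ => ?_
      have : Sum.elim a (lvl x n) = Sum.elim a x ∘ Sum.map id (fun i => ⟨n, i⟩) := by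
        ext (i | i) <;> rfl
      rw [this]
    exact (hX σ N _ hdef).1 (hne N)
  choose E hE using hbr
  obtain ⟨c, hc1, hc2⟩ := exists_lt_power_aleph0 (2 ^ cardL L)
    ((le_sup_right : ℵ₀ ≤ cardL L).trans (cantor _).le)
  let Λ : Type u := c.out
  have hΛ : #Λ = c := mk_out c
  let I : Type u := Finset Λ × ℕ
  have hfF : ∀ F : Finset Λ, ∃ f : Λ → ℕ, InjOn f F := fun F =>
    Set.countable_iff_exists_injOn.1 F.finite_toSet.countable
  choose f hf using hfF
  let U : Ultrafilter I := Ultrafilter.of Filter.atTop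
  have hU : ∀ {p : I → Prop}, (∀ᶠ i in Filter.atTop, p i) → ∀ᶠ i in (U : Filter I), p i :=
    fun h => Ultrafilter.of_le _ h
  let N := (U : Filter I).Product fun _ => M
  have hNM : N ⊨ L.completeTheory M := by
    rw [Theory.model_iff]
    intro φ hφ
    rw [Ultraproduct.sentence_realize]
    exact Filter.Eventually.of_forall fun _ => hφ
  choose φ hφ using fun n => empty_definable_iff.1 (ht n)
  have hφt : ∀ n x, (φ n).Realize x ↔ x ∈ t n := fun n x => by rw [hφ n]; rfl
  let T : ∀ n, Set (α ⊕ l n → N) := fun n => {x | (φ n).Realize x}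
  let toN : (I → M) → N := fun x => ((x : I → M) : (U : Filter I).Product fun _ => M)
  let D : (ℕ → Λ) → ∀ n, l n → N := fun σ n i =>
    toN (fun q => lvl (X (f q.1 ∘ σ) (n + 1)) n i)
  let e : (ℕ → Λ) → α → N := fun σ i => toN (fun q => E (f q.1 ∘ σ) q.2 i)
  have los : ∀ n (x : α ⊕ l n → I → M), (fun i => toN (x i)) ∈ T n ↔
      ∀ᶠ q in (U : Filter I), (fun i => x i q) ∈ t n := by
    intro n x
    simp only [← hφt]
    exact Ultraproduct.realize_formula_cast (φ n) x
  have hcard : #(ℕ → Λ) ≤ #Λ := by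
    refine tree_bound H.ss hNM (by rwa [hΛ]) T (fun n => empty_definable_iff.2 ⟨φ n, rfl⟩) D e
      ?_ ?_ ?_
    · intro σ n
      have h1 := (los n (Sum.elim (fun i q => E (f q.1 ∘ σ) q.2 i)
        (fun i q => lvl (X (f q.1 ∘ σ) (n + 1)) n i))).2 (hU (by
          filter_upwards [Filter.eventually_ge_atTop ((∅, n + 1) : I)] with q hq
          have := hE (f q.1 ∘ σ) q.2 n hq.2
          rw [hX2 _ n q.2 hq.2] at this
          convert this using 1
          ext (i | i) <;> rfl))
      convert h1 using 1
      ext (i | i) <;> rfl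
    · intro σ σ' n h
      ext i
      simp only [D]
      congr 1
      ext q
      rw [hX' _ (f q.1 ∘ σ') (n + 1) fun m hm => by simp [h m (Nat.le_of_lt_succ hm)] ]
    · intro σ n
      refine ⟨k n, ?_⟩
      rintro S hS ⟨a, ha⟩
      have : ∃ a' : α → I → M, ∀ i, toN (a' i) = a i :=
        ⟨fun i => Quotient.out (a i), fun i => Quotient.out_eq (a i)⟩
      obtain ⟨a', ha'⟩ := this
      have h1 : ∀ j ∈ S, ∀ᶠ q in (U : Filter I), Sum.elim (fun i => a' i q)
          (lvl (X (f q.1 ∘ Function.update σ n j) (n + 1)) n) ∈ t n := by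
        intro j hj
        have h2 := (los n (Sum.elim a' (fun i q =>
          lvl (X (f q.1 ∘ Function.update σ n j) (n + 1)) n i))).1 (by
            convert ha j hj using 1
            ext (i | i)
            · exact ha' i
            · rfl)
        filter_upwards [h2] with q hq
        convert hq using 1
        ext (i | i) <;> rfl
      have h3 := (Filter.eventually_all_finset S).2 h1
      obtain ⟨q, hq, hqS⟩ := (h3.and (hU (Filter.eventually_ge_atTop ((S, 0) : I)))).exists
      have hinj : InjOn (f q.1) S := (hf q.1).mono hqS.1
      refine hinc (f q.1 ∘ σ) n (S.image (f q.1)) (by rw [Finset.card_image_of_injOn hinj, hS])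
        ⟨fun i => a' i q, fun j hj => ?_⟩
      obtain ⟨j, hjS, rfl⟩ := Finset.mem_image.1 hj
      have := hq j hjS
      rwa [Function.comp_update] at this
  have : #(ℕ → Λ) = c ^ (ℵ₀ : Cardinal.{u}) := by
    simp [hΛ]
  rw [this, hΛ] at hcard
  exact hcard.not_gt hc2

variable (L M α) in
/-- A definable set together with its parameters. -/
structure Node : Type (max u 1) where
  ι : Type
  fin : Finite ι
  e : ι → M
  s : Set (α ⊕ ι → M)
  def_s : (∅ : Set M).Definable L s

attribute [instance] Node.fin

/-- The underlying definable set of a node. -/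
def Node.set (x : Node L M α) : Set (α → M) := fib x.s x.e

/-- `x` is a dividing extension of `y`. -/
def Node.Lt (x y : Node L M α) : Prop :=
  x.set.Nonempty ∧ x.set ⊆ y.set ∧ (∃ j, x.e ∘ j = y.e) ∧ ∃ (ι : Type) (_ : Finite ι)
    (t : Set (α ⊕ ι → M)) (g : ι → x.ι), (∅ : Set M).Definable L t ∧
      x.set ⊆ fib t (x.e ∘ g) ∧ Div L (range y.e) t (x.e ∘ g)

theorem Node.wf (H : Ctx L M κ) [Finite α] : WellFounded (Node.Lt (L := L) (M := M) (α := α)) := by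
  rw [wellFounded_iff_isEmpty_descending_chain]
  refine ⟨fun ⟨x, hx⟩ => ?_⟩
  choose hne hsub hj ι hι t g ht hxt hdiv using hx
  have hmono : Antitone fun n => (x n).set := antitone_nat_of_succ_le hsub
  have hr : Monotone fun n => range (x n).e := monotone_nat_of_le_succ fun n => by
    obtain ⟨j, hj⟩ := hj n
    change range (x n).e ⊆ range (x (n + 1)).e
    rw [← hj]
    exact range_comp_subset_range _ _
  refine no_chain H ht (fun p : Σ n, ι n => (x (p.1 + 1)).e (g p.1 p.2)) (fun n => ?_) fun N => ?_
  · refine (hdiv n).mono_base ?_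
    rintro _ ⟨⟨m, i⟩, hm, rfl⟩
    exact hr (Nat.succ_le_of_lt hm) ⟨_, rfl⟩
  · obtain ⟨a, ha⟩ := hne N
    exact ⟨a, fun n hn => hxt n (hmono (Nat.succ_le_of_lt hn) (hmono N.le_succ ha))⟩

/-- The rank of a node. -/
noncomputable def Node.rk (H : Ctx L M κ) [Finite α] (x : Node L M α) : Ordinal.{max u 1} :=
  haveI : IsWellFounded (Node L M α) Node.Lt := ⟨Node.wf H⟩
  IsWellFounded.rank Node.Lt x

theorem Node.rk_lt (H : Ctx L M κ) [Finite α] {x y : Node L M α} (h : x.Lt y) :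
    x.rk H < y.rk H :=
  haveI : IsWellFounded (Node L M α) Node.Lt := ⟨Node.wf H⟩
  IsWellFounded.rank_lt_of_rel h

theorem Node.rk_le (H : Ctx L M κ) [Finite α] {x : Node L M α} {o : Ordinal}
    (h : ∀ y : Node L M α, y.Lt x → y.rk H < o) : x.rk H ≤ o := by
  have : IsWellFounded (Node L M α) Node.Lt := ⟨Node.wf H⟩
  rw [Node.rk, IsWellFounded.rank_eq]
  refine Ordinal.iSup_le fun y => ?_
  exact Order.succ_le_of_lt (h y.1 y.2)

/-- Change of parameters. -/
def Node.move (x : Node L M α) (e : x.ι → M) : Node L M α := { x with e := e }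

theorem fib_nonempty_congr [Finite α] {s : Set (α ⊕ β → M)} (hs : A.Definable L s) {b b' : β → M}
    (h : EqTp L A b b') (hn : (fib s b).Nonempty) : (fib s b').Nonempty :=
  (h _ (definable_exists_fib hs)).1 hn

theorem Node.rk_move (H : Ctx L M κ) [Finite α] (x : Node L M α) : ∀ e, EqTp L ∅ x.e e →
    x.rk H ≤ (x.move e).rk H := by
  have wf := Node.wf (L := L) (M := M) (α := α) H
  induction x using wf.induction with
  | _ x ih =>
  intro e he
  refine Node.rk_le H fun z hz => ?_
  obtain ⟨ez, hez⟩ := copy H empty_small he z.e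
  refine (ih z hz ez hez.inl).trans_lt (Node.rk_lt H ?_)
  obtain ⟨hne, hsub, ⟨j, hj⟩, ι, hι, t, g, ht, hzt, hdiv⟩ := hz
  refine ⟨fib_nonempty_congr z.def_s hez.inl hne, fib_subset_congr z.def_s x.def_s hez hsub,
    ⟨j, ?_⟩, ι, hι, t, g, ht, ?_, ?_⟩
  · ext i
    exact (hez.eq_iff (Sum.inl (j i)) (Sum.inr i)).1 (congrFun hj i)
  · exact fib_subset_congr z.def_s ht (hez.of_comp (Sum.elim Sum.inl (Sum.inl ∘ g))
      (x' := Sum.elim z.e (z.e ∘ g)) (y' := Sum.elim ez (ez ∘ g))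
      (by ext (i | i) <;> rfl) (by ext (i | i) <;> rfl)) hzt
  · have := Div.congr H empty_small ht (hez.of_comp (Sum.elim Sum.inr (Sum.inl ∘ g))
      (x' := Sum.elim x.e (z.e ∘ g)) (y' := Sum.elim e (ez ∘ g))
      (by ext (i | i) <;> rfl) (by ext (i | i) <;> rfl)) (by simpa using hdiv)
    rw [empty_union] at this
    exact this

/-- Add dummy parameters. -/
def Node.addParam (x : Node L M α) {β : Type} [Finite β] (e : β → M) : Node L M α where
  ι := x.ι ⊕ β
  fin := inferInstance
  e := Sum.elim x.e e
  s := (fun y => y ∘ Sum.map id Sum.inl) ⁻¹' x.s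
  def_s := x.def_s.preimage_comp _

theorem Node.set_addParam (x : Node L M α) {β : Type} [Finite β] (e : β → M) :
    (x.addParam e).set = x.set := by
  ext a
  simp only [Node.set, Node.addParam, mem_fib, mem_preimage]
  have : Sum.elim a (Sum.elim x.e e) ∘ Sum.map id Sum.inl = Sum.elim a x.e := by
    ext (i | i) <;> rfl
  rw [this]

theorem Node.rk_mono (H : Ctx L M κ) [Finite α] (y : Node L M α) : ∀ y1 : Node L M α,
    y.set ⊆ y1.set → y.rk H ≤ y1.rk H := by
  have wf := Node.wf (L := L) (M := M) (α := α) H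
  induction y using wf.induction with
  | _ y ih =>
  intro y1 hy
  refine Node.rk_le H fun z hz => ?_
  have hz' := hz
  obtain ⟨hne, hsub, ⟨j, hj⟩, ι, hι, t, g, ht, hzt, hdiv⟩ := hz
  have hsm : #(range y.e) ≤ κ := small_range H.inf y.e
  obtain ⟨w, hw, hwd⟩ := Div.copy H hsm (small_range H.inf y1.e)
    (ht.mono (empty_subset _)) hdiv
  have hw2 : EqTp L ∅ (Sum.elim z.e y.e) (Sum.elim w y.e) :=
    eqTp_sum_iff.2 (by rwa [empty_union])
  have hws : (z.move w).set ⊆ y.set := fib_subset_congr z.def_s y.def_s hw2 hsub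
  have hwt : (z.move w).set ⊆ fib t (w ∘ g) :=
    fib_subset_congr z.def_s ht (hw2.of_comp (Sum.elim Sum.inl (Sum.inl ∘ g))
      (x' := Sum.elim z.e (z.e ∘ g)) (y' := Sum.elim w (w ∘ g))
      (by ext (i | i) <;> rfl) (by ext (i | i) <;> rfl)) hzt
  have hwn : (z.move w).set.Nonempty := fib_nonempty_congr z.def_s hw2.inl hne
  have hwy : (z.move w).Lt y := by
    refine ⟨hwn, hws, ⟨j, ?_⟩, ι, hι, t, g, ht, hwt, hwd.mono_base subset_union_left⟩
    ext i
    exact (hw2.eq_iff (Sum.inl (j i)) (Sum.inr i)).1 (congrFun hj i)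
  refine (z.rk_move H w hw2.inl).trans_lt ((ih _ hwy ((z.move w).addParam y1.e)
    (by rw [Node.set_addParam])).trans_lt (Node.rk_lt H ?_))
  refine ⟨by rwa [Node.set_addParam], by rw [Node.set_addParam]; exact hws.trans hy,
    ⟨Sum.inr, rfl⟩, ι, hι, t, Sum.inl ∘ g, ht, by rw [Node.set_addParam]; exact hwt,
    hwd.mono_base subset_union_right⟩

/-- Intersect a node with a definable set in the same parameters. -/
def Node.inter (x : Node L M α) (s : Set (α ⊕ x.ι → M)) (hs : (∅ : Set M).Definable L s) :
    Node L M α := { x with s := x.s ∩ s, def_s := x.def_s.inter hs }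

theorem Node.set_inter (x : Node L M α) (s : Set (α ⊕ x.ι → M)) (hs : (∅ : Set M).Definable L s) :
    (x.inter s hs).set = x.set ∩ fib s x.e := rfl

theorem Node.rk_union (H : Ctx L M κ) [Finite α] (x : Node L M α) : ∀ x1 x2 : Node L M α,
    (∃ j, x.e ∘ j = x1.e) → (∃ j, x.e ∘ j = x2.e) → x.set ⊆ x1.set ∪ x2.set →
    x.rk H ≤ max (x1.rk H) (x2.rk H) := by
  have wf := Node.wf (L := L) (M := M) (α := α) H
  induction x using wf.induction with
  | _ x ih =>
  rintro x1 x2 ⟨j1, hj1⟩ ⟨j2, hj2⟩ hx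
  refine Node.rk_le H fun z hz => ?_
  have hz' := hz
  obtain ⟨hne, hsub, ⟨j, hj⟩, ι, hι, t, g, ht, hzt, hdiv⟩ := hz
  have key : ∀ x1 : Node L M α, ∀ j1, x.e ∘ j1 = x1.e → ∃ z1 : Node L M α,
      z1.set = z.set ∩ x1.set ∧ z1.ι = z.ι ∧ (∃ j, z.e ∘ j = z1.e) ∧
      (z1.set.Nonempty → z1.Lt x1) := by
    intro x1 j1 hj1
    let s : Set (α ⊕ z.ι → M) := (fun y => y ∘ Sum.map id (j ∘ j1)) ⁻¹' x1.s
    have hs : (∅ : Set M).Definable L s := x1.def_s.preimage_comp _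
    have hse : z.e ∘ (j ∘ j1) = x1.e := by rw [← Function.comp_assoc, hj, hj1]
    have h1 : (z.inter s hs).set = z.set ∩ x1.set := by
      rw [Node.set_inter]
      congr 1
      ext a
      simp only [s, mem_fib, mem_preimage, Node.set, Sum.elim_comp_map, Function.comp_id, hse]
    refine ⟨z.inter s hs, h1, rfl, ⟨id, rfl⟩, fun hn => ⟨hn, ?_, ⟨j ∘ j1, hse⟩, ι, hι, t, g, ht,
      ?_, ?_⟩⟩
    · rw [h1]; exact inter_subset_right
    · rw [h1]; exact inter_subset_left.trans hzt
    · refine hdiv.mono_base ?_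
      rw [← hj1]; exact range_comp_subset_range _ _
  obtain ⟨z1, hz1, -, hz1j, hz1l⟩ := key x1 j1 hj1
  obtain ⟨z2, hz2, -, hz2j, hz2l⟩ := key x2 j2 hj2
  have hzz : z.set ⊆ z1.set ∪ z2.set := by
    intro a ha
    rw [hz1, hz2]
    exact (hx (hsub ha)).imp (fun h => ⟨ha, h⟩) fun h => ⟨ha, h⟩
  rcases z1.set.eq_empty_or_nonempty with h1 | h1
  · rw [h1, empty_union] at hzz
    exact (z.rk_mono H z2 hzz).trans_lt (lt_max_of_lt_right (Node.rk_lt H (hz2l (hne.mono hzz))))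
  rcases z2.set.eq_empty_or_nonempty with h2 | h2
  · rw [h2, union_empty] at hzz
    exact (z.rk_mono H z1 hzz).trans_lt (lt_max_of_lt_left (Node.rk_lt H (hz1l (hne.mono hzz))))
  · exact (ih z hz' z1 z2 hz1j hz2j hzz).trans_lt
      (max_lt_max (Node.rk_lt H (hz1l h1)) (Node.rk_lt H (hz2l h2)))

theorem Node.rk_lt_of_cover (H : Ctx L M κ) [Finite α] {o : Ordinal} (x : Node L M α)
    {T : Set (Set (α ⊕ x.ι → M))} (hT : T.Finite) : (∀ t ∈ T, (∅ : Set M).Definable L t) →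
    ∀ s (hs : (∅ : Set M).Definable L s), (x.inter s hs).set.Nonempty →
    (x.inter s hs).set ⊆ fib (⋃₀ T) x.e →
    (∀ t ∈ T, ∀ s (hs : (∅ : Set M).Definable L s), (x.inter s hs).set ⊆ fib t x.e →
      (x.inter s hs).set.Nonempty → (x.inter s hs).rk H < o) →
    (x.inter s hs).rk H < o := by
  induction T, hT using Set.Finite.induction_on with
  | empty =>
    rintro - s hs ⟨a, ha⟩ h -
    simpa using h ha
  | @insert t T _ hT ih =>
    intro hTd s hs hne hcov ho
    have ht := hTd t (mem_insert _ _)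
    have hTd' : ∀ t ∈ T, (∅ : Set M).Definable L t := fun t h => hTd t (mem_insert_of_mem _ h)
    have hTu : (∅ : Set M).Definable L (⋃₀ T) := definable_sUnion hT hTd'
    have ho' := fun t (h : t ∈ T) => ho t (mem_insert_of_mem _ h)
    have hcov' : (x.inter s hs).set ⊆
        (x.inter (s ∩ t) (hs.inter ht)).set ∪ (x.inter (s ∩ ⋃₀ T) (hs.inter hTu)).set := by
      intro a ha
      have := hcov ha
      rw [sUnion_insert] at this
      exact this.imp (fun h => ⟨ha.1, ha.2, h⟩) fun h => ⟨ha.1, ha.2, h⟩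
    have h1 : (x.inter (s ∩ t) (hs.inter ht)).set.Nonempty →
        (x.inter (s ∩ t) (hs.inter ht)).rk H < o :=
      ho t (mem_insert _ _) _ _ fun a ha => ha.2.2
    have h2 : (x.inter (s ∩ ⋃₀ T) (hs.inter hTu)).set.Nonempty →
        (x.inter (s ∩ ⋃₀ T) (hs.inter hTu)).rk H < o := fun hn =>
      ih hTd' _ (hs.inter hTu) hn (fun a ha => ha.2.2) ho'
    rcases (x.inter (s ∩ t) (hs.inter ht)).set.eq_empty_or_nonempty with h3 | h3
    · rw [h3, empty_union] at hcov'
      exact (Node.rk_mono H _ _ hcov').trans_lt (h2 (hne.mono hcov'))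
    rcases (x.inter (s ∩ ⋃₀ T) (hs.inter hTu)).set.eq_empty_or_nonempty with h4 | h4
    · rw [h4, union_empty] at hcov'
      exact (Node.rk_mono H _ _ hcov').trans_lt (h1 (hne.mono hcov'))
    · exact (Node.rk_union H (x.inter s hs) (x.inter (s ∩ t) (hs.inter ht))
        (x.inter (s ∩ ⋃₀ T) (hs.inter hTu)) ⟨id, rfl⟩ ⟨id, rfl⟩ hcov').trans_lt (max_lt (h1 h3) (h2 h4))

theorem Node.rk_lt_of_fi (H : Ctx L M κ) [Finite α] {z y : Node L M α} (hne : z.set.Nonempty)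
    (hzy : z.set ⊆ y.set) (hF : FI L (range y.e) z.set) : z.rk H < y.rk H := by
  obtain ⟨ι, hι, d, T, hT, h1, h2⟩ := hF
  let x : Node L M α := (z.addParam y.e).addParam d
  have hx : x.set = z.set := by simp only [x, Node.set_addParam]
  have hxs : (x.inter univ definable_univ).set = z.set := by
    rw [Node.set_inter, hx]; simp [fib]
  let G : Set (α ⊕ ι → M) → Set (α ⊕ x.ι → M) := fun t => (fun y => y ∘ Sum.map id Sum.inr) ⁻¹' t
  have hG : ∀ t, fib (G t) x.e = fib t d := by
    intro t
    ext a
    have : Sum.elim a x.e ∘ Sum.map id Sum.inr = Sum.elim a d := by ext (i | i) <;> rfl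
    simp only [G, mem_fib, mem_preimage, this]
  refine (Node.rk_mono H z (x.inter univ definable_univ) hxs.ge).trans_lt ?_
  refine Node.rk_lt_of_cover H x (hT.image G) ?_ _ _ (hxs ▸ hne) ?_ ?_
  · rintro _ ⟨t, ht, rfl⟩
    exact (h1 t ht).1.preimage_comp _
  · rw [hxs]
    intro a ha
    obtain ⟨t, ht, hat⟩ := h2 ha
    refine ⟨G t, ⟨t, ht, rfl⟩, ?_⟩
    rw [← mem_fib, hG]
    exact hat
  · rintro _ ⟨t, ht, rfl⟩ s hs hst hn
    refine Node.rk_lt H ⟨hn, ?_, ⟨Sum.inl ∘ Sum.inr, rfl⟩, ι, hι, t, Sum.inr, (h1 t ht).1,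
      (hG t) ▸ hst, (h1 t ht).2⟩
    rw [Node.set_inter, hx]
    exact inter_subset_left.trans hzy

/-- Local character of nonforking: superstability gives a finite base. -/
theorem local_char (H : Ctx L M κ) [Finite α] (a : α → M) (B : Set M) :
    ∃ E ⊆ B, E.Finite ∧ Ind L a E B := by
  let S : Set (Node L M α) := {y | range y.e ⊆ B ∧ a ∈ y.set}
  have hS : S.Nonempty := ⟨⟨Empty, inferInstance, Empty.elim, univ, definable_univ⟩,
    by rintro _ ⟨i, -⟩; exact i.elim, by simp [Node.set]⟩
  obtain ⟨y, ⟨hyB, hay⟩, hmin⟩ :=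
    (InvImage.wf (fun y : Node L M α => y.rk H) Ordinal.lt_wf).has_min S hS
  refine ⟨range y.e, hyB, finite_range _, fun W hW haW hF => ?_⟩
  rw [union_eq_self_of_subset_left hyB] at hW
  obtain ⟨n, e, t, he, ht, rfl⟩ := exists_fib_fin hW
  let z : Node L M α := ⟨y.ι ⊕ Fin n, inferInstance, Sum.elim y.e e,
    ((fun x => x ∘ Sum.map id Sum.inl) ⁻¹' y.s) ∩ ((fun x => x ∘ Sum.map id Sum.inr) ⁻¹' t),
    (y.def_s.preimage_comp _).inter (ht.preimage_comp _)⟩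
  have hz : z.set = y.set ∩ fib t e := by
    ext x
    simp only [z, Node.set, mem_fib, mem_inter_iff, mem_preimage, Sum.elim_comp_map,
      Function.comp_id, Sum.elim_comp_inl, Sum.elim_comp_inr]
  refine hmin z ⟨?_, hz ▸ ⟨hay, haW⟩⟩ (Node.rk_lt_of_fi H ⟨a, hz ▸ ⟨hay, haW⟩⟩
    (hz ▸ inter_subset_left) (hF.subset (hz ▸ inter_subset_right)))
  change range (Sum.elim y.e e) ⊆ B
  rw [Sum.elim_range]
  exact union_subset hyB he

theorem ind_self (H : Ctx L M κ) [Finite α] (a : α → M) (C : Set M) : Ind L a C C := by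
  obtain ⟨E, hE, -, h⟩ := local_char H a C
  exact (h.base_mono hE subset_union_right).mono subset_union_left

theorem ind_of_subset {a : α → M} (ha : range a ⊆ C) : Ind L a C B := by
  rintro W - haW ⟨ι, hι, d, T, hT, h1, h2⟩
  obtain ⟨t, ht, hat⟩ := h2 haW
  obtain ⟨v, hv, k, hk, hki⟩ := (h1 t ht).2
  obtain ⟨S, hS⟩ := Infinite.exists_subset_card_eq ℕ k
  exact hki S hS ⟨a, fun j _ =>
    (((hv j).add ha).swap _ ((h1 t ht).1.mono (empty_subset _))).2 hat⟩

theorem exists_seq (H : Ctx L M κ) [Finite α] (hC : #C ≤ κ) (hB : #B ≤ κ) {a : α → M}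
    (h : Ind L a C B) : ∃ f : ℕ → α → M, ∀ n, EqTp L (C ∪ B) (f n) a ∧
      Ind L (f n) C (B ∪ ⋃ i ∈ Iio n, range (f i)) := by
  have : Nonempty (α → M) := ⟨a⟩
  refine dc_greedy (fun n f x => EqTp L (C ∪ B) x a ∧ Ind L x C (B ∪ ⋃ i ∈ Iio n, range (f i)))
    ?_ ?_
  · intro n g g' hg x hx
    have : (⋃ i ∈ Iio n, range (g' i)) = ⋃ i ∈ Iio n, range (g i) :=
      iUnion₂_congr fun i hi => by rw [hg i hi]
    rwa [this]
  · intro n g _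
    obtain ⟨a', h1, h2⟩ := h.ext H hC hB (D := ⋃ i ∈ Iio n, range (g i))
      (small_finite H.inf ((finite_Iio n).biUnion fun i _ => finite_range _))
    exact ⟨a', h1.symm, h2⟩

theorem Ind.move (H : Ctx L M κ) (hC : #C ≤ κ) [Finite α] [Countable β] {a a' : α → M}
    {e e' : β → M} (hi : Ind L a C (range e)) (h : EqTp L C (Sum.elim a e) (Sum.elim a' e')) :
    Ind L a' C (range e') := by
  have := Ind.congr H hC empty_small (b := (Empty.elim : Empty → M)) (b' := Empty.elim)
    (a := a) (a' := a') (e := e) (e' := e') (B := ∅) (C := C) ?_ (by rwa [range_eq_empty, union_empty, empty_union])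
  · rwa [range_eq_empty, union_empty, empty_union] at this
  · rw [union_empty]
    refine h.of_comp (Sum.elim Sum.inl (Sum.elim Empty.elim Sum.inr)) ?_ ?_ <;>
      ext (i | i | i) <;> first | rfl | exact i.elim

variable (L) in
/-- Nonforking independence of sets. -/
def SInd (A C B : Set M) : Prop :=
  ∀ (n : ℕ) (e : Fin n → M), range e ⊆ A → Ind L e C B

theorem SInd.tuple (h : SInd L A C B) [Finite α] {a : α → M} (ha : range a ⊆ A) :
    Ind L a C B := by
  obtain ⟨n, ⟨e⟩⟩ := Finite.exists_equiv_fin α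
  have := (h n (a ∘ e.symm) ((range_comp_subset_range _ _).trans ha)).comp e
  rwa [Function.comp_assoc, e.symm_comp_self] at this

theorem Ind.sInd {a : α → M} (h : Ind L a C B) (hA : A ⊆ range a) : SInd L A C B := by
  intro n e he
  choose g hg using fun i => hA (he ⟨i, rfl⟩)
  have := h.comp g
  rwa [show a ∘ g = e from funext hg] at this

theorem SInd.mono (h : SInd L A C B) {A' B' : Set M} (hA : A' ⊆ A) (hB : B' ⊆ C ∪ B) :
    SInd L A' C B' := fun n e he => (h n e (he.trans hA)).mono hB

theorem SInd.pair (H : Ctx L M κ) (hC : #C ≤ κ) (hD : #D ≤ κ) [Finite α] (hA : A.Finite)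
    {a : α → M} (h : SInd L A C D) (ha : Ind L a (C ∪ A) D) : SInd L (A ∪ range a) C D := by
  obtain ⟨n, e, rfl⟩ := exists_enum hA
  refine (Ind.pair H hC hD (h n e le_rfl) ha).sInd ?_
  rw [Sum.elim_range, union_comm]

theorem SInd.seq (H : Ctx L M κ) (hC : #C ≤ κ) [Finite α] {f : ℕ → α → M}
    (hf : ∀ n, Ind L (f n) C (⋃ i ∈ Iio n, range (f i))) (m k : ℕ) :
    SInd L (⋃ i ∈ Ioc m (m + k), range (f i)) C (range (f m)) := by
  induction k with
  | zero =>
    intro n e he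
    simp only [add_zero, Ioc_self, mem_empty_iff_false, iUnion_false, iUnion_empty,
      subset_empty_iff, range_eq_empty_iff] at he
    refine ind_of_subset ?_
    rintro _ ⟨i, -⟩
    exact he.elim i
  | succ k ih =>
    have hu : (⋃ i ∈ Ioc m (m + (k + 1)), range (f i)) =
        (⋃ i ∈ Ioc m (m + k), range (f i)) ∪ range (f (m + k + 1)) := by
      ext x
      simp only [mem_iUnion, mem_union, mem_Ioc, exists_prop]
      constructor
      · rintro ⟨i, ⟨h1, h2⟩, hx⟩
        rcases h2.lt_or_eq with h2 | rfl
        · exact Or.inl ⟨i, ⟨h1, by omega⟩, hx⟩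
        · exact Or.inr hx
      · rintro (⟨i, ⟨h1, h2⟩, hx⟩ | hx)
        · exact ⟨i, ⟨h1, by omega⟩, hx⟩
        · exact ⟨_, ⟨by omega, le_rfl⟩, hx⟩
    rw [hu]
    refine SInd.pair H hC (small_range H.inf _) ((finite_Ioc _ _).biUnion fun i _ => finite_range _)
      ih ?_
    refine ((hf (m + k + 1)).base_mono subset_union_left (union_subset subset_union_left ?_)).mono
      ?_
    · refine subset_union_of_subset_right (biUnion_subset_biUnion_left fun i hi => ?_) _
      exact Nat.lt_succ_of_le hi.2
    · refine subset_union_of_subset_right (subset_biUnion_of_mem (u := fun i => range (f i)) ?_) _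
      exact Nat.lt_succ_of_le (Nat.le_add_right _ _)

theorem Ind.symm (H : Ctx L M κ) (hC : #C ≤ κ) [Finite α] [Finite β] {a : α → M} {b : β → M}
    (h : Ind L a C (range b)) : Ind L b C (range a) := by
  have hCb : #↥(C ∪ range b) ≤ κ := small_union H.inf hC (small_range H.inf b)
  obtain ⟨f, hf⟩ := exists_seq H hC (small_range H.inf b) h
  have hseq : ∀ n, Ind L (f n) C (⋃ i ∈ Iio n, range (f i)) := fun n =>
    (hf n).2.mono (subset_union_of_subset_right subset_union_right _)
  let g : ℕ → ℕ × α → M := fun n p => f (n - p.1) p.2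
  obtain ⟨x, hx⟩ := realize_ultrafilter_countable H hCb ((Filter.hyperfilter ℕ).map g)
  have hev : ∀ s : Set (ℕ × α → M), (C ∪ range b).Definable L s → ∀ N, (∀ n ≥ N, g n ∈ s) →
      x ∈ s := fun s hs N h => (hx s hs).2 (Filter.Eventually.filter_mono
        Nat.hyperfilter_le_atTop (Filter.eventually_atTop.2 ⟨N, h⟩ : ∀ᶠ n in .atTop, g n ∈ s))
  have hxa : ∀ N, EqTp L (C ∪ range b) (fun i => x (N, i)) a := by
    have : ∀ N s, (C ∪ range b).Definable L s → a ∈ s → (fun i => x (N, i)) ∈ s := by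
      intro N s hs ha
      exact hev _ (hs.preimage_comp fun i => (N, i)) 0 fun n _ => ((hf (n - N)).1 s hs).2 ha
    intro N s hs
    refine ⟨fun h => ?_, this N s hs⟩
    by_contra ha
    exact this N sᶜ hs.compl ha h
  have hxN : ∀ N, Ind L (fun p : Fin N × α => x (p.1, p.2)) C (range fun i => x (N, i)) := by
    intro N W hW hxW hF
    obtain ⟨t, ht, rfl⟩ := exists_fib hW
    refine hev {y | Sum.elim (fun p : Fin N × α => y (p.1, p.2)) (fun i => y (N, i)) ∈ t}ᶜ ?_ N
      ?_ hxW
    · refine Definable.compl ?_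
      convert (ht.mono subset_union_left).preimage_comp
        (Sum.elim (fun p : Fin N × α => ((p.1 : ℕ), p.2)) fun i => (N, i)) using 1
      ext y
      simp only [mem_preimage]
      rw [Set.mem_ofPred_eq, Sum.comp_elim]
      rfl
    · intro n hn hgn
      have h1 : Ind L (fun p : Fin N × α => f (n - p.1) p.2) C (range (f (n - N))) := by
        refine (SInd.seq H hC hseq (n - N) N).tuple ?_
        rintro _ ⟨⟨i, j⟩, rfl⟩
        exact mem_biUnion (x := n - (i : ℕ)) ⟨by omega, by omega⟩ ⟨j, rfl⟩
      obtain ⟨y, hy⟩ := copy H hC ((((hf (n - N)).1.trans (hxa N).symm).mono subset_union_left))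
        (fun p : Fin N × α => f (n - p.1) p.2)
      exact h1.move H hC hy _ (definable_fib ht _) ((hy _ ht).1 hgn) hF
  obtain ⟨E, hE, hEf, hbE⟩ := local_char H b (C ∪ range x)
  obtain ⟨N, hN⟩ : ∃ N, E ⊆ C ∪ range fun p : Fin N × α => x (p.1, p.2) := by
    have : ∀ F : Set M, F.Finite → F ⊆ C ∪ range x →
        ∃ N, F ⊆ C ∪ range fun p : Fin N × α => x (p.1, p.2) := by
      intro F hF
      induction F, hF using Set.Finite.induction_on with
      | empty => exact fun _ => ⟨0, empty_subset _⟩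
      | @insert y F _ _ ih =>
        intro hF
        obtain ⟨N, hN⟩ := ih ((subset_insert _ _).trans hF)
        have hm : ∀ N', N ≤ N' → F ⊆ C ∪ range fun p : Fin N' × α => x (p.1, p.2) := by
          refine fun N' hN' => hN.trans (union_subset_union_right _ ?_)
          rintro _ ⟨⟨i, j⟩, rfl⟩
          exact ⟨⟨⟨i, i.2.trans_le hN'⟩, j⟩, rfl⟩
        rcases hF (mem_insert _ _) with h | ⟨⟨i, j⟩, rfl⟩
        · exact ⟨N, insert_subset (Or.inl h) hN⟩
        · exact ⟨max N (i + 1), insert_subset (Or.inr ⟨⟨⟨i, by simp⟩, j⟩, rfl⟩)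
            (hm _ (le_max_left _ _))⟩
    exact this E hEf hE
  have h1 : Ind L b (C ∪ range fun p : Fin N × α => x (p.1, p.2)) (range fun i => x (N, i)) :=
    by
    refine (hbE.base_mono hN (subset_union_of_subset_right (union_subset_union_right _ ?_) _)).mono
      (subset_union_of_subset_right (subset_union_of_subset_right ?_ _) _)
    · rintro _ ⟨p, rfl⟩
      exact ⟨_, rfl⟩
    · rintro _ ⟨p, rfl⟩
      exact ⟨_, rfl⟩
  have h2 := (Ind.pair H hC (small_range H.inf _) (hxN N) h1).comp Sum.inl
  rw [Sum.elim_comp_inl] at h2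
  exact h2.move H hC (eqTp_sum_iff.2 (hxa N)).swap

/-- If `e` is independent from `B` over `C`, dividing at `e` over `C` persists over `C ∪ B`. -/
theorem Div.base_ext (H : Ctx L M κ) (hC : #C ≤ κ) (hB : #B ≤ κ) [Finite α] [Finite ι]
    {t : Set (α ⊕ ι → M)} {e : ι → M} (ht : C.Definable L t) (hd : Div L C t e)
    (he : Ind L e C B) : Div L (C ∪ B) t e := by
  obtain ⟨v, hv, hv0, k, hk, hki⟩ := hd.indisc_zero H hC ht
  have hex : ∀ F : Finset B, ∃ w : ℕ × ι → M,
      (∀ j, EqTp L (C ∪ (↑) '' (F : Set B)) (fun i => w (j, i)) e) ∧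
      KInc t k fun j i => w (j, i) := by
    intro F
    obtain ⟨n, b, hb⟩ := exists_enum (F.finite_toSet.image ((↑) : B → M))
    rw [← hb]
    have h1 : Ind L e C (range b) := he.mono (by
      rw [hb]
      rintro _ ⟨i, -, rfl⟩
      exact Or.inr i.2)
    have h2 := h1.symm H hC
    rw [← hv0] at h2
    obtain ⟨y, hy⟩ := hv.common H hC h2
    obtain ⟨w, hw⟩ := Benign.copy H hC (hy 0).inl (fun p : ℕ × ι => v p.1 p.2)
    refine ⟨w, fun j => EqTp.of_sum ?_, hki.congr ht hw.inl⟩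
    refine EqTp.trans ?_ ((hy j).trans (by rw [hv0]; exact .refl _)).swap
    exact (hw.of_comp (Sum.elim (fun i => Sum.inl (j, i)) Sum.inr) (by ext (i | i) <;> rfl)
      (by ext (i | i) <;> rfl)).symm
  choose w hw hwk using hex
  obtain ⟨x, hx⟩ := realize_ultrafilter_countable H (small_union H.inf hC hB)
    ((Ultrafilter.of (Filter.atTop : Filter (Finset B))).map w)
  have hev : ∀ s : Set (ℕ × ι → M), (C ∪ B).Definable L s → (∃ F, ∀ G ≥ F, w G ∈ s) → x ∈ s :=
    fun s hs h => (hx s hs).2 (Ultrafilter.of_le _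
      (Filter.eventually_atTop.2 h : ∀ᶠ G in .atTop, w G ∈ s))
  refine ⟨fun j i => x (j, i), fun j => ?_, k, hk, fun S hS hcon => ?_⟩
  · have : ∀ s, (C ∪ B).Definable L s → e ∈ s → (fun i => x (j, i)) ∈ s := by
      intro s hs hes
      refine hev _ (hs.preimage_comp fun i => (j, i)) ?_
      obtain ⟨n, f, t, hf, ht, rfl⟩ := exists_fib_fin' hs
      refine ⟨(finite_range fun i : Fin n => (⟨f i, hf ⟨i, rfl⟩⟩ : B)).toFinset, fun G hG => ?_⟩
      refine (hw G j _ ((definable_fib ht f).mono (union_subset_union_right _ ?_))).2 hes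
      rintro _ ⟨i, rfl⟩
      exact ⟨⟨f i, hf ⟨i, rfl⟩⟩, hG (by simp), rfl⟩
    intro s hs
    refine ⟨fun h => ?_, this s hs⟩
    by_contra ha
    exact this sᶜ hs.compl ha h
  · have h1 := (definable_exists_fib (definable_forall_mem ht S)).compl.mono
      (subset_union_left (t := B))
    exact hev _ h1 ⟨∅, fun G _ h => hwk G S hS h⟩ hcon

/-- A set forking over `C` with parameters independent from `B` forks over `C ∪ B`. -/
theorem FI.base_ext (H : Ctx L M κ) (hC : #C ≤ κ) (hB : #B ≤ κ) [Finite α] [Finite β]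
    {t : Set (α ⊕ β → M)} {a : β → M} (ht : C.Definable L t) (hF : FI L C (fib t a))
    (ha : Ind L a C B) : FI L (C ∪ B) (fib t a) := by
  obtain ⟨ι, hι, e, T, hT, h1, h2⟩ := hF
  obtain ⟨e', he', hi⟩ := ((ind_self H e (C ∪ range a)).mono (B' := ∅) (empty_subset _)).ext H
    (small_union H.inf hC (small_range H.inf a)) empty_small hB
  rw [union_empty] at he'
  rw [empty_union] at hi
  have hi' := (Ind.pair H hC hB ha hi).comp Sum.inl
  rw [Sum.elim_comp_inl] at hi'
  refine ⟨ι, hι, e', T, hT, fun s hs => ⟨(h1 s hs).1, ?_⟩, ?_⟩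
  · refine Div.base_ext H hC hB ((h1 s hs).1.mono (empty_subset _)) ?_ hi'
    obtain ⟨v, hv, h3⟩ := (h1 s hs).2
    exact ⟨v, fun i => (hv i).trans (he'.mono subset_union_left), h3⟩
  · exact fib_subset_congr ht (definable_sUnion hT fun s hs => (h1 s hs).1.mono (empty_subset _))
      (eqTp_sum_iff.2 he').swap h2

theorem Ind.trans (H : Ctx L M κ) (hC : #C ≤ κ) (hB : #B ≤ κ) [Finite α]
    {a : α → M} (h1 : Ind L a C B) (h2 : Ind L a (C ∪ B) D) : Ind L a C (B ∪ D) := by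
  rw [ind_iff_fin]
  intro n f hf
  have key : ∃ (m : ℕ) (b : Fin m → M) (l : ℕ) (d : Fin l → M), range b ⊆ B ∧ range d ⊆ D ∧
      range f ⊆ range b ∪ range d := by
    obtain ⟨m, b, hb⟩ := exists_enum ((finite_range f).inter_of_left B)
    obtain ⟨l, d, hd⟩ := exists_enum ((finite_range f).inter_of_left D)
    refine ⟨m, b, l, d, hb ▸ inter_subset_right, hd ▸ inter_subset_right, fun x hx => ?_⟩
    rw [hb, hd]
    exact (hf hx).imp (fun h => ⟨hx, h⟩) fun h => ⟨hx, h⟩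
  obtain ⟨m, b, l, d, hb, hd, hfbd⟩ := key
  obtain ⟨E, hE, hEf, hadE⟩ := local_char H (Sum.elim a d) (C ∪ B)
  obtain ⟨q, b', hb'⟩ := exists_enum ((hEf.inter_of_left B).union (finite_range b))
  have hb'B : range b' ⊆ B := hb' ▸ union_subset inter_subset_right hb
  have hC' : #↥(C ∪ range b') ≤ κ := small_union H.inf hC (small_range H.inf b')
  have hCB : C ∪ range b' ∪ B = C ∪ B := by
    rw [union_assoc, union_eq_self_of_subset_left hb'B]
  have h3 : Ind L (Sum.elim a d) (C ∪ range b') B := by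
    have : E ⊆ C ∪ range b' := fun x hx => (hE hx).imp id fun h => hb' ▸ Or.inl ⟨hx, h⟩
    exact (hadE.base_mono this (subset_union_of_subset_right
      (union_subset_union_right _ hb'B) _)).mono (subset_union_of_subset_right
        subset_union_right _)
  have h4 : Ind L a (C ∪ range b') (range d) := by
    refine Ind.symm H hC' fun W hW hdW hF => ?_
    obtain ⟨t, ht, rfl⟩ := exists_fib hW
    have h5 : Ind L d (C ∪ range b' ∪ B) (range a) := by
      rw [hCB]
      exact (h2.mono (subset_union_of_subset_right hd _)).symm H (small_union H.inf hC hB)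
    exact h5 _ (hW.mono (union_subset_union_left _ subset_union_left)) hdW
      (hF.base_ext H hC' hB ht (h3.comp Sum.inl))
  have h6 := Ind.pair H hC (small_range H.inf a)
    ((h1.mono (subset_union_of_subset_right hb'B _)).symm H hC) (h4.symm H hC')
  refine (h6.symm H hC).mono (subset_union_of_subset_right (hfbd.trans ?_) _)
  rw [Sum.elim_range]
  exact union_subset (subset_union_of_subset_right (hb' ▸ subset_union_right) _) subset_union_left

theorem mem_aclSet_iff {x : M} : x ∈ aclSet (L := L) B ↔
    ∃ s : Set (Fin 1 → M), B.Definable L s ∧ ![x] ∈ s ∧ s.Finite := by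
  have key : ∀ s : Set (Fin 1 → M), s.Finite ↔ {y : M | ![y] ∈ s}.Finite := by
    intro s
    have hs : s = (fun y : M => ![y]) '' {y : M | ![y] ∈ s} := by
      ext v
      have hv : ![v 0] = v := by ext i; rw [Subsingleton.elim i 0]; rfl
      constructor
      · intro h
        refine ⟨v 0, ?_, hv⟩
        rw [Set.mem_ofPred_eq, hv]
        exact h
      · rintro ⟨y, hy, rfl⟩
        exact hy
    refine ⟨fun h => h.preimage (f := fun y : M => ![y]) fun a _ b _ h => ?_,
      fun h => hs ▸ h.image _⟩
    exact congrFun h 0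
  constructor
  · rintro ⟨φ, h1, h2⟩
    refine ⟨{v | (φ.relabel Sum.swap).Realize (Sum.elim ((↑) : B → M) v)},
      definable_iff_exists_formula_sum.2 ⟨_, rfl⟩, ?_, (key _).2 ?_⟩
    · simpa [Formula.realize_relabel, elim_comp_swap] using h1
    · simpa [Formula.realize_relabel, elim_comp_swap] using h2
  · rintro ⟨s, hs, hx, hf⟩
    obtain ⟨φ, rfl⟩ := definable_iff_exists_formula_sum.1 hs
    refine ⟨φ.relabel Sum.swap, ?_, ?_⟩
    · simpa [Formula.realize_relabel, elim_comp_swap] using hx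
    · simpa [Formula.realize_relabel, elim_comp_swap] using (key _).1 hf

theorem subset_aclSet : B ⊆ aclSet (L := L) B := fun x hx =>
  mem_aclSet_iff.2 ⟨{v | v 0 = x}, by
    have := (definable_fib (A := B) (definable_eq (L := L) (M := M)
      (Sum.inl 0 : Fin 1 ⊕ Fin 1) (Sum.inr 0)) ![x]).mono (L := L) (B := B) ?_
    · exact this
    · exact union_subset le_rfl (by rintro _ ⟨i, rfl⟩; rw [Subsingleton.elim i 0]; exact hx), rfl,
    (finite_singleton ![x]).subset fun v hv => by
      ext i; rw [Subsingleton.elim i 0]; exact hv⟩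

theorem aclSet_mono (h : A ⊆ B) : aclSet (L := L) A ⊆ aclSet (L := L) B := fun x hx => by
  obtain ⟨s, hs, h'⟩ := mem_aclSet_iff.1 hx
  exact mem_aclSet_iff.2 ⟨s, hs.mono h, h'⟩

theorem aclSet_finite_conj [Finite α] {z : α → M} (hz : range z ⊆ aclSet (L := L) B) :
    {z' | EqTp L B z z'}.Finite := by
  choose s hs hzs hf using fun i => mem_aclSet_iff.1 (hz ⟨i, rfl⟩)
  refine (Finite.pi' (t := fun i => {y : M | ![y] ∈ s i}) fun i => ?_).subset fun z' hz' i => ?_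
  · refine (hf i).preimage (f := fun y : M => ![y]) fun a _ b _ h => ?_
    exact congrFun h 0
  · have h := (hz'.comp fun _ : Fin 1 => i)
    have hv : ∀ z : α → M, z ∘ (fun _ : Fin 1 => i) = ![z i] := fun z => by
      ext i; rw [Subsingleton.elim i 0]; rfl
    rw [hv, hv] at h
    exact (h _ (hs i)).1 (hzs i)

theorem Ind.acl (H : Ctx L M κ) (hC : #C ≤ κ) (hE : #E ≤ κ) [Finite α] {a : α → M}
    (h : Ind L a C E) : Ind L a C (aclSet (L := L) (C ∪ E)) := by
  rw [ind_iff_fin]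
  intro n z hz
  have hfin := aclSet_finite_conj hz
  have hU : (⋃ z' ∈ {z' | EqTp L (C ∪ E) z z'}, range z').Finite :=
    hfin.biUnion fun _ _ => finite_range _
  obtain ⟨a', h1, h2⟩ := h.ext H hC hE (small_finite H.inf hU)
  obtain ⟨z', hz'⟩ := copy H (small_union H.inf hC hE) h1 z
  have h3 : Ind L a' C (range z') := by
    refine h2.mono (subset_union_of_subset_right (subset_union_of_subset_right ?_ _) _)
    exact subset_biUnion_of_mem (u := fun z' : Fin n → M => range z') hz'.inl
  exact h3.move H hC (hz'.mono subset_union_left).swap.symm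

theorem SInd.symm (H : Ctx L M κ) (hC : #C ≤ κ) (h : SInd L A C B) : SInd L B C A := by
  intro n e he
  rw [ind_iff_fin]
  intro m f hf
  exact ((h m f hf).mono (subset_union_of_subset_right he _)).symm H hC

theorem SInd.trans (H : Ctx L M κ) (hC : #C ≤ κ) (hB : #B ≤ κ) (h1 : SInd L A C B)
    (h2 : SInd L A (C ∪ B) D) : SInd L A C (B ∪ D) := fun n e he =>
  (h1 n e he).trans H hC hB (h2 n e he)

theorem SInd.base_mono (h : SInd L A C B) {C' : Set M} (h1 : C ⊆ C') (h2 : C' ⊆ C ∪ B) :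
    SInd L A C' B := fun n e he => (h n e he).base_mono h1 h2

theorem SInd.left_trans (H : Ctx L M κ) (hC : #C ≤ κ) (hA : #A ≤ κ) (h1 : SInd L A C D)
    (h2 : SInd L B (C ∪ A) D) : SInd L (A ∪ B) C D :=
  ((h1.symm H hC).trans H hC hA (h2.symm H (small_union H.inf hC hA))).symm H hC

theorem SInd.acl (H : Ctx L M κ) (hC : #C ≤ κ) (hB : #B ≤ κ) (h : SInd L A C B) :
    SInd L A C (aclSet (L := L) (C ∪ B)) := fun n e he => (h n e he).acl H hC hB

theorem sInd_range {a : α → M} [Finite α] : SInd L (range a) C B ↔ Ind L a C B :=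
  ⟨fun h => h.tuple le_rfl, fun h => h.sInd le_rfl⟩

theorem sInd_of_fin (h : ∀ F : Set M, F.Finite → F ⊆ B → SInd L A C F) : SInd L A C B := by
  intro n e he
  rw [ind_iff_fin]
  exact fun m f hf => h _ (finite_range f) hf n e he

theorem SInd.iUnion_left {X : ℕ → Set M} (hX : Monotone X) (h : ∀ n, SInd L (X n) C B) :
    SInd L (⋃ n, X n) C B := by
  intro n e he
  obtain ⟨m, hm⟩ : ∃ m, range e ⊆ X m := by
    choose g hg using fun i => mem_iUnion.1 (he ⟨i, rfl⟩)
    refine ⟨Finset.univ.sup g, ?_⟩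
    rintro _ ⟨i, rfl⟩
    exact hX (Finset.le_sup (Finset.mem_univ i)) (hg i)
  exact h m n e hm

/-- An independent sequence is independent regardless of order. -/
theorem SInd.others (H : Ctx L M κ) (hC : #C ≤ κ) {X : ℕ → Set M} (hX : ∀ n, #(X n) ≤ κ)
    (h : ∀ n, SInd L (X n) C (⋃ i ∈ Iio n, X i)) (n : ℕ) : 
    SInd L (X n) C (⋃ i ∈ ({n}ᶜ : Set ℕ), X i) := by
  have hU : ∀ s : Set ℕ, #↥(⋃ i ∈ s, X i) ≤ κ := fun s =>
    small_mono (iUnion₂_subset fun i _ => subset_iUnion X i) (small_iUnion H.inf X hX)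
  have key : ∀ N, SInd L (X n) C (⋃ i ∈ {i | i < N ∧ i ≠ n}, X i) := by
    intro N
    induction N with
    | zero => exact (h n).mono le_rfl (subset_union_of_subset_right (by simp) _)
    | succ N ih =>
      rcases Nat.lt_or_ge n N with hN | hN
      · have h1 : SInd L (X N) (C ∪ ⋃ i ∈ {i | i < N ∧ i ≠ n}, X i) (X n) := by
          refine ((h N).base_mono subset_union_left (union_subset_union_right _ ?_)).mono le_rfl ?_
          · exact biUnion_subset_biUnion_left fun i hi => hi.1
          · exact subset_union_of_subset_right (subset_biUnion_of_mem (u := X) (mem_Iio.2 hN)) _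
        refine (ih.trans H hC (hU _) (h1.symm H (small_union H.inf hC (hU _)))).mono le_rfl ?_
        refine subset_union_of_subset_right (iUnion₂_subset fun i hi => ?_) _
        rcases (Nat.lt_succ_iff.1 hi.1).lt_or_eq with h2 | rfl
        · exact subset_union_of_subset_left
            (subset_biUnion_of_mem (u := X) (show i ∈ {i | i < N ∧ i ≠ n} from ⟨h2, hi.2⟩)) _
        · exact subset_union_right
      · refine (h n).mono le_rfl (subset_union_of_subset_right ?_ _)
        refine biUnion_subset_biUnion_left fun i hi => ?_
        exact lt_of_le_of_ne ((Nat.lt_succ_iff.1 hi.1).trans hN) hi.2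
  refine (SInd.mono (SInd.iUnion_left (X := fun N => ⋃ i ∈ {i | i < N ∧ i ≠ n}, X i) ?_
    fun N => (key N).symm H hC) ?_ subset_union_right).symm H hC
  · exact fun N N' hN => biUnion_subset_biUnion_left fun i hi => ⟨hi.1.trans_le hN, hi.2⟩
  · refine iUnion₂_subset fun i hi => subset_iUnion_of_subset (i + 1) ?_
    exact subset_biUnion_of_mem (u := X)
      (show i ∈ {j | j < i + 1 ∧ j ≠ n} from ⟨Nat.lt_succ_self i, hi⟩)

theorem divides_iff (H : Ctx L M κ) (hC : #C ≤ κ) {n m : ℕ} {φ : L.Formula (Fin n ⊕ Fin m)}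
    {b : Fin m → M} : Divides (L := L) C φ b ↔ Div L C {x | φ.Realize x} b := by
  have hφ : (∅ : Set M).Definable L {x : Fin n ⊕ Fin m → M | φ.Realize x} :=
    empty_definable_iff.2 ⟨φ, rfl⟩
  constructor
  · rintro ⟨f, rfl, hf, k, hk, h⟩
    have hf' : Indisc L C f := fun k i j hi hj => sameTypeOver_iff.1 (hf k i j hi hj)
    refine ⟨f, hf'.zero, k, hk, fun S hS ⟨a, ha⟩ => ?_⟩
    refine h (S.orderEmbOfFin hS) (S.orderEmbOfFin hS).strictMono ⟨a, fun j => ?_⟩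
    exact ha _ (S.orderEmbOfFin_mem hS j)
  · intro h
    obtain ⟨v, hv, hv0, k, hk, hki⟩ := h.indisc_zero H hC (hφ.mono (empty_subset _))
    refine ⟨v, hv0, fun k i j hi hj => sameTypeOver_iff.2 (hv k i j hi hj), k, hk, ?_⟩
    rintro i hi ⟨a, ha⟩
    refine hki (Finset.univ.image i) (by rw [Finset.card_image_of_injective _ hi.injective]; simp)
      ⟨a, fun j hj => ?_⟩
    obtain ⟨j, -, rfl⟩ := Finset.mem_image.1 hj
    exact ha j

theorem TupForksOver.mono {n : ℕ} {a : Fin n → M} (h : TupForksOver (L := L) a B C) (hB : B ⊆ D) :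
    TupForksOver (L := L) a D C := by
  obtain ⟨r, ms, φ, b, h1, h2⟩ := h
  exact ⟨r, ms, φ, b, h1, fun a' ha' => h2 a' (sameTypeOver_iff.2 ((sameTypeOver_iff.1 ha').mono hB))⟩

theorem tupForksOver_iff (H : Ctx L M κ) (hB : #B ≤ κ) (hCB : C ⊆ B) {n : ℕ} {a : Fin n → M} :
    TupForksOver (L := L) a B C ↔ ¬ Ind L a C B := by
  have hC := small_mono hCB hB
  constructor
  · rintro ⟨r, ms, φ, b, h1, h2⟩ hi
    obtain ⟨a', ha', hi'⟩ := hi.ext H hC hB (D := ⋃ i, range (b i))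
      (small_finite H.inf (finite_iUnion fun i => finite_range _))
    rw [union_eq_self_of_subset_left hCB] at ha'
    obtain ⟨i, hi⟩ := h2 a' (sameTypeOver_iff.2 ha')
    have h3 := (divides_iff H hC).1 (h1 i)
    have hφ : (∅ : Set M).Definable L {x : Fin n ⊕ Fin (ms i) → M | (φ i).Realize x} :=
      empty_definable_iff.2 ⟨φ i, rfl⟩
    refine hi'.not_div (hφ.mono (empty_subset _)) ?_ hi h3
    exact subset_union_of_subset_right (subset_union_of_subset_right
      (subset_iUnion (fun i => range (b i)) i) _) _
  · intro hi
    rw [Ind] at hi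
    push Not at hi
    obtain ⟨W, hW, haW, ι, hι, d, T, hT, h1, h2⟩ := hi
    rw [union_eq_self_of_subset_left hCB] at hW
    obtain ⟨r, T, rfl⟩ : ∃ (r : ℕ) (T' : Fin r → Set (Fin n ⊕ ι → M)), range T' = T := by
      obtain ⟨n, f, hf⟩ := hT.fin_param
      exact ⟨n, f, hf.2⟩
    obtain ⟨m, ⟨g⟩⟩ := Finite.exists_equiv_fin ι
    choose φ hφ using fun i => empty_definable_iff.1 (h1 (T i) ⟨i, rfl⟩).1
    have hr : ∀ (i) (x : Fin n → M), (Formula.relabel (Sum.map id g) (φ i)).Realize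
        (Sum.elim x (d ∘ g.symm)) ↔ Sum.elim x d ∈ T i := by
      intro i x
      rw [Formula.realize_relabel, hφ i, Set.mem_ofPred_eq, Sum.elim_comp_map, Function.comp_assoc,
        g.symm_comp_self]
      rfl
    refine ⟨r, fun _ => m, fun i => Formula.relabel (Sum.map id g) (φ i), fun _ => d ∘ g.symm,
      fun i => (divides_iff H hC).2 ?_, fun a' ha' => ?_⟩
    · refine Div.of_subset H hC ((h1 (T i) ⟨i, rfl⟩).1.mono (empty_subset _)) ?_ (h1 _ ⟨i, rfl⟩).2
        fun x hx => (hr i x).1 hx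
      exact (empty_definable_iff.2 ⟨_, rfl⟩ : (∅ : Set M).Definable L _).mono (empty_subset _)
    · obtain ⟨_, ⟨i, rfl⟩, hi⟩ := h2 (((sameTypeOver_iff.1 ha') W hW).1 haW)
      exact ⟨i, (hr i a').2 hi⟩

/-- Smallness as a class, so that bounds are found by instance search. -/
class Sm (κ : Cardinal.{u}) (A : Set M) : Prop where
  le : #A ≤ κ

instance [h : Fact (ℵ₀ ≤ κ)] [hA : Sm κ A] [hB : Sm κ B] : Sm κ (A ∪ B) :=
  ⟨small_union h.1 hA.1 hB.1⟩

instance [h : Fact (ℵ₀ ≤ κ)] [Countable ι] (f : ι → M) : Sm κ (range f) := ⟨small_range h.1 f⟩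

instance : Sm κ (∅ : Set M) := ⟨empty_small⟩

theorem Sm.of_finite [h : Fact (ℵ₀ ≤ κ)] (hA : A.Finite) : Sm κ A := ⟨small_finite h.1 hA⟩

theorem Sm.mono [hB : Sm κ B] (h : A ⊆ B) : Sm κ A := ⟨small_mono h hB.1⟩

/-- The union of an initial segment of a sequence of sets. -/
def pre (X : ℕ → Set M) (n : ℕ) : Set M := ⋃ i ∈ Iio n, X i

theorem pre_zero (X : ℕ → Set M) : pre X 0 = ∅ := by simp [pre]

theorem pre_succ (X : ℕ → Set M) (n : ℕ) : pre X (n + 1) = pre X n ∪ X n := by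
  ext x
  simp only [pre, mem_iUnion, mem_Iio, mem_union, Nat.lt_succ_iff_lt_or_eq]
  constructor
  · rintro ⟨i, h | rfl, hx⟩
    exacts [Or.inl ⟨i, h, hx⟩, Or.inr hx]
  · rintro (⟨i, h, hx⟩ | hx)
    exacts [⟨i, Or.inl h, hx⟩, ⟨n, Or.inr rfl, hx⟩]

theorem subset_pre {X : ℕ → Set M} {i n : ℕ} (h : i < n) : X i ⊆ pre X n :=
  subset_biUnion_of_mem (u := X) (mem_Iio.2 h)

theorem pre_subset {X : ℕ → Set M} {n : ℕ} (h : ∀ i < n, X i ⊆ A) : pre X n ⊆ A :=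
  iUnion₂_subset h

theorem pre_mono {X : ℕ → Set M} : Monotone (pre X) := fun _ _ h =>
  pre_subset fun _ hi => subset_pre (hi.trans_le h)

instance [h : Fact (ℵ₀ ≤ κ)] (X : ℕ → Set M) [hX : ∀ n, Sm κ (X n)] (n : ℕ) : Sm κ (pre X n) :=
  ⟨small_mono (iUnion₂_subset fun i _ => subset_iUnion X i) (small_iUnion h.1 X fun n => (hX n).1)⟩

instance [h : Fact (ℵ₀ ≤ κ)] (X : ℕ → Set M) [hX : ∀ n, Sm κ (X n)] : Sm κ (⋃ n, X n) :=
  ⟨small_iUnion h.1 X fun n => (hX n).1⟩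

theorem SInd.weak (h : SInd L A C B) {A' C' B' : Set M} (hA : A' ⊆ A := by grind)
    (hC : C ⊆ C' := by grind) (hB : C' ∪ B' ⊆ C ∪ B := by grind) : SInd L A' C' B' :=
  (h.base_mono hC (subset_union_left.trans hB)).mono hA
    ((subset_union_right.trans hB).trans (union_subset_union_left _ hC))

theorem SInd.sy (H : Ctx L M κ) (h : SInd L A C B) [hC : Sm κ C] : SInd L B C A := h.symm H hC.1

theorem SInd.tr (H : Ctx L M κ) (h1 : SInd L A C B) {A' C' C'' F : Set M} (h2 : SInd L A' C' D)
    [hC : Sm κ C] [hC' : Sm κ C'] {A'' : Set M} (hA : A'' ⊆ A := by grind)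
    (hA' : A'' ⊆ A' := by grind) (hCC : C ⊆ C' := by grind)
    (hCB : C' ⊆ C ∪ B := by grind) (hCC' : C ⊆ C'' := by grind)
    (hF : C'' ∪ F ⊆ C' ∪ D := by grind) : SInd L A'' C'' F := by
  have h3 : SInd L A'' C C' := h1.weak hA le_rfl (union_subset subset_union_left hCB)
  have h4 : SInd L A'' (C ∪ C') D := by
    rw [union_eq_self_of_subset_left hCC]
    exact h2.weak hA'
  exact (h3.trans H hC.1 hC'.1 h4).weak le_rfl hCC' (hF.trans (by grind))

/-- Left transitivity, in the form used for sets of tuples. -/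
theorem SInd.ltr (H : Ctx L M κ) (h1 : SInd L A C D) (h2 : SInd L B (C ∪ A) D)
    [hC : Sm κ C] [hA : Sm κ A] {A' : Set M} (h : A' ⊆ A ∪ B := by grind) : SInd L A' C D :=
  (h1.left_trans H hC.1 hA.1 h2).weak h

theorem sInd_self (H : Ctx L M κ) : SInd L A C C := fun _ _ _ => ind_self H _ _

theorem sInd_of_subset (h : A ⊆ C) : SInd L A C B := fun _ _ he => ind_of_subset (he.trans h)

theorem lc_seq (H : Ctx L M κ) [Finite β] (b : β → M) (D : Set M) (X : ℕ → Set M) :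
    ∃ N, SInd L (range b) (D ∪ pre X N) (⋃ n, X n) := by
  obtain ⟨E, hE, hfin, h⟩ := local_char H b (D ∪ ⋃ n, X n)
  have hmono : Monotone fun n => D ∪ pre X n := fun n m hnm => union_subset_union_right _ (pre_mono hnm)
  have hU : (E : Set M) ⊆ ⋃ n, (D ∪ pre X n) := by
    refine hE.trans (union_subset ?_ (iUnion_subset fun n => ?_))
    · exact subset_iUnion_of_subset 0 subset_union_left
    · exact subset_iUnion_of_subset (n + 1) (subset_union_of_subset_right (subset_pre n.lt_succ_self) _)
  obtain ⟨N, hN⟩ : ∃ N, E ⊆ D ∪ pre X N := by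
    have := hmono.directed_le.exists_mem_subset_of_finset_subset_biUnion (s := hfin.toFinset)
      (by simpa using hU)
    simpa using this
  refine ⟨N, (sInd_range.2 h).weak le_rfl hN ?_⟩
  have : pre X N ⊆ ⋃ n, X n := pre_subset fun i _ => subset_iUnion X i
  grind

theorem SInd.tp [Finite α] {a a' : α → M} (h : SInd L (range a) C B) (ha : EqTp L D a a')
    (hD : C ∪ B ⊆ D := by grind) : SInd L (range a') C B :=
  sInd_range.2 ((sInd_range.1 h).eqTp (ha.mono hD))

end Forking

section Forking

open Set

variable {L : FirstOrder.Language.{u, u}} {M : Type u} [L.Structure M]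
  {κ : Cardinal.{u}} {A B C D E : Set M} {α β γ δ ι : Type}
  [hκ : Fact (ℵ₀ ≤ κ)]

theorem SInd.ex (H : Ctx L M κ) [Finite α] {a : α → M} (h : SInd L (range a) C B) [hC : Sm κ C]
    [hB : Sm κ B] (D : Set M) [hD : Sm κ D] :
    ∃ a', EqTp L (C ∪ B) a a' ∧ SInd L (range a') C (B ∪ D) := by
  obtain ⟨a', h1, h2⟩ := (sInd_range.1 h).ext H hC.1 hB.1 hD.1
  exact ⟨a', h1, sInd_range.2 h2⟩

theorem exists_free (H : Ctx L M κ) [Finite α] (a : α → M) (C : Set M) [hC : Sm κ C]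
    (D : Set M) [hD : Sm κ D] : ∃ a', EqTp L C a a' ∧ SInd L (range a') C D := by
  obtain ⟨a', h1, h2⟩ := ((sInd_self (A := range a) (C := C) H).mono le_rfl (empty_subset _)).ex H D
  exact ⟨a', h1.mono subset_union_left, h2.weak⟩

theorem SInd.cg (H : Ctx L M κ) [Finite α] [Countable β] [Countable γ] {a a' : α → M}
    {b b' : β → M} {e e' : γ → M} (h : SInd L (range a) (C ∪ range b) (range e)) [hC : Sm κ C]
    (heq : EqTp L C (Sum.elim a (Sum.elim b e)) (Sum.elim a' (Sum.elim b' e'))) :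
    SInd L (range a') (C ∪ range b') (range e') := by
  have := Ind.congr H hC.1 empty_small (B := ∅) (a := a) (a' := a') (b := b) (b' := b') (e := e)
    (e' := e') (by simpa using heq) (by simpa using sInd_range.1 h)
  exact sInd_range.2 (by simpa using this)

theorem SInd.mv (H : Ctx L M κ) [Finite α] [Countable β] {a a' : α → M}
    {e e' : β → M} (h : SInd L (range a) C (range e)) [hC : Sm κ C]
    (heq : EqTp L C (Sum.elim a e) (Sum.elim a' e')) : SInd L (range a') C (range e') :=
  sInd_range.2 ((sInd_range.1 h).move H hC.1 heq)

theorem exists_free_seq (H : Ctx L M κ) [Finite α] (a : α → M) (C : Set M) [hC : Sm κ C] :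
    ∃ f : ℕ → α → M, ∀ n, EqTp L C a (f n) ∧
      SInd L (range (f n)) C (pre (fun i => range (f i)) n) := by
  obtain ⟨f, hf⟩ := exists_seq H hC.1 empty_small
    ((ind_self H a C).mono (B' := ∅) (empty_subset _))
  refine ⟨f, fun n => ⟨((hf n).1.mono subset_union_left).symm, sInd_range.2 ?_⟩⟩
  have := (hf n).2
  rwa [empty_union] at this

/-- Regularity of the type of `a` over `B`. -/
def RegS (L : FirstOrder.Language.{u, u}) [L.Structure M] (κ : Cardinal.{u}) (B : Set M)
    (a : α → M) : Prop :=
  ∀ D : Set M, Sm κ D → B ⊆ D → ∀ a' e : α → M, EqTp L B a a' → EqTp L B a e →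
    SInd L (range a') B D → ¬ SInd L (range e) B D → SInd L (range a') D (range e)

/-- Stationarity of the type of `a` over `B`. -/
def StatS (L : FirstOrder.Language.{u, u}) [L.Structure M] (κ : Cardinal.{u}) (B : Set M)
    (a : α → M) : Prop :=
  ∀ D : Set M, Sm κ D → B ⊆ D → ∀ a' e : α → M, EqTp L B a a' → EqTp L B a e →
    SInd L (range a') B D → SInd L (range e) B D → EqTp L D a' e

/-- Nonorthogonality of two types. -/
def NOrth (L : FirstOrder.Language.{u, u}) [L.Structure M] (κ : Cardinal.{u}) (B : Set M)
    (a : α → M) (C : Set M) (b : β → M) : Prop :=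
  ∃ D : Set M, Sm κ D ∧ B ⊆ D ∧ C ⊆ D ∧ ∃ a' b', EqTp L B a a' ∧ EqTp L C b b' ∧
    SInd L (range a') B D ∧ SInd L (range b') C D ∧ ¬ SInd L (range a') D (range b')

theorem NOrth.symm (H : Ctx L M κ) {a : α → M} {b : β → M} (h : NOrth L κ B a C b) :
    NOrth L κ C b B a := by
  obtain ⟨D, hD, h1, h2, a', b', h3, h4, h5, h6, h7⟩ := h
  exact ⟨D, hD, h2, h1, b', a', h4, h3, h6, h5, fun h => h7 (h.sy H)⟩

set_option maxHeartbeats 1000000 in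
/-- Regular types have weight one. -/
theorem RegS.weight_one (H : Ctx L M κ) [Finite α] [Finite β] [Finite γ] {s a : α → M}
    (hr : RegS L κ B s) (hs : EqTp L B s a) [hB : Sm κ B] [hD : Sm κ D] (hBD : B ⊆ D)
    (ha : SInd L (range a) B D) {b : β → M} {c : γ → M} (hbc : SInd L (range b) D (range c)) :
    SInd L (range a) D (range b) ∨ SInd L (range a) D (range c) := by
  by_contra! hcon
  obtain ⟨hab, hac⟩ := hcon
  obtain ⟨f, hf⟩ := exists_free_seq H (Sum.elim a c) (D ∪ range b)
  set p : ℕ → α → M := fun n => f n ∘ Sum.inl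
  set q : ℕ → γ → M := fun n => f n ∘ Sum.inr
  have hpq : ∀ n, f n = Sum.elim (p n) (q n) := fun n => (Sum.elim_comp_inl_inr _).symm
  have hfr : ∀ n, range (f n) = range (p n) ∪ range (q n) := fun n => by rw [hpq, Sum.elim_range]
  set X : ℕ → Set M := fun i => range (f i)
  set Q : ℕ → Set M := fun i => range (q i)
  set P : ℕ → Set M := fun i => range (p i)
  have htp : ∀ n, EqTp L (D ∪ range b) (Sum.elim a c) (Sum.elim (p n) (q n)) := fun n => by
    rw [← hpq]; exact (hf n).1
  have hX : ∀ n, X n = P n ∪ Q n := hfr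
  have hQX : ∀ n, pre Q n ⊆ pre X n := fun n => pre_subset fun i hi =>
    (subset_union_right.trans (hX i).ge).trans (subset_pre hi)
  have hfree : ∀ n, SInd L (P n ∪ Q n) (D ∪ range b) (pre X n) := fun n => by
    rw [← hX]; exact (hf n).2
  have hq : ∀ n, SInd L (Q n) D (range b) := fun n => (hbc.sy H).tp (htp n).inr
  have hp : ∀ n, SInd L (P n) B D := fun n => ha.tp ((htp n).inl.mono subset_union_left)
  have hpq' : ∀ n, ¬ SInd L (P n) D (Q n) := fun n h =>
    hac (h.mv H ((htp n).symm.mono subset_union_left))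
  have hsp : ∀ n, EqTp L B s (p n) := fun n =>
    hs.trans ((htp n).inl.mono (hBD.trans subset_union_left))
  have hQb : ∀ n, SInd L (pre Q n) D (range b) := by
    intro n
    induction n with
    | zero => exact sInd_of_subset (by simp [pre_zero])
    | succ n ih =>
      rw [pre_succ]
      have h1 : SInd L (Q n) D (range b ∪ pre X n) := (hq n).tr H (hfree n)
      have h2 := hQX n
      exact ih.ltr H h1.weak le_rfl
  have hPQ : ∀ n, SInd L (P n) B (D ∪ pre Q n) := by
    intro n
    have h2 := hQX n
    have h3 : SInd L (P n) (D ∪ range b) (pre Q n) := (hfree n).weak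
    have h4 : SInd L (pre Q n) D (P n) := (hQb n).tr H (h3.sy H)
    exact (hp n).tr H (h4.sy H)
  have hfork : ∀ i n, i < n → ¬ SInd L (P i) B (D ∪ pre Q n) := fun i n hi h => by
    have h1 : Q i ⊆ pre Q n := subset_pre hi
    exact hpq' i h.weak
  have hPP : ∀ n m, m ≤ n → SInd L (P n) B (D ∪ pre Q n ∪ pre P m) := by
    intro n m
    induction m with
    | zero => intro _; rw [pre_zero, union_empty]; exact hPQ n
    | succ m ih =>
      intro hm
      have h1 := ih (by omega)
      have h2 : SInd L (P n) (D ∪ pre Q n ∪ pre P m) (P m) := by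
        refine hr _ inferInstance (by grind) _ _ (hsp n) (hsp m) h1 fun h => ?_
        exact hfork m n (by omega) h.weak
      rw [pre_succ]
      exact h1.tr H h2
  have hPX : ∀ n, SInd L (P n) D (pre X n) := by
    intro n
    have h1 : pre X n ⊆ pre Q n ∪ pre P n := pre_subset fun i hi => by
      have h1 : Q i ⊆ pre Q n := subset_pre hi
      have h2 : P i ⊆ pre P n := subset_pre hi
      rw [hX]; grind
    exact (hPP n n le_rfl).weak
  obtain ⟨N, hN⟩ := lc_seq H b D X
  have h1 : P N ⊆ ⋃ n, X n := (subset_union_left.trans (hX N).ge).trans (subset_iUnion X N)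
  have h2 : SInd L (range b) (D ∪ pre X N) (P N) := hN.weak
  have h3 : SInd L (P N) D (range b) := (hPX N).tr H (h2.sy H)
  exact hab (h3.mv H ((htp N).inl.add subset_union_right |>.symm.mono subset_union_left))

theorem NOrth.enlarge (H : Ctx L M κ) [Finite α] [Finite β] {a : α → M} {b : β → M}
    (h : NOrth L κ B a C b) [hB : Sm κ B] [hC : Sm κ C] (E : Set M) [hE : Sm κ E] :
    ∃ D : Set M, Sm κ D ∧ B ⊆ D ∧ C ⊆ D ∧ E ⊆ D ∧ ∃ a' b', EqTp L B a a' ∧ EqTp L C b b' ∧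
      SInd L (range a') B D ∧ SInd L (range b') C D ∧ ¬ SInd L (range a') D (range b') := by
  obtain ⟨D, hD, h1, h2, a1, b1, h3, h4, h5, h6, h7⟩ := h
  obtain ⟨w, hw1, hw2⟩ := exists_free H (Sum.elim a1 b1) D E
  obtain ⟨a2, b2, rfl⟩ : ∃ a2 b2, w = Sum.elim a2 b2 := ⟨_, _, (Sum.elim_comp_inl_inr w).symm⟩
  rw [Sum.elim_range] at hw2
  have h8 : SInd L (range a2) B D := h5.tp hw1.inl
  have h9 : SInd L (range b2) C D := h6.tp hw1.inr
  have ha : SInd L (range a2) D E := hw2.weak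
  have hb : SInd L (range b2) D E := hw2.weak
  refine ⟨D ∪ E, inferInstance, by grind, by grind, by grind, a2, b2,
    h3.trans (hw1.inl.mono h1), h4.trans (hw1.inr.mono h2), h8.tr H ha, h9.tr H hb, fun h => h7 ?_⟩
  have h10 : SInd L (range a2) D (range b2) := ha.tr H h
  exact h10.mv H hw1.symm

theorem NOrth.finite_base (H : Ctx L M κ) [Finite α] [Finite β] {a : α → M} {b : β → M}
    (h : NOrth L κ B a C b) [hB : Sm κ B] [hC : Sm κ C] :
    ∃ (n : ℕ) (f : Fin n → M) (a' : α → M) (b' : β → M), EqTp L B a a' ∧ EqTp L C b b' ∧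
      SInd L (range a') B (B ∪ C ∪ range f) ∧ SInd L (range b') C (B ∪ C ∪ range f) ∧
      ¬ SInd L (range a') (B ∪ C ∪ range f) (range b') := by
  obtain ⟨D, hD, h1, h2, a1, b1, h3, h4, h5, h6, h7⟩ := h
  obtain ⟨E, hED, hE, hi⟩ := local_char H (Sum.elim a1 b1) D
  obtain ⟨n, f, -, rfl⟩ := hE.fin_param
  have hi' := sInd_range.2 hi
  rw [Sum.elim_range] at hi'
  refine ⟨n, f, a1, b1, h3, h4, h5.weak, h6.weak, fun h => h7 ?_⟩
  have h8 : SInd L (range a1 ∪ range b1) (B ∪ C ∪ range f) D := hi'.weak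
  have h9 : SInd L D (B ∪ C ∪ range f ∪ range b1) (range a1) := (h8.sy H).weak
  exact h.tr H (h9.sy H)

set_option maxHeartbeats 1000000 in
/-- Nonorthogonality is transitive through a regular stationary type. -/
theorem NOrth.trans (H : Ctx L M κ) [Finite α] [Finite β] [Finite γ] {s : α → M} {q : β → M}
    {p : γ → M} {B₁ B₂ : Set M} [hB : Sm κ B] [hB₁ : Sm κ B₁] [hB₂ : Sm κ B₂]
    (hr : RegS L κ B s) (hst : StatS L κ B s) (h1 : NOrth L κ B s B₁ q)
    (h2 : NOrth L κ B s B₂ p) : NOrth L κ B₁ q B₂ p := by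
  obtain ⟨D₁, hD₁, hBD, hB1D, hB2D, a, e, ha, he, haD, heD, hae⟩ := h1.enlarge H B₂
  obtain ⟨n, f₂, a₂, p₂, ha₂, hp₂, haf, hpf, hap⟩ := h2.finite_base H
  have hG : EqTp L (B ∪ B₂) a₂ a := hst _ inferInstance subset_union_left _ _ ha₂ ha haf.weak
    haD.weak
  obtain ⟨w, hw⟩ := copy H (C := B ∪ B₂) Sm.le hG (Sum.elim f₂ p₂)
  obtain ⟨w', hw1, hw2⟩ := exists_free H w (B ∪ B₂ ∪ range a) (D₁ ∪ range e)
  obtain ⟨f, b, rfl⟩ : ∃ f b, w' = Sum.elim f b := ⟨_, _, (Sum.elim_comp_inl_inr w').symm⟩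
  have htp : EqTp L (B ∪ B₂) (Sum.elim (Sum.elim f₂ p₂) a₂) (Sum.elim (Sum.elim f b) a) :=
    hw.trans (eqTp_sum_iff.2 hw1)
  rw [Sum.elim_range] at hw2
  have haf' : SInd L (range a) (B ∪ B₂) (range f) := by
    have : SInd L (range a₂) (B ∪ B₂) (range f₂) := haf.weak
    refine this.mv H (htp.of_comp (Sum.elim Sum.inr (Sum.inl ∘ Sum.inl)) ?_ ?_) <;>
      ext (i | i) <;> rfl
  have hfb : SInd L (range b) B₂ (B ∪ B₂ ∪ range f) := by
    have : SInd L (range p₂) (B₂) (B ∪ B₂) := hpf.weak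
    have h3 : SInd L (range b) B₂ (B ∪ B₂) := this.tp htp.inl.inr
    have h4 : SInd L (range p₂) (B ∪ B₂) (range f₂) := hpf.weak
    have h5 : SInd L (range b) (B ∪ B₂) (range f) := h4.mv H htp.inl.swap
    exact h3.tr H h5
  have hab : ¬ SInd L (range a) (B ∪ B₂ ∪ range f) (range b) := by
    intro h
    refine hap (h.cg H ?_)
    refine htp.symm.of_comp (Sum.elim Sum.inr (Sum.elim (Sum.inl ∘ Sum.inl) (Sum.inl ∘ Sum.inr)))
      ?_ ?_ <;> ext (i | i | i) <;> rfl
  have haD2 : SInd L (range a) (B ∪ B₂) D₁ := haD.weak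
  have hK1 : SInd L (range a ∪ (range f ∪ range b)) (B ∪ B₂) D₁ :=
    haD2.ltr H hw2.weak le_rfl
  have hf1 : SInd L (range f) (B ∪ B₂) (range a ∪ D₁ ∪ range e) := (haf'.sy H).tr H hw2
  have hf2 : SInd L (range f) D₁ (range a ∪ range e) := hf1.weak
  have hf3 : SInd L (range a ∪ range e) D₁ (range f) := hf2.sy H
  have haf2 : SInd L (range a) D₁ (range f) := hf3.weak
  have hef2 : SInd L (range e) D₁ (range f) := hf3.weak
  have haf3 : SInd L (range a) B (D₁ ∪ range f) := haD.tr H haf2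
  have hef3 : SInd L (range e) B₁ (D₁ ∪ range f) := heD.tr H hef2
  have hK2 : SInd L (range a ∪ range b) (B ∪ B₂ ∪ range f) D₁ := by
    have h3 : SInd L D₁ (B ∪ B₂) (range a ∪ (range f ∪ range b)) := hK1.sy H
    have h4 : SInd L D₁ (B ∪ B₂ ∪ range f) (range a ∪ range b) := h3.weak
    exact h4.sy H
  have hbD : SInd L (range b) B₂ (D₁ ∪ range f) := hfb.tr H hK2
  refine ⟨D₁ ∪ range f, inferInstance, by grind, by grind, e, b, he,
    hp₂.trans (htp.inl.inr.mono subset_union_right), hef3, hbD, fun h => ?_⟩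
  rcases hr.weight_one H ha (D := D₁ ∪ range f) (by grind) haf3 h with h' | h'
  · exact hae (haf2.tr H h')
  · have h3 : SInd L (range a) (B ∪ B₂ ∪ range f) D₁ := hK2.weak
    exact hab (h3.tr H h')

theorem SameTypeOver.refl (x : α → M) : SameTypeOver (L := L) A x x := fun _ => Iff.rfl

theorem StatS.of_finite {s : α → M} [Finite α]
    (h : ∀ (n : ℕ) (f : Fin n → M) (a e : α → M), EqTp L B s a → EqTp L B s e →
      SInd L (range a) B (range f) → SInd L (range e) B (range f) → EqTp L (B ∪ range f) a e) :
    StatS L κ B s := by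
  intro D hD hBD a e ha he haD heD
  rw [eqTp_iff_fin]
  intro n f hf
  have := (h n f a e ha he haD.weak heD.weak).add (b := f) subset_union_right
  exact this.mono (empty_subset _)

theorem RegS.of_finite (H : Ctx L M κ) {s : α → M} [Finite α] [hB : Sm κ B]
    (h : ∀ (n : ℕ) (f : Fin n → M) (a e : α → M), EqTp L B s a → EqTp L B s e →
      SInd L (range a) B (range f) → ¬ SInd L (range e) B (range f) →
      SInd L (range a) (B ∪ range f) (range e)) : RegS L κ B s := by
  intro D hD hBD a e ha he haD heD
  obtain ⟨E, hED, hE, hi⟩ := local_char H (Sum.elim a e) D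
  obtain ⟨n, f, -, rfl⟩ := hE.fin_param
  have hi' := sInd_range.2 hi
  rw [Sum.elim_range] at hi'
  have h1 : SInd L (range a) (B ∪ range f) (range e) := by
    refine h n f a e ha he haD.weak fun h => heD ?_
    have h2 : SInd L (range e) (B ∪ range f) D := hi'.weak
    exact h.tr H h2
  have h8 : SInd L (range a ∪ range e) (B ∪ range f) D := hi'.weak
  have h9 : SInd L D (B ∪ range f ∪ range e) (range a) := (h8.sy H).weak
  exact h1.tr H (h9.sy H)

theorem TypeRegular.regS (H : Ctx L M κ) {n : ℕ} {a : Fin n → M} (h : TypeRegular (L := L) B a) :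
    RegS L κ B a := by
  intro D hD hBD a' e ha he haD heD
  have hB : Sm κ B := Sm.mono hBD
  have h1 := h D e hBD (sameTypeOver_iff.2 he)
    ((tupForksOver_iff H hD.1 hBD).2 fun h => heD (sInd_range.2 h))
  have h2 := h1 D a' e hBD le_rfl (sameTypeOver_iff.2 ha) (fun h => ?_) (SameTypeOver.refl _)
    (fun h => (tupForksOver_iff H hD.1 le_rfl).1 h (ind_self H _ _))
  · rw [tupForksOver_iff H (κ := κ) Sm.le subset_union_left, not_not] at h2
    exact (sInd_range.2 h2).weak
  · exact (tupForksOver_iff H hD.1 hBD).1 h (sInd_range.1 haD)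

theorem TypeStationary.statS (H : Ctx L M κ) {n : ℕ} {a : Fin n → M}
    (h : TypeStationary (L := L) B a) : StatS L κ B a := by
  intro D hD hBD a' e ha he haD heD
  exact sameTypeOver_iff.1 (h D hBD a' e (sameTypeOver_iff.2 ha) (sameTypeOver_iff.2 he)
    (fun h => (tupForksOver_iff H hD.1 hBD).1 h (sInd_range.1 haD))
    (fun h => (tupForksOver_iff H hD.1 hBD).1 h (sInd_range.1 heD)))

theorem nOrth_of_not_typesOrthogonal (H : Ctx L M κ) {n m : ℕ} {a : Fin n → M} {b : Fin m → M}
    [hB : Sm κ B] [hC : Sm κ C] (hs : StatS L κ B a)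
    (h : ¬ TypesOrthogonal (L := L) B a C b) : NOrth L κ B a C b := by
  by_contra hno
  refine h fun D a' b' hBD hCD ha haD hb hbD hf => haD ?_
  have key : ∀ {m : ℕ} {x y : Fin m → M} {B : Set M}, B ⊆ D → Sm κ B →
      SameTypeOver (L := L) D x y → ¬ TupForksOver (L := L) x D B →
      ∀ G : Set M, Sm κ G → B ⊆ G → G ⊆ D → SInd L (range y) B G := by
    intro m x y B hBD hB hxy hx G hG hBG hGD
    have h1 : SInd L (range x) B G := sInd_range.2 <| by
      by_contra hc
      exact hx (((tupForksOver_iff H hG.1 hBG).2 hc).mono hGD)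
    exact h1.tp (sameTypeOver_iff.1 hxy)
  obtain ⟨r, ms, φ, d, h1, h2⟩ := hf
  refine ⟨r, ms, φ, d, fun i => ?_, fun a'' ha'' => h2 a'' ?_⟩
  · obtain ⟨f, hf0, hf1, hf2⟩ := h1 i
    exact ⟨f, hf0, fun k i j hi hj => sameTypeOver_iff.2
      ((sameTypeOver_iff.1 (hf1 k i j hi hj)).mono hBD), hf2⟩
  · rw [sameTypeOver_iff, eqTp_iff_fin]
    intro l g hg
    obtain ⟨l', g', hg', hgD⟩ : ∃ (l' : ℕ) (g' : Fin l' → M), range g' ⊆ D ∧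
        range g ⊆ range g' ∪ range b' := by
      obtain ⟨l', g', -, h3⟩ := ((finite_range g).inter_of_left D).fin_param
      refine ⟨l', g', h3.trans_subset inter_subset_right, fun x hx => ?_⟩
      rcases hg hx with h | h
      · exact Or.inl (h3 ▸ ⟨hx, h⟩)
      · exact Or.inr h
    have hx := fun (x : Fin n → M) (hx : SameTypeOver (L := L) D a' x) =>
      key hBD hB hx haD (B ∪ C ∪ range g') inferInstance (by grind) (by grind)
    have hb'' := key hCD hC (SameTypeOver.refl b') hbD (B ∪ C ∪ range g') inferInstance
      (by grind) (by grind)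
    have ha1 : ∀ x, SameTypeOver (L := L) D a' x → EqTp L B a x := fun x hx =>
      (sameTypeOver_iff.1 ha).trans ((sameTypeOver_iff.1 hx).mono hBD)
    have hxb : ∀ x, SameTypeOver (L := L) D a' x →
        SInd L (range x) B (B ∪ C ∪ range g' ∪ range b') := by
      intro x hx'
      by_contra hc
      exact hno ⟨B ∪ C ∪ range g', inferInstance, by grind, by grind, x, b', ha1 x hx',
        sameTypeOver_iff.1 hb, hx x hx', hb'', fun h => hc ((hx x hx').tr H h)⟩
    have h3 := hs _ inferInstance (by grind) _ _ (ha1 _ (SameTypeOver.refl a')) (ha1 _ ha'')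
      (hxb _ (SameTypeOver.refl a')) (hxb _ ha'')
    exact (h3.add (b := g) (by grind)).mono (empty_subset _)

theorem RegS.descend (H : Ctx L M κ) [Finite α] {s : α → M} [hB : Sm κ B] [hD : Sm κ D]
    (hr : RegS L κ D s) (hst : StatS L κ B s) (hBD : B ⊆ D) (hs : SInd L (range s) B D) :
    RegS L κ B s := by
  refine RegS.of_finite H fun n f a e ha he haf hef => ?_
  obtain ⟨w, hw1, hw2⟩ := exists_free H (Sum.elim f (Sum.elim a e)) B D
  obtain ⟨f', a', e', rfl⟩ : ∃ f' a' e', w = Sum.elim f' (Sum.elim a' e') :=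
    ⟨w ∘ Sum.inl, w ∘ Sum.inr ∘ Sum.inl, w ∘ Sum.inr ∘ Sum.inr, by ext (i | i | i) <;> rfl⟩
  rw [Sum.elim_range, Sum.elim_range] at hw2
  have hf1 : SInd L (range a') B (range f') := haf.mv H (hw1.of_comp
    (Sum.elim (Sum.inr ∘ Sum.inl) Sum.inl) (by ext (i | i) <;> rfl) (by ext (i | i) <;> rfl))
  have hf2 : ¬ SInd L (range e') B (range f') := fun h => hef (h.mv H (hw1.symm.of_comp
    (Sum.elim (Sum.inr ∘ Sum.inr) Sum.inl) (by ext (i | i) <;> rfl) (by ext (i | i) <;> rfl)))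
  have ha2 : SInd L (range a') B D := hw2.weak
  have he2 : SInd L (range e') B D := hw2.weak
  have ha3 : EqTp L B s a' := ha.trans hw1.inr.inl
  have he3 : EqTp L B s e' := he.trans hw1.inr.inr
  have h3 : SInd L D B (range f' ∪ (range a' ∪ range e')) := hw2.sy H
  have h4 : SInd L D (B ∪ range f') (range a' ∪ range e') := h3.weak
  have h5 : SInd L (range a' ∪ range e') (B ∪ range f') D := h4.sy H
  have h6 : SInd L (range a') (B ∪ range f') D := h5.weak
  have h7 : SInd L (range a') B (D ∪ range f') := hf1.tr H h6
  have h8 : SInd L (range a') (D ∪ range f') (range e') := by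
    refine hr _ inferInstance subset_union_left _ _ (hst D hD hBD _ _ (EqTp.refl _) ha3 hs ha2)
      (hst D hD hBD _ _ (EqTp.refl _) he3 hs he2) h7.weak fun h => hf2 ?_
    exact he2.tr H h
  have h9 : SInd L (range a') (B ∪ range f') (range e') := h6.tr H h8
  refine h9.cg H (hw1.symm.of_comp (Sum.elim (Sum.inr ∘ Sum.inl) (Sum.elim Sum.inl
    (Sum.inr ∘ Sum.inr))) ?_ ?_) <;> ext (i | i | i) <;> rfl

theorem StatS.conj (H : Ctx L M κ) [Finite α] [Finite β] {s s' : α → M} {c c' : β → M}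
    (hst : StatS L κ (range c) s) (h : EqTp L ∅ (Sum.elim s c) (Sum.elim s' c')) :
    StatS L κ (range c') s' := by
  refine StatS.of_finite fun n f a e ha he haf hef => ?_
  obtain ⟨w, hw⟩ := copy H (C := ∅) empty_small h.inr.symm (Sum.elim f (Sum.elim a e))
  obtain ⟨f', a', e', rfl⟩ : ∃ f' a' e', w = Sum.elim f' (Sum.elim a' e') :=
    ⟨w ∘ Sum.inl, w ∘ Sum.inr ∘ Sum.inl, w ∘ Sum.inr ∘ Sum.inr, by ext (i | i | i) <;> rfl⟩
  have ha0 : EqTp L ∅ (Sum.elim s' c') (Sum.elim a c') := eqTp_sum_iff.2 (by rwa [empty_union])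
  have he0 : EqTp L ∅ (Sum.elim s' c') (Sum.elim e c') := eqTp_sum_iff.2 (by rwa [empty_union])
  have ha1 : EqTp L ∅ (Sum.elim a c') (Sum.elim a' c) := hw.of_comp
    (Sum.elim (Sum.inl ∘ Sum.inr ∘ Sum.inl) Sum.inr) (by ext (i | i) <;> rfl)
    (by ext (i | i) <;> rfl)
  have he1 : EqTp L ∅ (Sum.elim e c') (Sum.elim e' c) := hw.of_comp
    (Sum.elim (Sum.inl ∘ Sum.inr ∘ Sum.inr) Sum.inr) (by ext (i | i) <;> rfl)
    (by ext (i | i) <;> rfl)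
  have ha2 : EqTp L (range c) s a' := by
    simpa using eqTp_sum_iff.1 (h.trans (ha0.trans ha1))
  have he2 : EqTp L (range c) s e' := by
    simpa using eqTp_sum_iff.1 (h.trans (he0.trans he1))
  have haf' : EqTp L ∅ (Sum.elim a (Sum.elim c' f)) (Sum.elim a' (Sum.elim c f')) := hw.of_comp
    (Sum.elim (Sum.inl ∘ Sum.inr ∘ Sum.inl) (Sum.elim Sum.inr (Sum.inl ∘ Sum.inl)))
    (by ext (i | i | i) <;> rfl) (by ext (i | i | i) <;> rfl)
  have hef' : EqTp L ∅ (Sum.elim e (Sum.elim c' f)) (Sum.elim e' (Sum.elim c f')) := hw.of_comp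
    (Sum.elim (Sum.inl ∘ Sum.inr ∘ Sum.inr) (Sum.elim Sum.inr (Sum.inl ∘ Sum.inl)))
    (by ext (i | i | i) <;> rfl) (by ext (i | i | i) <;> rfl)
  have ha3 : SInd L (range a') (range c) (range f') := by
    have : SInd L (range a) (∅ ∪ range c') (range f) := by rwa [empty_union]
    simpa using this.cg H haf'
  have he3 : SInd L (range e') (range c) (range f') := by
    have : SInd L (range e) (∅ ∪ range c') (range f) := by rwa [empty_union]
    simpa using this.cg H hef'
  have h1 : EqTp L (range c ∪ range f') a' e' := by
    have h1 : SInd L (range a') (range c) (range c ∪ range f') := ha3.weak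
    have h2 : SInd L (range e') (range c) (range c ∪ range f') := he3.weak
    exact hst _ inferInstance subset_union_left _ _ ha2 he2 h1 h2
  have h2 : EqTp L ∅ (Sum.elim a' (Sum.elim c f')) (Sum.elim e' (Sum.elim c f')) :=
    eqTp_sum_iff.2 (by rwa [Sum.elim_range, empty_union])
  have h3 := eqTp_sum_iff.1 (haf'.trans (h2.trans hef'.symm))
  rwa [Sum.elim_range, empty_union] at h3

theorem RegS.conj (H : Ctx L M κ) [Finite α] [Finite β] {s s' : α → M} {c c' : β → M}
    (hr : RegS L κ (range c) s) (h : EqTp L ∅ (Sum.elim s c) (Sum.elim s' c')) :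
    RegS L κ (range c') s' := by
  refine RegS.of_finite H fun n f a e ha he haf hef => ?_
  obtain ⟨w, hw⟩ := copy H (C := ∅) empty_small h.inr.symm (Sum.elim f (Sum.elim a e))
  obtain ⟨f', a', e', rfl⟩ : ∃ f' a' e', w = Sum.elim f' (Sum.elim a' e') :=
    ⟨w ∘ Sum.inl, w ∘ Sum.inr ∘ Sum.inl, w ∘ Sum.inr ∘ Sum.inr, by ext (i | i | i) <;> rfl⟩
  have ha0 : EqTp L ∅ (Sum.elim s' c') (Sum.elim a c') := eqTp_sum_iff.2 (by rwa [empty_union])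
  have he0 : EqTp L ∅ (Sum.elim s' c') (Sum.elim e c') := eqTp_sum_iff.2 (by rwa [empty_union])
  have ha1 : EqTp L ∅ (Sum.elim a c') (Sum.elim a' c) := hw.of_comp
    (Sum.elim (Sum.inl ∘ Sum.inr ∘ Sum.inl) Sum.inr) (by ext (i | i) <;> rfl)
    (by ext (i | i) <;> rfl)
  have he1 : EqTp L ∅ (Sum.elim e c') (Sum.elim e' c) := hw.of_comp
    (Sum.elim (Sum.inl ∘ Sum.inr ∘ Sum.inr) Sum.inr) (by ext (i | i) <;> rfl)
    (by ext (i | i) <;> rfl)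
  have ha2 : EqTp L (range c) s a' := by
    simpa using eqTp_sum_iff.1 (h.trans (ha0.trans ha1))
  have he2 : EqTp L (range c) s e' := by
    simpa using eqTp_sum_iff.1 (h.trans (he0.trans he1))
  have haf' : EqTp L ∅ (Sum.elim a (Sum.elim c' f)) (Sum.elim a' (Sum.elim c f')) := hw.of_comp
    (Sum.elim (Sum.inl ∘ Sum.inr ∘ Sum.inl) (Sum.elim Sum.inr (Sum.inl ∘ Sum.inl)))
    (by ext (i | i | i) <;> rfl) (by ext (i | i | i) <;> rfl)
  have hef' : EqTp L ∅ (Sum.elim e (Sum.elim c' f)) (Sum.elim e' (Sum.elim c f')) := hw.of_comp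
    (Sum.elim (Sum.inl ∘ Sum.inr ∘ Sum.inr) (Sum.elim Sum.inr (Sum.inl ∘ Sum.inl)))
    (by ext (i | i | i) <;> rfl) (by ext (i | i | i) <;> rfl)
  have hae' : EqTp L ∅ (Sum.elim a' (Sum.elim (Sum.elim c f') e'))
      (Sum.elim a (Sum.elim (Sum.elim c' f) e)) := hw.symm.of_comp
    (Sum.elim (Sum.inl ∘ Sum.inr ∘ Sum.inl) (Sum.elim (Sum.elim Sum.inr (Sum.inl ∘ Sum.inl))
      (Sum.inl ∘ Sum.inr ∘ Sum.inr)))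
    (by ext (i | (i | i) | i) <;> rfl) (by ext (i | (i | i) | i) <;> rfl)
  have ha3 : SInd L (range a') (range c) (range f') := by
    have : SInd L (range a) (∅ ∪ range c') (range f) := by rwa [empty_union]
    simpa using this.cg H haf'
  have he3 : ¬ SInd L (range e') (range c) (range f') := fun h => hef <| by
    have : SInd L (range e') (∅ ∪ range c) (range f') := by rwa [empty_union]
    simpa using this.cg H hef'.symm
  have h1 : SInd L (range a') (range c ∪ range f') (range e') :=
    hr _ inferInstance subset_union_left _ _ ha2 he2 ha3.weak fun h => he3 h.weak
  have h2 : SInd L (range a') (∅ ∪ range (Sum.elim c f')) (range e') := by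
    rwa [empty_union, Sum.elim_range]
  simpa [Sum.elim_range] using h2.cg H hae'

theorem NOrth.conj (H : Ctx L M κ) [Finite α] [Finite β] {s₁ s₂ t₁ t₂ : α → M}
    {c₁ c₂ d₁ d₂ : β → M} (h : NOrth L κ (range c₁) s₁ (range c₂) s₂)
    (h1 : EqTp L ∅ (Sum.elim s₁ c₁) (Sum.elim t₁ d₁))
    (h2 : EqTp L ∅ (Sum.elim s₂ c₂) (Sum.elim t₂ d₂))
    (hc : EqTp L ∅ (Sum.elim c₁ c₂) (Sum.elim d₁ d₂)) :
    NOrth L κ (range d₁) t₁ (range d₂) t₂ := by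
  obtain ⟨n, f, a, e, ha, he, haf, hef, hae⟩ := h.finite_base H
  obtain ⟨w, hw⟩ := copy H (C := ∅) empty_small hc (Sum.elim f (Sum.elim a e))
  obtain ⟨f', a', e', rfl⟩ : ∃ f' a' e', w = Sum.elim f' (Sum.elim a' e') :=
    ⟨w ∘ Sum.inl, w ∘ Sum.inr ∘ Sum.inl, w ∘ Sum.inr ∘ Sum.inr, by ext (i | i | i) <;> rfl⟩
  have ha0 : EqTp L ∅ (Sum.elim s₁ c₁) (Sum.elim a c₁) := eqTp_sum_iff.2 (by rwa [empty_union])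
  have he0 : EqTp L ∅ (Sum.elim s₂ c₂) (Sum.elim e c₂) := eqTp_sum_iff.2 (by rwa [empty_union])
  have ha1 : EqTp L ∅ (Sum.elim a (Sum.elim c₁ (Sum.elim (Sum.elim c₁ c₂) f)))
    (Sum.elim a' (Sum.elim d₁ (Sum.elim (Sum.elim d₁ d₂) f'))) := hw.of_comp
    (Sum.elim (Sum.inl ∘ Sum.inr ∘ Sum.inl) (Sum.elim (Sum.inr ∘ Sum.inl)
      (Sum.elim Sum.inr (Sum.inl ∘ Sum.inl))))
    (by ext (i | i | (i | i) | i) <;> rfl) (by ext (i | i | (i | i) | i) <;> rfl)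
  have he1 : EqTp L ∅ (Sum.elim e (Sum.elim c₂ (Sum.elim (Sum.elim c₁ c₂) f)))
    (Sum.elim e' (Sum.elim d₂ (Sum.elim (Sum.elim d₁ d₂) f'))) := hw.of_comp
    (Sum.elim (Sum.inl ∘ Sum.inr ∘ Sum.inr) (Sum.elim (Sum.inr ∘ Sum.inr)
      (Sum.elim Sum.inr (Sum.inl ∘ Sum.inl))))
    (by ext (i | i | (i | i) | i) <;> rfl) (by ext (i | i | (i | i) | i) <;> rfl)
  have hae' : EqTp L ∅ (Sum.elim a' (Sum.elim (Sum.elim (Sum.elim d₁ d₂) f') e'))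
    (Sum.elim a (Sum.elim (Sum.elim (Sum.elim c₁ c₂) f) e)) := hw.symm.of_comp
    (Sum.elim (Sum.inl ∘ Sum.inr ∘ Sum.inl) (Sum.elim (Sum.elim Sum.inr (Sum.inl ∘ Sum.inl))
      (Sum.inl ∘ Sum.inr ∘ Sum.inr)))
    (by ext (i | ((i | i) | i) | i) <;> rfl) (by ext (i | ((i | i) | i) | i) <;> rfl)
  refine ⟨range d₁ ∪ range d₂ ∪ range f', inferInstance, subset_union_of_subset_left
    subset_union_left _, subset_union_of_subset_left subset_union_right _, a', e', ?_, ?_, ?_, ?_,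
    fun h => hae ?_⟩
  · have := h1.symm.trans (ha0.trans (ha1.of_comp (Sum.elim Sum.inl (Sum.inr ∘ Sum.inl))
      (x' := Sum.elim a c₁) (y' := Sum.elim a' d₁) (by ext (i | i) <;> rfl)
      (by ext (i | i) <;> rfl)))
    simpa using eqTp_sum_iff.1 this
  · have := h2.symm.trans (he0.trans (he1.of_comp (Sum.elim Sum.inl (Sum.inr ∘ Sum.inl))
      (x' := Sum.elim e c₂) (y' := Sum.elim e' d₂) (by ext (i | i) <;> rfl)
      (by ext (i | i) <;> rfl)))
    simpa using eqTp_sum_iff.1 this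
  · have : SInd L (range a) (∅ ∪ range c₁) (range (Sum.elim (Sum.elim c₁ c₂) f)) := by
      simpa [Sum.elim_range] using haf
    simpa [Sum.elim_range] using this.cg H ha1
  · have : SInd L (range e) (∅ ∪ range c₂) (range (Sum.elim (Sum.elim c₁ c₂) f)) := by
      simpa [Sum.elim_range] using hef
    simpa [Sum.elim_range] using this.cg H he1
  · have : SInd L (range a') (∅ ∪ range (Sum.elim (Sum.elim d₁ d₂) f')) (range e') := by
      simpa [Sum.elim_range] using h
    simpa [Sum.elim_range] using this.cg H hae'

theorem SInd.conj (H : Ctx L M κ) [Finite α] [Finite β] [Finite γ] {a a' : α → M}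
    {b b' : β → M} {e e' : γ → M} (hCB : C ⊆ B)
    (h : SInd L (range a) (C ∪ range b) (B ∪ range e)) [hC : Sm κ C]
    (heq : EqTp L B (Sum.elim a (Sum.elim b e)) (Sum.elim a' (Sum.elim b' e'))) :
    SInd L (range a') (C ∪ range b') (B ∪ range e') := by
  refine sInd_of_fin fun F hF hFB => ?_
  obtain ⟨n, f, hf, hfF⟩ := (hF.inter_of_left B).fin_param
  have h1 : SInd L (range a) (C ∪ range b) (range (Sum.elim e f)) := by
    refine h.mono le_rfl ?_
    rw [Sum.elim_range]
    have : range f ⊆ B := by rw [hfF]; exact inter_subset_right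
    grind
  have h2 : EqTp L B (Sum.elim (Sum.elim a (Sum.elim b e)) f)
      (Sum.elim (Sum.elim a' (Sum.elim b' e')) f) :=
    heq.add (by rw [hfF]; exact inter_subset_right)
  have h3 : EqTp L C (Sum.elim a (Sum.elim b (Sum.elim e f)))
      (Sum.elim a' (Sum.elim b' (Sum.elim e' f))) := by
    refine (h2.mono hCB).of_comp (Sum.elim (Sum.inl ∘ Sum.inl) (Sum.elim (Sum.inl ∘ Sum.inr ∘ Sum.inl)
      (Sum.elim (Sum.inl ∘ Sum.inr ∘ Sum.inr) Sum.inr))) ?_ ?_ <;> ext (i | i | i | i) <;> rfl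
  have h4 := h1.cg H h3
  refine h4.mono le_rfl ?_
  rw [Sum.elim_range, hfF]
  intro x hx
  rcases hFB hx with h | h
  exacts [Or.inr (Or.inr ⟨hx, h⟩), Or.inr (Or.inl h)]

theorem exists_nOrth_pair (H : Ctx L M κ) [Finite α] [Finite β] [Finite γ] {c : γ → M} {d : α → M}
    {e : β → M} {Y : Set M} [hY : Sm κ Y] (h : NOrth L κ (range c) d Y e) :
    ∃ (c₁ c₂ : γ → M) (d₁ d₂ : α → M), EqTp L ∅ (Sum.elim d c) (Sum.elim d₁ c₁) ∧
      EqTp L ∅ (Sum.elim d c) (Sum.elim d₂ c₂) ∧ EqTp L Y c c₁ ∧ EqTp L Y c c₂ ∧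
      SInd L (range c₁) Y (range c₂) ∧ NOrth L κ (range c₁) d₁ (range c₂) d₂ := by
  by_contra hcon
  obtain ⟨n, f, d', e', hd, he, hdf, hef, hde⟩ := h.finite_base H
  obtain ⟨w, hw⟩ := exists_free_seq H (Sum.elim d' (Sum.elim c f)) (Y ∪ range e')
  set dd : ℕ → α → M := fun n => w n ∘ Sum.inl
  set cc : ℕ → γ → M := fun n => w n ∘ Sum.inr ∘ Sum.inl
  set ff : ℕ → Fin n → M := fun n => w n ∘ Sum.inr ∘ Sum.inr
  have hww : ∀ n, w n = Sum.elim (dd n) (Sum.elim (cc n) (ff n)) := fun n => by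
    ext (i | i | i) <;> rfl
  set Z : ℕ → Set M := fun n => range (w n)
  set X : ℕ → Set M := fun n => range (Sum.elim (cc n) (ff n))
  have hX : ∀ n, X n = range (cc n) ∪ range (ff n) := fun n => Sum.elim_range _ _
  have hZ : ∀ n, Z n = range (dd n) ∪ X n := fun n => by
    simp only [Z, X]; rw [hww n, Sum.elim_range]
  have htp : ∀ n, EqTp L (Y ∪ range e') (Sum.elim d' (Sum.elim c f))
      (Sum.elim (dd n) (Sum.elim (cc n) (ff n))) := fun n => by
    rw [← hww]; exact (hw n).1
  have hi : ∀ n, SInd L (Z n) (Y ∪ range e') (⋃ i ∈ ({n}ᶜ : Set ℕ), Z i) :=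
    SInd.others H Sm.le (fun n => (inferInstance : Sm κ (range (w n))).1) fun n => (hw n).2
  have hXe : ∀ n, SInd L (X n) Y (range e') := fun n => by
    have h1 : SInd L (range (Sum.elim c f)) Y (range e') := by
      have := hef.sy H
      refine this.weak ?_
      rw [Sum.elim_range]; grind
    exact h1.tp (htp n).inr
  have hXZ : ∀ n, X n ⊆ Z n := fun n => by rw [hZ]; exact subset_union_right
  have hpre : ∀ n, SInd L (pre X n) Y (range e') := by
    intro n
    induction n with
    | zero => rw [pre_zero]; exact sInd_of_subset (empty_subset _)
    | succ n ih =>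
      rw [pre_succ]
      have h1 : SInd L (X n) (Y ∪ range e') (pre X n) :=
        (hw n).2.mono (hXZ n) (subset_union_of_subset_right
          (pre_subset fun i hi => (hXZ i).trans (subset_pre hi)) _)
      have h2 : SInd L (X n) Y (range e' ∪ pre X n) := (hXe n).tr H h1
      have h3 : SInd L (X n) (Y ∪ pre X n) (range e') := h2.weak
      exact ih.ltr H h3 le_rfl
  set U : Set M := ⋃ n, X n
  have hU : SInd L U Y (range e') := by
    have : U = ⋃ n, pre X n := by
      refine subset_antisymm (iUnion_subset fun n => ?_) (iUnion_subset fun n => ?_)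
      · exact subset_iUnion_of_subset (n + 1) (subset_pre n.lt_succ_self)
      · exact pre_subset fun i _ => subset_iUnion X i
    rw [this]
    exact SInd.iUnion_left pre_mono hpre
  have hdX : ∀ n, SInd L (range (dd n)) (Y ∪ X n) U := by
    intro n
    set O : Set M := ⋃ i ∈ ({n}ᶜ : Set ℕ), X i
    have hO : O ⊆ U := iUnion₂_subset fun i _ => subset_iUnion X i
    have : Sm κ O := Sm.mono hO
    have hUO : U ⊆ X n ∪ O := iUnion_subset fun i => by
      by_cases hin : i = n
      · subst hin; exact subset_union_left
      · exact subset_union_of_subset_right (subset_biUnion_of_mem (u := X) hin) _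
    have h1 : SInd L (range (dd n) ∪ X n) (Y ∪ range e') O := by
      rw [← hZ]
      exact (hi n).mono le_rfl (subset_union_of_subset_right
        (iUnion₂_mono fun i _ => hXZ i) _)
    have h2 : SInd L O (Y ∪ range e') (range (dd n) ∪ X n) := h1.sy H
    have h3 : SInd L O Y (range e') := hU.mono hO subset_union_right
    have h4 : SInd L O Y (range e' ∪ (range (dd n) ∪ X n)) := h3.tr H h2
    have h5 : SInd L O (Y ∪ X n) (range (dd n)) := h4.weak
    have h6 : SInd L (range (dd n)) (Y ∪ X n) O := h5.sy H
    exact h6.mono le_rfl (hUO.trans (by grind))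
  have hdc : ∀ n, SInd L (range (dd n)) (range (cc n)) (Y ∪ range (ff n)) := by
    intro n
    have h1 : SInd L (range d') (∅ ∪ range c) (Y ∪ range f) := by
      rw [empty_union]; exact hdf.weak
    have h2 := h1.conj H (empty_subset _) ((htp n).mono subset_union_left)
    rwa [empty_union] at h2
  have hdU : ∀ n, SInd L (range (dd n)) (range (cc n)) (Y ∪ U) := by
    intro n
    have h1 := hdX n
    rw [hX] at h1
    have h2 := hdc n
    exact h2.tr H h1
  have hpair : ∀ m n, m < n → ¬ NOrth L κ (range (cc n)) (dd n) (range (cc m)) (dd m) := by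
    intro m n hmn hno
    have hq : ∀ n, EqTp L ∅ (Sum.elim d c) (Sum.elim (dd n) (cc n)) := fun n => by
      have h1 : EqTp L ∅ (Sum.elim d c) (Sum.elim d' c) :=
        (hd.add le_rfl).mono (empty_subset _)
      refine h1.trans (((htp n).mono (empty_subset _)).of_comp
        (Sum.elim Sum.inl (Sum.inr ∘ Sum.inl)) ?_ ?_) <;> ext (i | i) <;> rfl
    refine hcon ⟨cc n, cc m, dd n, dd m, hq n, hq m, (htp n).inr.inl.mono subset_union_left,
      (htp m).inr.inl.mono subset_union_left, ?_, hno⟩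
    have h1 : SInd L (X n) (Y ∪ range e') (X m) :=
      (hw n).2.mono (hXZ n) (subset_union_of_subset_right ((hXZ m).trans (subset_pre hmn)) _)
    have h2 : SInd L (X n) Y (range e' ∪ X m) := (hXe n).tr H h1
    rw [hX, hX] at h2
    exact h2.weak
  set V : ℕ → Set M := fun n => range (dd n)
  have hcU : ∀ n, range (cc n) ⊆ U := fun n =>
    (by rw [hX]; exact subset_union_left : range (cc n) ⊆ X n).trans (subset_iUnion X n)
  have hdV : ∀ n, SInd L (range (dd n)) (range (cc n)) (Y ∪ U ∪ pre V n) := by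
    intro n
    induction n using Nat.strong_induction_on with
    | _ n ih =>
      have key : ∀ m ≤ n, SInd L (range (dd n)) (range (cc n)) (Y ∪ U ∪ pre V m) := by
        intro m
        induction m with
        | zero => intro _; rw [pre_zero, union_empty]; exact hdU n
        | succ m ihm =>
          intro hm
          have h1 := ihm (by omega)
          have h2 := ih m (by omega)
          have h3 : SInd L (range (dd n)) (Y ∪ U ∪ pre V m) (V m) := by
            by_contra hcon
            exact hpair m n (by omega) ⟨Y ∪ U ∪ pre V m, inferInstance,
              (hcU n).trans (by grind), (hcU m).trans (by grind), dd n, dd m,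
              EqTp.refl _, EqTp.refl _, h1, h2, hcon⟩
          rw [pre_succ]
          have := hcU n
          exact h1.tr H h3
      exact key n le_rfl
  obtain ⟨N, hN⟩ := lc_seq H e' (Y ∪ U) V
  have h1 : SInd L (range e') (Y ∪ U ∪ pre V N) (V N) :=
    hN.mono le_rfl ((subset_iUnion V N).trans subset_union_right)
  have h2 : SInd L (range (dd N)) (Y ∪ U ∪ pre V N) (range e') := h1.sy H
  have h3 : SInd L (range (dd N)) (Y ∪ X N) (Y ∪ U ∪ pre V N) := by
    have h4 : SInd L (range (dd N)) (Y ∪ U) (pre V N) := by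
      have := hcU N
      exact (hdV N).weak
    have hXU : X N ⊆ U := subset_iUnion X N
    exact (hdX N).tr H h4
  have h4 : SInd L (range (dd N)) (Y ∪ X N) (range e') := by
    have hXU : X N ⊆ U := subset_iUnion X N
    exact h3.tr H h2
  rw [hX] at h4
  refine hde ?_
  have h5 : SInd L (range d') (Y ∪ range (Sum.elim c f)) (range e') := by
    have h6 : SInd L (range (dd N)) (Y ∪ range (Sum.elim (cc N) (ff N))) (range e') := by
      rwa [Sum.elim_range]
    refine h6.cg H ?_
    refine ((htp N).symm.add (b := e') subset_union_right).mono subset_union_left |>.of_comp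
      (Sum.elim (Sum.inl ∘ Sum.inl) (Sum.elim (Sum.inl ∘ Sum.inr) Sum.inr)) ?_ ?_ <;>
      ext (i | i | i) <;> rfl
  rw [Sum.elim_range] at h5
  exact h5.weak
/-- Copies of a regular type along an indiscernible sequence are pairwise nonorthogonal, when the
type is nonorthogonal to a type over a set independent from its parameters. -/
theorem nOrth_copies (H : Ctx L M κ) [Finite α] [Finite β] [Finite γ] {c : ℕ → γ → M} {d : α → M}
    {e : β → M} {Y : Set M} [hY : Sm κ Y] [hC : Sm κ C] (hCY : C ⊆ Y) (hind : Indisc L C c)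
    (hcY : SInd L (range (c 0)) C Y) (hr : RegS L κ (range (c 0)) d)
    (hst : StatS L κ (range (c 0)) d) (hno : NOrth L κ (range (c 0)) d Y e) {i j : ℕ}
    {d₁ d₂ : α → M} (h1 : EqTp L ∅ (Sum.elim d (c 0)) (Sum.elim d₁ (c i)))
    (h2 : EqTp L ∅ (Sum.elim d (c 0)) (Sum.elim d₂ (c j))) :
    NOrth L κ (range (c i)) d₁ (range (c j)) d₂ := by
  obtain ⟨a, b, s, t, has, hbt, ha, hb, hab, hst'⟩ := exists_nOrth_pair H hno
  have h3 : SInd L (range a) C Y := hcY.tp ha (by grind)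
  have h4 : SInd L (range a) C (range b) := h3.tr H hab
  obtain ⟨y, hy⟩ := copy H (C := C) Sm.le (hb.symm.mono hCY) a
  have h5 : SInd L (range y) C (range (c 0)) := h4.mv H hy
  obtain ⟨y', hy'⟩ := hind.common H Sm.le (sInd_range.1 h5)
  have h6 : ∀ j, EqTp L C (Sum.elim a b) (Sum.elim y' (c j)) := fun j => hy.trans (hy' j).symm
  obtain ⟨s', hs'⟩ := copy H (C := C) Sm.le (h6 0).inl s
  have h7 : EqTp L ∅ (Sum.elim s a) (Sum.elim s' y') := hs'.mono (empty_subset _)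
  have key : ∀ {j d'}, EqTp L ∅ (Sum.elim d (c 0)) (Sum.elim d' (c j)) →
      NOrth L κ (range y') s' (range (c j)) d' := fun {j d'} hd' =>
    hst'.conj H h7 (hbt.symm.trans hd') ((h6 j).mono (empty_subset _))
  exact (key h1).trans H (hr.conj H (has.trans h7)) (hst.conj H (has.trans h7)) (key h2)
/-- A realization of a nonforking extension of a regular type is independent from any realization
of a forking extension of a nonorthogonal regular type. -/
theorem NOrth.indep_of_fork (H : Ctx L M κ) [Finite α] [Finite β] {s s' : α → M} {e e' : β → M}
    {Bs Be W : Set M} (hno : NOrth L κ Bs s Be e) (hr : RegS L κ Bs s) (hst : StatS L κ Bs s)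
    (hre : RegS L κ Be e) (hs : EqTp L Bs s s') (he : EqTp L Be e e') [hW : Sm κ W] (hBs : Bs ⊆ W)
    (hBe : Be ⊆ W) (hsW : SInd L (range s') Bs W) (heW : ¬ SInd L (range e') Be W) :
    SInd L (range s') W (range e') := by
  have : Sm κ Bs := Sm.mono hBs
  have : Sm κ Be := Sm.mono hBe
  obtain ⟨n, f₀, a, b₀, ha, hb₀, haf, hbf, hab⟩ := hno.finite_base H
  have hsB : SInd L (range s') Bs (Bs ∪ Be) := hsW.mono le_rfl (by grind)
  have hG : EqTp L (Bs ∪ Be) a s' := hst _ inferInstance subset_union_left _ _ ha hs haf.weak hsB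
  obtain ⟨w, hw⟩ := copy H (C := Bs ∪ Be) Sm.le hG (Sum.elim f₀ b₀)
  obtain ⟨w', hw1, hw2⟩ := exists_free H w (Bs ∪ Be ∪ range s') (W ∪ range e')
  obtain ⟨f, b, rfl⟩ : ∃ f b, w' = Sum.elim f b := ⟨_, _, (Sum.elim_comp_inl_inr w').symm⟩
  have htp : EqTp L (Bs ∪ Be) (Sum.elim (Sum.elim f₀ b₀) a) (Sum.elim (Sum.elim f b) s') :=
    hw.trans (eqTp_sum_iff.2 hw1)
  rw [Sum.elim_range] at hw2
  have h1 : SInd L (range s') (Bs ∪ Be) (range f) := by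
    have : SInd L (range a) (Bs ∪ Be) (range f₀) := haf.weak
    refine this.mv H (htp.of_comp (Sum.elim Sum.inr (Sum.inl ∘ Sum.inl)) ?_ ?_) <;>
      ext (i | i) <;> rfl
  have h2 : SInd L (range b) Be (Bs ∪ Be ∪ range f) := by
    have h3 : SInd L (range b₀) Be (Bs ∪ Be) := hbf.weak
    have h4 : SInd L (range b) Be (Bs ∪ Be) := h3.tp htp.inl.inr
    have h5 : SInd L (range b₀) (Bs ∪ Be) (range f₀) := hbf.weak
    have h6 : SInd L (range b) (Bs ∪ Be) (range f) := h5.mv H htp.inl.swap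
    exact h4.tr H h6
  have h3 : ¬ SInd L (range s') (Bs ∪ Be ∪ range f) (range b) := by
    intro h
    refine hab (h.cg H ?_)
    refine htp.symm.of_comp (Sum.elim Sum.inr (Sum.elim (Sum.inl ∘ Sum.inl) (Sum.inl ∘ Sum.inr)))
      ?_ ?_ <;> ext (i | i | i) <;> rfl
  have h4 : SInd L (range f) (Bs ∪ Be) (range s' ∪ W ∪ range e') := (h1.sy H).tr H hw2
  have h5 : SInd L (range f) W (range s' ∪ range e') := h4.weak
  have h6 : SInd L (range s' ∪ range e') W (range f) := h5.sy H
  have h7 : SInd L (range s') W (range f) := h6.weak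
  have h8 : SInd L (range s') Bs (W ∪ range f) := hsW.tr H h7
  have h9 : SInd L W (Bs ∪ Be) (range s' ∪ (range f ∪ range b)) := by
    have h10 : SInd L (range s') (Bs ∪ Be) W := hsW.weak
    have h11 : SInd L (range s' ∪ (range f ∪ range b)) (Bs ∪ Be) W := h10.ltr H hw2.weak le_rfl
    exact h11.sy H
  have h10 : SInd L W (Bs ∪ Be ∪ range f) (range s' ∪ range b) := h9.weak
  have h11 : SInd L (range s' ∪ range b) (Bs ∪ Be ∪ range f) W := h10.sy H
  have h12 : SInd L (range b) Be (W ∪ range f) := h2.tr H h11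
  have h13 : SInd L (range b) (W ∪ range f) (range e') :=
    hre _ inferInstance (hBe.trans subset_union_left) _ _
      (hb₀.trans (htp.inl.inr.mono subset_union_right)) he h12
      fun h => heW (h.mono le_rfl (by grind))
  rcases hr.weight_one H hs (hBs.trans subset_union_left) h8 h13 with h | h
  · have h14 : SInd L (range s') (Bs ∪ Be ∪ range f) W := h11.weak
    exact absurd (h14.tr H h) h3
  · exact h7.tr H h
theorem ElemSubset.exists_realize {N S : Set M} (hN : ElemSubset (L := L) N) (hS : S.Finite)
    (hSN : S ⊆ N) (φ : L.Formula (Fin 1 ⊕ S)) {x : M}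
    (hx : φ.Realize (Sum.elim ![x] Subtype.val)) :
    ∃ y ∈ N, φ.Realize (Sum.elim ![y] Subtype.val) := by
  have := hS.to_subtype
  obtain ⟨n, ⟨e⟩⟩ := Finite.exists_equiv_fin S
  set a : Fin n → M := fun i => (e.symm i : M)
  set ψ : L.BoundedFormula (Fin n) 1 :=
    BoundedFormula.relabel (Sum.elim Sum.inr (Sum.inl ∘ e) : Fin 1 ⊕ S → Fin n ⊕ Fin 1) φ
  have key : ∀ y : M, ψ.Realize a ![y] ↔ φ.Realize (Sum.elim ![y] Subtype.val) := by
    intro y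
    refine BoundedFormula.realize_relabel.trans ?_
    rw [Formula.Realize]
    refine iff_of_eq (congr (congrArg _ ?_) (Subsingleton.elim _ _))
    ext (i | i)
    · simp
    · simp [a]
  obtain ⟨y, hy, h⟩ := hN.2 n ψ a (fun i => hSN (e.symm i).2) ⟨x, (key x).2 hx⟩
  exact ⟨y, hy, (key y).1 h⟩

theorem exists_eqTp_mem_one {N S : Set M} (hN : ElemSubset (L := L) N)
    (hs : SubsetSaturated (L := L) κ N) (hS : S.Finite) (hSN : S ⊆ N) (x : M) :
    ∃ y ∈ N, EqTp L S ![x] ![y] := by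
  have hlt : #S < κ := hS.lt_aleph0.trans_le hκ.1
  obtain ⟨y, hy, h⟩ := hs S hSN hlt {φ | φ.Realize (Sum.elim ![x] Subtype.val)} fun fs hfs => by
    obtain ⟨y, hy, h⟩ := hN.exists_realize hS hSN
      (BoundedFormula.iInf fun φ : fs => (φ : L.Formula (Fin 1 ⊕ S)))
      (x := x) (BoundedFormula.realize_iInf.2 fun φ => hfs φ.2)
    exact ⟨y, hy, fun φ hφ => BoundedFormula.realize_iInf.1 h ⟨φ, hφ⟩⟩
  refine ⟨y, hy, sameTypeOver_iff.1 fun φ => ⟨fun hφ => h φ hφ, fun hφ => ?_⟩⟩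
  by_contra hn
  exact (Formula.realize_not.1 (h φ.not (Formula.realize_not.2 hn))) hφ

/-- Finitary types over finite subsets of a saturated elementary substructure are realized
in it. -/
theorem exists_eqTp_mem (H : Ctx L M κ) {N S : Set M} (hN : ElemSubset (L := L) N)
    (hs : SubsetSaturated (L := L) κ N) (hS : S.Finite) (hSN : S ⊆ N) {n : ℕ} (a : Fin n → M) :
    ∃ b : Fin n → M, range b ⊆ N ∧ EqTp L S a b := by
  induction n with
  | zero => exact ⟨a, by rintro _ ⟨i, _⟩; exact i.elim0, EqTp.refl a⟩
  | succ n ih =>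
    obtain ⟨b, hb, hab⟩ := ih (a ∘ Fin.castSucc)
    obtain ⟨y, hy⟩ := copy H (small_finite H.inf hS) hab ![a (Fin.last n)]
    obtain ⟨z, hz, hyz⟩ := exists_eqTp_mem_one hN hs (hS.union (finite_range b))
      (union_subset hSN hb) (y 0)
    have hy0 : ![y 0] = y := by ext i; rw [Subsingleton.elim i 0]; rfl
    rw [hy0] at hyz
    have h1 := hy.trans (eqTp_sum_iff.2 hyz)
    refine ⟨Fin.snoc b z, ?_, ?_⟩
    · rintro _ ⟨i, rfl⟩
      induction i using Fin.lastCases with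
      | last => simpa using hz
      | cast i => simpa using hb ⟨i, rfl⟩
    · refine h1.of_comp (Fin.lastCases (Sum.inl 0) Sum.inr) ?_ ?_ <;> ext i <;>
        induction i using Fin.lastCases <;> simp

theorem aclSet_subset {N : Set M} (hN : ElemSubset (L := L) N)
    (hs : SubsetSaturated (L := L) κ N) (hAN : A ⊆ N) : aclSet (L := L) A ⊆ N := by
  intro x hx
  obtain ⟨s, hs', hxs, hf⟩ := mem_aclSet_iff.1 hx
  obtain ⟨A₀, hA₀, hs₀⟩ := definable_iff_finitely_definable.1 hs'
  set F : Set M := {y | ![y] ∈ s} ∩ N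
  have hF : F.Finite := (hf.preimage (f := fun y : M => ![y]) fun a _ b _ h => by
    simpa using congrFun h 0).inter_of_left N
  obtain ⟨y, hy, hxy⟩ := exists_eqTp_mem_one hN hs (A₀.finite_toSet.union hF)
    (union_subset (hA₀.trans hAN) inter_subset_right) x
  have hys : ![y] ∈ s := (hxy s (hs₀.mono subset_union_left)).1 hxs
  have : ![x] 0 = ![y] 0 := hxy.symm.eq_of_mem (Or.inr ⟨hys, hy⟩)
  exact (show x = y from this) ▸ hy

/-- The type of `a` over `B` is regular, stationary and nonorthogonal to the regular stationary
type of `p` over `P`. -/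
structure PReg (L : FirstOrder.Language.{u, u}) [L.Structure M] (κ : Cardinal.{u}) (P : Set M)
    (p : δ → M) (B : Set M) (a : α → M) : Prop where
  reg : RegS L κ B a
  stat : StatS L κ B a
  north : NOrth L κ B a P p
  regP : RegS L κ P p
  statP : StatS L κ P p

theorem PReg.nOrth (H : Ctx L M κ) [Finite α] [Finite β] [Finite δ] {P Bs Be : Set M} {p : δ → M}
    {s : α → M} {e : β → M} (hs : PReg L κ P p Bs s) (he : PReg L κ P p Be e) [Sm κ P] [Sm κ Bs]
    [Sm κ Be] : NOrth L κ Bs s Be e :=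
  (hs.north.symm H).trans H hs.regP hs.statP (he.north.symm H)

theorem PReg.indep (H : Ctx L M κ) [Finite α] [Finite β] [Finite δ] {P Bs Be W : Set M} {p : δ → M}
    {s s' : α → M} {e e' : β → M} (hs : PReg L κ P p Bs s) (he : PReg L κ P p Be e) [Sm κ P]
    (hs' : EqTp L Bs s s') (he' : EqTp L Be e e') [hW : Sm κ W] (hBs : Bs ⊆ W)
    (hBe : Be ⊆ W) (hsW : SInd L (range s') Bs W) (heW : ¬ SInd L (range e') Be W) :
    SInd L (range s') W (range e') :=
  have : Sm κ Bs := Sm.mono hBs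
  have : Sm κ Be := Sm.mono hBe
  (hs.nOrth H he).indep_of_fork H hs.reg hs.stat he.reg hs' he' hBs hBe hsW heW

/-- The concatenation of an initial segment of a sequence of tuples. -/
def tup (b : ℕ → α → M) (n : ℕ) : Fin n × α → M := fun i => b i.1 i.2

theorem range_tup (b : ℕ → α → M) (n : ℕ) : range (tup b n) = pre (fun j => range (b j)) n := by
  ext x
  simp only [tup, mem_range, pre, mem_iUnion, mem_Iio, Prod.exists]
  exact ⟨fun ⟨i, j, h⟩ => ⟨i, i.2, j, h⟩, fun ⟨i, hi, j, h⟩ => ⟨⟨i, hi⟩, j, h⟩⟩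

theorem EqTp.tup_succ {b d : ℕ → α → M} {n : ℕ}
    (h : EqTp L A (Sum.elim (b n) (tup b n)) (Sum.elim (d n) (tup d n))) :
    EqTp L A (tup b (n + 1)) (tup d (n + 1)) := by
  refine h.of_comp (fun i => Fin.lastCases (motive := fun _ => α ⊕ Fin n × α) (Sum.inl i.2)
    (fun j => Sum.inr (j, i.2)) i.1) ?_ ?_ <;> ext ⟨i, j⟩ <;>
    induction i using Fin.lastCases <;> simp [tup]

/-- Independent sequences of realizations of a stationary type have the same type. -/
theorem StatS.tup_eqTp (H : Ctx L M κ) [Finite α] {P E : Set M} {s : α → M} (hst : StatS L κ P s)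
    [hE : Sm κ E] (hPE : P ⊆ E) {b d : ℕ → α → M} (hb : ∀ j, EqTp L P s (b j))
    (hd : ∀ j, EqTp L P s (d j))
    (hbi : ∀ j, SInd L (range (b j)) P (E ∪ pre (fun i => range (b i)) j))
    (hdi : ∀ j, SInd L (range (d j)) P (E ∪ pre (fun i => range (d i)) j)) (n : ℕ) :
    EqTp L E (tup b n) (tup d n) := by
  have : Sm κ P := Sm.mono hPE
  induction n with
  | zero =>
    have : tup b 0 = tup d 0 := by ext i; exact i.1.elim0
    rw [this]; exact EqTp.refl _
  | succ n ih =>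
    obtain ⟨x, hx⟩ := copy H (C := E) Sm.le ih (b n)
    have h1 : EqTp L P s x := (hb n).trans (hx.inl.mono hPE)
    have h2 : SInd L (range x) P (E ∪ range (tup d n)) := by
      have h3 := hbi n
      have h4 : SInd L (range (b n)) P E := h3.weak
      have h5 : SInd L (range (b n)) E (range (tup b n)) := by
        rw [range_tup]; exact h3.weak
      have h6 : SInd L (range x) P E := h4.tp hx.inl
      have h7 : SInd L (range x) E (range (tup d n)) := h5.mv H hx
      exact h6.tr H h7
    have h3 : EqTp L (E ∪ range (tup d n)) x (d n) := by
      refine hst _ inferInstance (hPE.trans subset_union_left) _ _ h1 (hd n) h2 ?_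
      rw [range_tup]; exact hdi n
    exact (hx.trans (eqTp_sum_iff.2 h3)).tup_succ

theorem exists_eqTp_mem_finite (H : Ctx L M κ) [Finite α] {N S : Set M}
    (hN : ElemSubset (L := L) N) (hs : SubsetSaturated (L := L) κ N) (hS : S.Finite) (hSN : S ⊆ N)
    (a : α → M) : ∃ b : α → M, range b ⊆ N ∧ EqTp L S a b := by
  obtain ⟨n, ⟨e⟩⟩ := Finite.exists_equiv_fin α
  obtain ⟨b, hb, hab⟩ := exists_eqTp_mem H hN hs hS hSN (a ∘ e.symm)
  exact ⟨b ∘ e, (range_comp_subset_range _ _).trans hb, hab.of_comp e (by ext; simp) rfl⟩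

/-- Two nonorthogonal types have independent sequences of realizations that depend on each
other over the parameters of the types. -/
theorem NOrth.exists_dep_seq (H : Ctx L M κ) [Finite α] [Finite β] {B₁ B₂ : Set M} {s : α → M}
    {t : β → M} [hB₁ : Sm κ B₁] [hB₂ : Sm κ B₂] (h : NOrth L κ B₁ s B₂ t) :
    ∃ (a : ℕ → α → M) (b : ℕ → β → M) (n : ℕ), (∀ j, EqTp L B₁ s (a j)) ∧
      (∀ j, EqTp L B₂ t (b j)) ∧
      (∀ j, SInd L (range (b j)) B₂ (B₁ ∪ B₂ ∪ pre (fun i => range (b i)) j)) ∧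
      ¬ SInd L (range (tup a n)) (B₁ ∪ B₂) (range (tup b n)) := by
  obtain ⟨k, z, a₀, b₀, ha₀, hb₀, haz, hbz, hab⟩ := h.finite_base H
  obtain ⟨w, hw⟩ := exists_free_seq H (Sum.elim a₀ b₀) (B₁ ∪ B₂ ∪ range z)
  set a : ℕ → α → M := fun n => w n ∘ Sum.inl
  set b : ℕ → β → M := fun n => w n ∘ Sum.inr
  have hww : ∀ n, w n = Sum.elim (a n) (b n) := fun n => (Sum.elim_comp_inl_inr _).symm
  set Z : ℕ → Set M := fun n => range (w n)
  have hZ : ∀ n, Z n = range (a n) ∪ range (b n) := fun n => by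
    simp only [Z]; rw [hww n, Sum.elim_range]
  have htp : ∀ n, EqTp L (B₁ ∪ B₂ ∪ range z) (Sum.elim a₀ b₀) (Sum.elim (a n) (b n)) := fun n => by
    rw [← hww]; exact (hw n).1
  obtain ⟨N, hN⟩ := lc_seq H z (B₁ ∪ B₂) Z
  have hba : ∀ j, SInd L (range (b j)) B₂ (B₁ ∪ B₂ ∪ range z ∪ pre Z j) := fun j => by
    have h1 : SInd L (range (b j)) B₂ (B₁ ∪ B₂ ∪ range z) := hbz.tp (htp j).inr
    have h2 : SInd L (range (b j)) (B₁ ∪ B₂ ∪ range z) (pre Z j) := (hw j).2.mono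
      (by have := hZ j; simp only [Z] at this; rw [this]; exact subset_union_right)
      subset_union_right
    exact h1.tr H h2
  have hbp : ∀ j, pre (fun i => range (b i)) j ⊆ pre Z j := fun j =>
    pre_subset fun i hi => subset_trans (by rw [hZ]; exact subset_union_right) (subset_pre hi)
  have hap : ∀ j, pre (fun i => range (a i)) j ⊆ pre Z j := fun j =>
    pre_subset fun i hi => subset_trans (by rw [hZ]; exact subset_union_left) (subset_pre hi)
  have hZp : ∀ j, pre Z j ⊆ pre (fun i => range (a i)) j ∪ pre (fun i => range (b i)) j := fun j =>
    pre_subset fun i hi => by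
      rw [hZ]; exact union_subset_union (subset_pre (X := fun i => range (a i)) hi)
        (subset_pre (X := fun i => range (b i)) hi)
  refine ⟨a, b, N + 1, fun j => ha₀.trans ((htp j).inl.mono (by grind)),
    fun j => hb₀.trans ((htp j).inr.mono (by grind)), fun j => ?_, fun hcon => ?_⟩
  · have := hbp j
    exact (hba j).mono le_rfl (by grind)
  · rw [range_tup, range_tup, pre_succ, pre_succ] at hcon
    have := hbp N
    have := hap N
    have := hZp N
    have hZN : Z N = range (a N) ∪ range (b N) := hZ N
    have h0 : SInd L (pre (fun i => range (a i)) N ∪ range (a N))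
        (B₁ ∪ B₂ ∪ pre (fun i => range (b i)) N) (range (b N)) := hcon.weak
    have h1 := h0.sy H
    have h2 : SInd L (range (b N)) (B₁ ∪ B₂ ∪ pre Z N) (range (a N)) := h1.weak
    have h3 : SInd L (range z) (B₁ ∪ B₂ ∪ pre Z N) (range (a N) ∪ range (b N)) := by
      rw [← hZN]; exact hN.mono le_rfl ((subset_iUnion Z N).trans subset_union_right)
    have h4 : SInd L (range (a N)) (B₁ ∪ B₂ ∪ pre Z N ∪ range (b N)) (range z) := by
      have h5 : SInd L (range z) (B₁ ∪ B₂ ∪ pre Z N ∪ range (b N)) (range (a N)) := h3.weak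
      exact h5.sy H
    have h5 : SInd L (range (a N)) (B₁ ∪ B₂ ∪ pre Z N) (range (b N) ∪ range z) :=
      (h2.sy H).tr H h4
    have h6 : SInd L (range (a N)) (B₁ ∪ B₂ ∪ range z) (pre Z N) := (hw N).2.mono
      (by have := hZ N; simp only [Z] at this; rw [this]; exact subset_union_left)
      subset_union_right
    have h7 : SInd L (range (a N)) (B₁ ∪ B₂ ∪ range z) (range (b N)) := by
      have h8 : SInd L (range (a N)) (B₁ ∪ B₂ ∪ range z ∪ pre Z N) (range (b N)) := h5.weak
      exact h6.tr H h8
    refine hab (h7.mv H (htp N).symm |>.weak)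
theorem exists_finite_of_no_seq {P N Y : Set M} {s : α → M}
    (h : ¬ ∃ f : ℕ → α → M, ∀ j, range (f j) ⊆ N ∧ EqTp L P s (f j) ∧
      SInd L (range (f j)) P (Y ∪ pre (fun i => range (f i)) j)) [Finite α] :
    ∃ F : Set M, F.Finite ∧ F ⊆ N ∧
      ∀ f : α → M, range f ⊆ N → EqTp L P s f → ¬ SInd L (range f) P (Y ∪ F) := by
  by_contra! hcon
  have : Nonempty (α → M) := ⟨s⟩
  refine h (dc_greedy (fun n g x => range x ⊆ N ∧ EqTp L P s x ∧
    SInd L (range x) P (Y ∪ pre (fun i => range (g i)) n)) ?_ ?_)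
  · intro n g g' hg x hx
    have : pre (fun i => range (g' i)) n = pre (fun i => range (g i)) n :=
      iUnion₂_congr fun i hi => congrArg range (hg i hi)
    rwa [this]
  · intro n g hg
    exact hcon _ ((finite_Iio n).biUnion fun i _ => finite_range _) (pre_subset fun i hi => (hg i hi).1)

theorem not_exists_seq_of_bound (H : Ctx L M κ) [Finite α] [Finite β] [Finite δ] [Finite γ]
    [Finite ι] {P N Y F : Set M} {p : δ → M}
    (hN : ElemSubset (L := L) N) (hs : SubsetSaturated (L := L) κ N) [hP : Sm κ P] [hY : Sm κ Y]
    (hF : F.Finite) (hFN : F ⊆ N) {c : γ → M} {c' : ι → M} {s : α → M} {t : β → M}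
    (hcF : range c ⊆ F) (hcF' : range c' ⊆ F)
    (hsP : PReg L κ P p (range c) s) (htP : PReg L κ P p (range c') t)
    (hb : ∀ f : α → M, range f ⊆ N → EqTp L (range c) s f → ¬ SInd L (range f) (range c) (Y ∪ F)) :
    ¬ ∃ f : ℕ → β → M, ∀ j, range (f j) ⊆ N ∧ EqTp L (range c') t (f j) ∧
      SInd L (range (f j)) (range c') (Y ∪ F ∪ pre (fun i => range (f i)) j) := by
  rintro ⟨d, hd⟩
  have : Sm κ F := Sm.of_finite hF
  obtain ⟨a, b, n, ha, hb', hbi, hab⟩ := (hsP.nOrth H htP).exists_dep_seq H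
  have h1 : EqTp L (range c ∪ range c') (tup b n) (tup d n) :=
    htP.stat.tup_eqTp H subset_union_right hb' (fun j => (hd j).2.1) hbi
      (fun j => (hd j).2.2.mono le_rfl (by grind)) n
  obtain ⟨x, hx⟩ := copy H (C := range c ∪ range c') Sm.le h1 (tup a n)
  have hdN : range (tup d n) ⊆ N := by
    rw [range_tup]; exact pre_subset fun i _ => (hd i).1
  obtain ⟨y, hyN, hxy⟩ := exists_eqTp_mem_finite H hN hs
    (S := range c ∪ range c' ∪ range (tup d n))
    (((finite_range c).union (finite_range c')).union (finite_range _)) (by grind) x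
  have hy := hx.trans (eqTp_sum_iff.2 hxy)
  set a' : Fin n → α → M := fun i j => y (i, j)
  have ha' : ∀ i, EqTp L (range c) s (a' i) := fun i =>
    (ha i).trans ((hy.inl.mono subset_union_left).comp fun j => (i, j))
  have haN : ∀ i, range (a' i) ⊆ N := fun i =>
    (range_comp_subset_range (fun j => (i, j)) y).trans hyN
  have hya : range y = ⋃ i, range (a' i) := by
    ext z; simp only [mem_range, mem_iUnion, Prod.exists, a']
  set X : ℕ → Set M := fun i => if h : i < n then range (a' ⟨i, h⟩) else ∅
  have hX : ∀ m ≤ n, pre X m ⊆ range y := fun m hm => pre_subset fun i hi => by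
    simp only [X, dif_pos (hi.trans_le hm)]
    rw [hya]; exact subset_iUnion (fun i => range (a' i)) _
  have hXy : range y ⊆ pre X n := by
    rw [hya]
    refine iUnion_subset fun i => ?_
    have : X i = range (a' i) := by simp only [X, dif_pos i.2]
    rw [← this]; exact subset_pre i.2
  have hdy : ∀ j, SInd L (range (d j)) (range c')
      (Y ∪ F ∪ pre (fun i => range (d i)) j ∪ range y) := by
    intro j
    have key : ∀ m ≤ n, SInd L (range (d j)) (range c')
        (Y ∪ F ∪ pre (fun i => range (d i)) j ∪ pre X m) := by
      intro m
      induction m with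
      | zero => intro _; rw [pre_zero, union_empty]; exact (hd j).2.2
      | succ m ih =>
        intro hm
        have h2 := ih (by omega)
        have : Sm κ (pre X m) := Sm.mono (hX m (by omega))
        have hXm : X m = range (a' ⟨m, hm⟩) := by simp only [X, dif_pos (show m < n from hm)]
        rw [pre_succ, hXm]
        have h3 := htP.indep H hsP (hd j).2.1 (ha' ⟨m, hm⟩)
          (W := Y ∪ F ∪ pre (fun i => range (d i)) j ∪ pre X m) (by grind) (by grind) h2
          (fun h => hb _ (haN _) (ha' ⟨m, hm⟩) (h.mono le_rfl (by grind)))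
        exact h2.tr H h3
    exact (key n le_rfl).mono le_rfl (by grind)
  have hpre : ∀ m, SInd L (pre (fun i => range (d i)) m) (range c ∪ range c') (range y) := by
    intro m
    induction m with
    | zero => rw [pre_zero]; exact sInd_of_subset (empty_subset _)
    | succ m ih =>
      rw [pre_succ]
      have h2 : SInd L (range (d m)) (range c ∪ range c' ∪ pre (fun i => range (d i)) m)
        (range y) := (hdy m).weak
      exact ih.ltr H h2 le_rfl
  have h3 : SInd L (range y) (range c ∪ range c') (range (tup d n)) := by
    rw [range_tup]; exact (hpre n).sy H
  exact hab (h3.mv H hy.symm)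

theorem exists_finite_bound (H : Ctx L M κ) [Finite α] [Finite δ] [Finite γ] {P N Y : Set M}
    {p : δ → M} (hN : ElemSubset (L := L) N) (hs : SubsetSaturated (L := L) κ N) [hP : Sm κ P]
    [hY : Sm κ Y] {c : ℕ → γ → M} {s : ℕ → α → M} (hcN : ∀ i, range (c i) ⊆ N)
    (hsP : ∀ i, PReg L κ P p (range (c i)) (s i))
    (h : ¬ ∃ f : ℕ → α → M, ∀ j, range (f j) ⊆ N ∧ EqTp L (range (c 0)) (s 0) (f j) ∧
      SInd L (range (f j)) (range (c 0)) (Y ∪ pre (fun i => range (f i)) j)) (k : ℕ) :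
    ∃ F : Set M, F.Finite ∧ F ⊆ N ∧ ∀ i < k, ∀ f : α → M, range f ⊆ N →
      EqTp L (range (c i)) (s i) f → ¬ SInd L (range f) (range (c i)) (Y ∪ F) := by
  obtain ⟨F, hF, hFN, hbd⟩ := exists_finite_of_no_seq h
  have key : ∀ i, ∃ F : Set M, F.Finite ∧ F ⊆ N ∧ ∀ f : α → M, range f ⊆ N →
      EqTp L (range (c i)) (s i) f → ¬ SInd L (range f) (range (c i)) (Y ∪ F) := by
    intro i
    set F' : Set M := F ∪ range (c 0) ∪ range (c i)
    have hF'N : F' ⊆ N := union_subset (union_subset hFN (hcN _)) (hcN _)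
    have hF' : F'.Finite := (hF.union (finite_range _)).union (finite_range _)
    obtain ⟨G, hG, hGN, hGb⟩ := exists_finite_of_no_seq
      (not_exists_seq_of_bound (Y := Y) H hN hs hF' hF'N
        (by grind) (by grind) (hsP 0) (hsP i) fun f hf hsf hi =>
          hbd f hf hsf (hi.mono le_rfl (by grind)))
    exact ⟨F' ∪ G, hF'.union hG, union_subset hF'N hGN, fun f hf hsf hi =>
      hGb f hf hsf (by rwa [union_assoc])⟩
  choose G hG hGN hGb using key
  refine ⟨⋃ i ∈ Iio k, G i, (finite_Iio k).biUnion fun i _ => hG i, iUnion₂_subset fun i _ => hGN i,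
    fun i hi f hf hsf hi' => hGb i f hf hsf (hi'.mono le_rfl ?_)⟩
  have : G i ⊆ ⋃ i ∈ Iio k, G i := subset_biUnion_of_mem (u := G) hi
  grind
theorem aclSet_of_eqTp (H : Ctx L M κ) [Finite α] {S A₀ : Set M} [hS : Sm κ S] {w w' : α → M}
    (h : EqTp L S w w') {x : M} (hx : x ∈ S) (hA : A₀ ⊆ S)
    (hacl : x ∈ aclSet (L := L) (A₀ ∪ range w)) : x ∈ aclSet (L := L) (A₀ ∪ range w') := by
  obtain ⟨s, hs, hxs, hf⟩ := mem_aclSet_iff.1 hacl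
  obtain ⟨t, ht, rfl⟩ := exists_fib hs
  refine mem_aclSet_iff.2 ⟨fib t w', definable_fib ht w', ?_, ?_⟩
  · have h1 : EqTp L S (Sum.elim ![x] w) (Sum.elim ![x] w') := (h.add (b := ![x]) (by
      rintro _ ⟨i, rfl⟩; rw [Subsingleton.elim i 0]; exact hx)).swap
    exact (h1 t (ht.mono hA)).1 hxs
  · by_contra hinf
    obtain ⟨T, hT, hcard⟩ := (show (fib t w').Infinite from hinf).exists_subset_card_eq
      ((fib t w).ncard + 1)
    obtain ⟨e⟩ : Nonempty (Fin ((fib t w).ncard + 1) ≃ T) :=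
      ⟨(Fintype.equivFinOfCardEq (by simpa using hcard)).symm⟩
    obtain ⟨y, hy⟩ := copy H (C := S) Sm.le h.symm (fun i => (e i : Fin 1 → M) 0)
    have hmem : ∀ i, ![y i] ∈ fib t w := fun i => by
      have h1 : EqTp L S (Sum.elim ![(e i : Fin 1 → M) 0] w') (Sum.elim ![y i] w) := by
        refine hy.of_comp (Sum.map (fun _ => i) id) ?_ ?_ <;> ext (j | j) <;> simp
      refine (h1 t (ht.mono hA)).1 ?_
      have h2 : ![(e i : Fin 1 → M) 0] = e i := by
        ext j; rw [Subsingleton.elim j 0]; rfl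
      rw [h2]; exact hT (e i).2
    have hinj : Function.Injective fun i => ![y i] := by
      intro i j hij
      have h1 : y i = y j := congrFun hij 0
      have h2 := (hy.eq_iff (Sum.inl i) (Sum.inl j)).2 h1
      refine e.injective (Subtype.ext ?_)
      ext l; rw [Subsingleton.elim l 0]; exact h2
    have h3 := ncard_le_ncard (range_subset_iff.2 hmem) hf
    rw [← image_univ, ncard_image_of_injective _ hinj, ncard_univ, Nat.card_fin] at h3
    omega

theorem exists_finite_acl (H : Ctx L M κ) [Finite α] {N B₀ X : Set M} (hN : ElemSubset (L := L) N)
    (hs : SubsetSaturated (L := L) κ N) {c : ℕ → γ → M} [Finite γ] {s : ℕ → α → M} {k : ℕ}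
    (hB₀ : B₀ ⊆ N) (hcN : ∀ i, range (c i) ⊆ N)
    (hX : ∀ y ∈ X, ∃ d i, i < k ∧ EqTp L (range (c i)) (s i) d ∧ y ∈ range d) {x : M}
    (hxN : x ∈ N) (hx : x ∈ aclSet (L := L) (B₀ ∪ X)) :
    ∃ (n : ℕ) (i : Fin n → ℕ) (d : Fin n → α → M), (∀ j, i j < k ∧ range (d j) ⊆ N ∧
      EqTp L (range (c (i j))) (s (i j)) (d j)) ∧ x ∈ aclSet (L := L) (B₀ ∪ ⋃ j, range (d j)) := by
  obtain ⟨Z, hZ, hxZ, hf⟩ := mem_aclSet_iff.1 hx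
  obtain ⟨A₀, hA₀, hZ₀⟩ := definable_iff_finitely_definable.1 hZ
  have hZ₁ : ((A₀ : Set M) ∩ B₀ ∪ X).Definable L Z := hZ₀.mono (by
    intro z hz
    exact (hA₀ hz).imp (fun h => ⟨hz, h⟩) id)
  obtain ⟨n, e, t, heX, ht, rfl⟩ := exists_fib_fin' hZ₁
  choose d i hi hd he using fun j => hX (e j) (heX ⟨j, rfl⟩)
  have hfin : ((A₀ : Set M) ∩ B₀).Finite := A₀.finite_toSet.inter_of_left _
  set S : Set M := (A₀ : Set M) ∩ B₀ ∪ {x} ∪ ⋃ j, range (c (i j)) with hS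
  have hSf : S.Finite := (hfin.union (finite_singleton x)).union (finite_iUnion fun j => finite_range _)
  have : Sm κ S := Sm.of_finite hSf
  obtain ⟨w, hwN, hw⟩ := exists_eqTp_mem_finite H hN hs hSf
    (union_subset (union_subset (inter_subset_right.trans hB₀) (by simpa using hxN))
      (iUnion_subset fun j => hcN _)) (fun p : Fin n × α => d p.1 p.2)
  have h1 : x ∈ aclSet (L := L) ((A₀ : Set M) ∩ B₀ ∪ range fun p : Fin n × α => d p.1 p.2) := by
    refine aclSet_mono (union_subset_union_right _ ?_)
      (mem_aclSet_iff.2 ⟨_, definable_fib ht e, hxZ, hf⟩)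
    rintro _ ⟨j, rfl⟩
    obtain ⟨l, hl⟩ := he j
    exact ⟨(j, l), hl⟩
  have h2 := aclSet_of_eqTp H hw (by simp [S]) (by rw [hS, union_assoc]; exact subset_union_left) h1
  refine ⟨n, i, fun j l => w (j, l), fun j => ⟨hi j, ?_, ?_⟩, aclSet_mono
    (union_subset_union inter_subset_right ?_) h2⟩
  · exact (range_comp_subset_range (fun l => (j, l)) w).trans hwN
  · refine (hd j).trans ((hw.mono ?_).comp fun l => (j, l))
    exact subset_union_of_subset_right (subset_iUnion (fun j => range (c (i j))) j) _
  · rintro _ ⟨⟨j, l⟩, rfl⟩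
    exact mem_iUnion.2 ⟨j, l, rfl⟩

theorem PReg.indep_finite (H : Ctx L M κ) [Finite α] [Finite β] [Finite δ] {P Y W : Set M}
    {p : δ → M} [hP : Sm κ P] [hW : Sm κ W] {t : β → M} (ht : PReg L κ P p Y t) (hYW : Y ⊆ W)
    (htW : SInd L (range t) Y W) {n : ℕ} {Bs : Fin n → Set M} {s d : Fin n → α → M}
    (hs : ∀ j, PReg L κ P p (Bs j) (s j)) (hBW : ∀ j, Bs j ⊆ W)
    (hd : ∀ j, EqTp L (Bs j) (s j) (d j)) (hdW : ∀ j, ¬ SInd L (range (d j)) (Bs j) W) :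
    SInd L (range t) Y (W ∪ ⋃ j, range (d j)) := by
  have : Sm κ Y := Sm.mono hYW
  induction n with
  | zero => simpa using htW
  | succ n ih =>
    have h1 := ih (fun j => hs j.castSucc) (fun j => hBW _) (fun j => hd _) fun j => hdW _
    set V : Set M := ⋃ j : Fin n, range (d j.castSucc)
    have hV : (⋃ j, range (d j)) ⊆ V ∪ range (d (Fin.last n)) := by
      refine iUnion_subset fun j => ?_
      induction j using Fin.lastCases with
      | last => exact subset_union_right
      | cast j =>
        refine subset_union_of_subset_left ?_ _
        exact subset_iUnion (fun j : Fin n => range (d j.castSucc)) j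
    have : Sm κ V := ⟨small_iUnion hκ.1 _ fun j => small_range hκ.1 _⟩
    have hBl := hBW (Fin.last n)
    have h2 := ht.indep H (hs (Fin.last n)) (EqTp.refl t) (hd (Fin.last n)) (W := W ∪ V)
      (by grind) (by grind) h1
      fun h => hdW (Fin.last n) (h.mono le_rfl (by grind))
    exact h1.tr H h2

/-- A type that is independent from a finite set on which all realizations of the `s i` depend is
independent from every set algebraic over such realizations. -/
theorem PReg.indep_of_acl (H : Ctx L M κ) [Finite α] [Finite β] [Finite γ] [Finite δ]
    {P N Y F B₀ D X : Set M} {p : δ → M} (hN : ElemSubset (L := L) N)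
    (hs : SubsetSaturated (L := L) κ N) [hP : Sm κ P] [hNs : Sm κ N] {c : ℕ → γ → M}
    {s : ℕ → α → M} {k : ℕ} (hcN : ∀ i, range (c i) ⊆ N)
    (hsP : ∀ i, PReg L κ P p (range (c i)) (s i)) (hYN : Y ⊆ N) (hFN : F ⊆ N)
    (hB₀ : B₀ ⊆ aclSet (L := L) Y) (hcF : ∀ i < k, range (c i) ⊆ F)
    (hb : ∀ i < k, ∀ f : α → M, range f ⊆ N → EqTp L (range (c i)) (s i) f →
      ¬ SInd L (range f) (range (c i)) (Y ∪ F))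
    (hXN : X ⊆ N) (hX : ∀ x ∈ X, x ∈ aclSet (L := L) (B₀ ∪ (⋃ i ∈ Iio k, range (c i)) ∪ D))
    (hD : ∀ y ∈ D, ∃ d i, i < k ∧ EqTp L (range (c i)) (s i) d ∧ y ∈ range d)
    {t : β → M} (ht : PReg L κ P p Y t) (htF : SInd L (range t) Y F) : SInd L (range t) Y X := by
  have hYs : Sm κ Y := Sm.mono hYN
  have hFs : Sm κ F := Sm.mono hFN
  have hBN : B₀ ⊆ N := hB₀.trans (aclSet_subset hN hs hYN)
  have hcU : (⋃ i ∈ Iio k, range (c i)) ⊆ F := iUnion₂_subset hcF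
  refine sInd_of_fin fun G hG hGX => ?_
  obtain ⟨V, hVN, hV, hGV⟩ : ∃ V ⊆ N, SInd L (range t) Y (Y ∪ F ∪ V) ∧
      G ⊆ aclSet (L := L) (B₀ ∪ F ∪ V) := by
    induction G, hG using Set.Finite.induction_on with
    | empty => exact ⟨∅, empty_subset _, htF.mono le_rfl (by simp), empty_subset _⟩
    | @insert x G _ hG ih =>
      obtain ⟨V, hVN, hV, hGV⟩ := ih ((subset_insert _ _).trans hGX)
      have hxX := hGX (mem_insert x G)
      obtain ⟨n, i, d, hd, hx⟩ := exists_finite_acl H hN hs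
        (union_subset hBN (hcU.trans hFN)) hcN hD (hXN hxX) (hX x hxX)
      have : Sm κ V := Sm.mono hVN
      have h1 := ht.indep_finite H (W := Y ∪ F ∪ V) (by grind) hV (fun j => hsP (i j))
        (fun j => (hcF _ (hd j).1).trans (by grind)) (fun j => (hd j).2.2)
        fun j h => hb _ (hd j).1 _ (hd j).2.1 (hd j).2.2 (h.mono le_rfl (by grind))
      refine ⟨V ∪ ⋃ j, range (d j), union_subset hVN (iUnion_subset fun j => (hd j).2.1),
        by rwa [← union_assoc], insert_subset (aclSet_mono (by grind) hx)
          (hGV.trans (aclSet_mono (by grind)))⟩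
  have : Sm κ V := Sm.mono hVN
  have h1 := hV.acl H hYs.le (Sm.le (κ := κ) (A := Y ∪ F ∪ V))
  set Z := aclSet (L := L) (Y ∪ (Y ∪ F ∪ V))
  have hZ : Sm κ Z := Sm.mono (aclSet_subset hN hs (by grind))
  have hsub : Y ∪ (Y ∪ F ∪ V) ⊆ Z := subset_aclSet
  have hB₀Z : B₀ ⊆ Z := hB₀.trans (aclSet_mono subset_union_left)
  exact (h1.acl H hYs.le hZ.le).mono le_rfl
    ((hGV.trans (aclSet_mono (by
      grind (splits := 40) (ematch := 40) only [Set.mem_union, Set.subset_def]))).trans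
        subset_union_right)

/-- Steinitz exchange: independent sequences of pairwise nonorthogonal regular types are no longer
than the sequences on which they depend. -/
theorem PReg.steinitz (H : Ctx L M κ) [Finite δ] {P Y : Set M} {p : δ → M} [hP : Sm κ P]
    {f : ℕ → Σ m : ℕ, Fin m → M} {n : ℕ} (hf : ∀ i < n, PReg L κ P p Y (f i).2) {W : Set M}
    [hW : Sm κ W] (hYW : Y ⊆ W) {m : ℕ} {g : ℕ → Σ m : ℕ, Fin m → M}
    (hg : ∀ i < m, PReg L κ P p Y (g i).2)
    (hi : ∀ i < m, SInd L (range (g i).2) Y (W ∪ pre (fun i => range (g i).2) i))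
    (hd : ∀ i < m, ¬ SInd L (range (g i).2) Y (W ∪ pre (fun i => range (f i).2) n)) : m ≤ n := by
  classical
  induction n generalizing W m g with
  | zero =>
    by_contra! hm
    refine hd 0 hm ?_
    have := hi 0 hm
    rwa [pre_zero] at this ⊢
  | succ n ih =>
    have hYs : Sm κ Y := Sm.mono hYW
    have hd' : ∀ i < m, ¬ SInd L (range (g i).2) Y
        (W ∪ range (f n).2 ∪ pre (fun i => range (f i).2) n) := fun i hi' h =>
      hd i hi' (by rw [pre_succ]; exact h.mono le_rfl (by grind))
    by_cases hall : ∀ i < m, SInd L (range (g i).2) Y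
        (W ∪ range (f n).2 ∪ pre (fun i => range (g i).2) i)
    · exact (ih (fun i hi => hf i (by omega)) (hYW.trans subset_union_left) hg hall hd').trans
        n.le_succ
    push Not at hall
    set i := Nat.find hall
    obtain ⟨him, hni⟩ : i < m ∧ ¬ SInd L (range (g i).2) Y
      (W ∪ range (f n).2 ∪ pre (fun i => range (g i).2) i) := Nat.find_spec hall
    have hlt : ∀ j < i, SInd L (range (g j).2) Y
        (W ∪ range (f n).2 ∪ pre (fun i => range (g i).2) j) := fun j hj => by
      by_contra h
      exact Nat.find_min hall hj ⟨hj.trans him, h⟩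
    have hfd : ¬ SInd L (range (f n).2) Y (W ∪ pre (fun i => range (g i).2) (i + 1)) := by
      intro h
      rw [pre_succ] at h
      have h1 : SInd L (range (f n).2) (W ∪ pre (fun i => range (g i).2) i) (range (g i).2) :=
        h.weak
      exact hni ((hi i him).tr H (h1.sy H))
    have hgt : ∀ j < m, i < j → SInd L (range (g j).2) Y
        (W ∪ range (f n).2 ∪ pre (fun i => range (g i).2) j) := fun j hj hij => by
      have h1 := (hg j hj).indep H (hf n n.lt_succ_self) (EqTp.refl _) (EqTp.refl _)
        (W := W ∪ pre (fun i => range (g i).2) j) (hYW.trans subset_union_left)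
        (hYW.trans subset_union_left) (hi j hj) fun h => hfd (h.mono le_rfl (by
          have : pre (fun i => range (g i).2) (i + 1) ⊆ pre (fun i => range (g i).2) j :=
            pre_mono (by omega)
          grind))
      exact (hi j hj).tr H h1
    set g' : ℕ → Σ m : ℕ, Fin m → M := fun j => if j < i then g j else g (j + 1)
    have hg1 : ∀ j < i, g' j = g j := fun j hj => if_pos hj
    have hg2 : ∀ j, i ≤ j → g' j = g (j + 1) := fun j hj => if_neg (by omega)
    have hpre : ∀ j, i ≤ j → pre (fun i => range (g' i).2) j ⊆ pre (fun i => range (g i).2) (j + 1) :=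
      fun j hj => pre_subset fun l hl => by
        rcases lt_or_ge l i with h | h
        · rw [hg1 l h]; exact subset_pre (X := fun i => range (g i).2) (by omega)
        · rw [hg2 l h]; exact subset_pre (X := fun i => range (g i).2) (by omega)
    have hpre' : ∀ j < i, pre (fun i => range (g' i).2) j ⊆ pre (fun i => range (g i).2) j :=
      fun j hj => pre_subset fun l hl => by
        rw [hg1 l (by omega)]; exact subset_pre (X := fun i => range (g i).2) hl
    have := ih (fun i hi => hf i (by omega)) (W := W ∪ range (f n).2)
      (hYW.trans subset_union_left) (m := m - 1) (g := g') ?_ ?_ ?_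
    · omega
    all_goals
      intro j hj
      rcases lt_or_ge j i with h | h
    · rw [hg1 j h]; exact hg j (by omega)
    · rw [hg2 j h]; exact hg _ (by omega)
    · have := hpre' j h
      rw [hg1 j h]; exact (hlt j h).mono le_rfl (by grind)
    · have := hpre j h
      rw [hg2 j h]; exact (hgt _ (by omega) (by omega)).mono le_rfl (by grind)
    · rw [hg1 j h]; exact hd' j (by omega)
    · rw [hg2 j h]; exact hd' _ (by omega)

/-- If no sequence of types depending on `X` is independent for longer than allowed by a finite
set, the lengths of such independent sequences are bounded. -/
theorem PReg.exists_bound (H : Ctx L M κ) [Finite δ] {P Y F X : Set M} {p : δ → M} [hP : Sm κ P]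
    [hY : Sm κ Y] (hF : F.Finite)
    (hFX : ∀ t : Σ m : ℕ, Fin m → M, PReg L κ P p Y t.2 → SInd L (range t.2) Y F →
      SInd L (range t.2) Y X) :
    ∃ n : ℕ, ∀ (m : ℕ) (g : ℕ → Σ m : ℕ, Fin m → M), (∀ i < m, PReg L κ P p Y (g i).2) →
      (∀ i < m, ¬ SInd L (range (g i).2) Y X) →
      (∀ i < m, SInd L (range (g i).2) Y (pre (fun i => range (g i).2) i)) → m ≤ n := by
  by_cases hex : ∃ (n : ℕ) (f : ℕ → Σ m : ℕ, Fin m → M),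
      (∀ i < n, PReg L κ P p Y (f i).2) ∧ ∀ t : Σ m : ℕ, Fin m → M, PReg L κ P p Y t.2 →
        ¬ SInd L (range t.2) Y X → ¬ SInd L (range t.2) Y (pre (fun i => range (f i).2) n)
  · obtain ⟨n, f, hf, hmax⟩ := hex
    exact ⟨n, fun m g hg hgX hgi => steinitz H hf le_rfl hg
      (fun i hi => (hgi i hi).mono le_rfl le_rfl)
      fun i hi h => hmax _ (hg i hi) (hgX i hi) (h.mono le_rfl (by grind))⟩
  push Not at hex
  exfalso
  have : Nonempty (Σ m : ℕ, Fin m → M) := ⟨⟨0, Fin.elim0⟩⟩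
  obtain ⟨f, hf⟩ := dc_greedy (X := Σ m : ℕ, Fin m → M) (fun n g x => PReg L κ P p Y x.2 ∧
    ¬ SInd L (range x.2) Y X ∧ SInd L (range x.2) Y (pre (fun i => range (g i).2) n))
    (fun n g g' hg x hx => by
      have : pre (fun i => range (g' i).2) n = pre (fun i => range (g i).2) n :=
        iUnion₂_congr fun i hi => congrArg (fun t : Σ m : ℕ, Fin m → M => range t.2) (hg i hi)
      rwa [this])
    (fun n g hg => hex n g fun i hi => (hg i hi).1)
  obtain ⟨l, b, -, rfl⟩ := hF.fin_param
  obtain ⟨N, hN⟩ := lc_seq H b Y fun i => range (f i).2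
  have h1 : SInd L (range b) (Y ∪ pre (fun i => range (f i).2) N) (range (f N).2) :=
    hN.mono le_rfl ((subset_iUnion (fun i => range (f i).2) N).trans subset_union_right)
  exact (hf N).2.1 (hFX _ (hf N).1 ((hf N).2.2.tr H (h1.sy H)))

theorem StatS.ascend (H : Ctx L M κ) [Finite α] {s : α → M} [hB : Sm κ B] [hD : Sm κ D]
    (hst : StatS L κ B s) (hBD : B ⊆ D) (hs : SInd L (range s) B D) : StatS L κ D s := by
  intro E hE hDE a e ha he haE heE
  have h1 : SInd L (range a) B D := hs.tp ha
  have h2 : SInd L (range e) B D := hs.tp he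
  exact hst E hE (hBD.trans hDE) a e (ha.mono hBD) (he.mono hBD) (h1.tr H haE) (h2.tr H heE)

theorem NOrth.descend (H : Ctx L M κ) [Finite α] {s : α → M} {e : β → M} [hB : Sm κ B]
    [hD : Sm κ D] (h : NOrth L κ D s C e) (hBD : B ⊆ D) (hs : SInd L (range s) B D) :
    NOrth L κ B s C e := by
  obtain ⟨E, hE, hDE, hCE, a, b, ha, hb, haE, hbE, hab⟩ := h
  have h1 : SInd L (range a) B D := hs.tp ha
  exact ⟨E, hE, hBD.trans hDE, hCE, a, b, ha.mono hBD, hb, h1.tr H haE, hbE, hab⟩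

theorem PairSaturated.saturatedIn {S : Set M} {μ : Cardinal.{u}}
    (h : PairSaturated (L := L) S μ) : SaturatedIn (M := M) L μ := by
  classical
  let _ : unaryLang.Structure M := unaryStructure S
  have h' : SaturatedIn (M := M) (L.sum unaryLang) μ := h
  intro Z hZ p hp
  obtain ⟨x, hx⟩ := h' Z hZ ((LHom.sumInl : L →ᴸ L.sum unaryLang).onFormula '' p) fun fs hfs => by
    obtain ⟨gs, hgs, rfl⟩ := Finset.subset_set_image_iff.1 hfs
    obtain ⟨x, hx⟩ := hp gs hgs
    refine ⟨x, fun φ hφ => ?_⟩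
    obtain ⟨ψ, hψ, rfl⟩ := Finset.mem_image.1 hφ
    exact (LHom.realize_onFormula _ ψ).2 (hx ψ hψ)
  exact ⟨x, fun φ hφ => (LHom.realize_onFormula LHom.sumInl φ).1 (hx _ ⟨φ, hφ, rfl⟩)⟩

theorem not_tupForksOver_iff (H : Ctx L M κ) {n : ℕ} {a : Fin n → M} [hB : Sm κ B] (hCB : C ⊆ B) :
    ¬ TupForksOver (L := L) a B C ↔ SInd L (range a) C B := by
  rw [tupForksOver_iff H hB.le hCB, not_not, sInd_range]

end Forking

section Setup

open Set

variable {L : FirstOrder.Language.{u, u}} {M : Type u} [L.Structure M] (S : WSetup L M)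

theorem WSetup.ctx : Ctx L M S.κ := ⟨S.reg.aleph0_le, S.pairSat.saturatedIn, S.superstable⟩

theorem WSetup.kc : Kc (L := L) S.κ S.A S.a S.Ma S.Astar := S.witness.k2.1.ka

theorem WSetup.smMa : Sm S.κ S.Ma := ⟨S.kc.cardM₁⟩

theorem WSetup.range_c : range S.c ⊆ S.Ma := range_subset_iff.2 S.hc

/-- Two-sided data on `p*` needed to compare it with the other types. -/
theorem WSetup.dstar_spec [hκ : Fact (ℵ₀ ≤ S.κ)] :
    RegS L S.κ (range S.c) S.dstar ∧ StatS L S.κ (range S.c) S.dstar ∧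
      SInd L (range S.dstar) (range S.c) S.Ma ∧
      ∃ (m : ℕ) (e : Fin m → M), NOrth L S.κ (range S.c) S.dstar (aclSet (L := L) S.Astar) e := by
  have H := S.ctx
  have := S.smMa
  have hst : StatS L S.κ (range S.c) S.dstar := S.statP.statS H
  have hi : SInd L (range S.dstar) (range S.c) S.Ma := (not_tupForksOver_iff H S.range_c).1 S.nfP
  have : Sm S.κ (aclSet (L := L) S.Astar) := Sm.mono (aclSet_subset S.kc.elem S.kc.sat S.kc.sub)
  refine ⟨(S.regularP.regS H).descend H hst S.range_c hi, hst, hi, ?_⟩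
  have hno := S.nonorthAstar
  simp only [TypeOrthSet, not_forall] at hno
  obtain ⟨m, e, he⟩ := hno
  exact ⟨m, e, (nOrth_of_not_typesOrthogonal H (hst.ascend H S.range_c hi) he).descend H
    S.range_c hi⟩

/-- The conjugates of `p*` along the indiscernible sequence are nonorthogonal to `p*`. -/
theorem WSetup.exists_conj [hκ : Fact (ℵ₀ ≤ S.κ)] : ∃ s : ℕ → Fin S.nd → M,
    (∀ i, PReg L S.κ (range S.c) S.dstar (range (S.cseq i)) (s i)) ∧
    ∀ i, EqTp L (aclSet (L := L) S.C) (Sum.elim S.dstar S.c) (Sum.elim (s i) (S.cseq i)) := by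
  have H := S.ctx
  have := S.smMa
  obtain ⟨hr, hst, hi, m, e, hno⟩ := S.dstar_spec
  have hAN := aclSet_subset S.kc.elem S.kc.sat S.kc.sub
  have hCA : aclSet (L := L) S.C ⊆ aclSet (L := L) S.Astar := aclSet_mono S.hCsub
  have : Sm S.κ (aclSet (L := L) S.Astar) := Sm.mono hAN
  have : Sm S.κ (aclSet (L := L) S.C) := Sm.mono hCA
  have : Sm S.κ S.Astar := Sm.mono S.kc.sub
  have hCs : Sm S.κ S.C := Sm.mono S.hCsub
  have hind : Indisc L (aclSet (L := L) S.C) S.cseq := fun k i j hi hj =>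
    sameTypeOver_iff.1 (S.indisc k i j hi hj)
  have hcA : SInd L (range S.c) S.C S.Astar :=
    ((not_tupForksOver_iff H subset_union_right).1 S.cIndep).mono le_rfl
      (subset_union_left.trans subset_union_right)
  have hcA' : SInd L (range S.c) (aclSet (L := L) S.C) (aclSet (L := L) S.Astar) := by
    have h1 := hcA.acl H hCs.le Sm.le
    have h2 : aclSet (L := L) S.C ⊆ aclSet (L := L) (S.C ∪ S.Astar) := aclSet_mono subset_union_left
    have h3 : aclSet (L := L) S.Astar ⊆ aclSet (L := L) (S.C ∪ S.Astar) :=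
      aclSet_mono subset_union_right
    have h4 : S.C ⊆ aclSet (L := L) S.C := subset_aclSet
    exact h1.weak
  choose s hs using fun i => copy H (C := aclSet (L := L) S.C) Sm.le
    (sameTypeOver_iff.1 (S.cseqTp i)).symm S.dstar
  have hs0 : ∀ i, EqTp L ∅ (Sum.elim S.dstar S.c) (Sum.elim (s i) (S.cseq i)) := fun i =>
    (hs i).mono (empty_subset _)
  have hc0 := S.cseq0
  refine ⟨s, fun i => ⟨hr.conj H (hs0 i), hst.conj H (hs0 i), ?_, hr, hst⟩, hs⟩
  have h1 := nOrth_copies H (c := S.cseq) (d := S.dstar) (e := e) hCA hind (by rwa [hc0])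
    (by rwa [hc0]) (by rwa [hc0]) (by rwa [hc0]) (i := i) (j := 0) (d₁ := s i) (d₂ := S.dstar)
    (by rw [hc0]; exact hs0 i) (EqTp.refl _)
  rwa [hc0] at h1

theorem WSetup.preg_of_inP [hκ : Fact (ℵ₀ ≤ S.κ)] {t : Σ m : ℕ, Fin m → M}
    (h : InP (L := L) S.Ma S.dstar S.Astar t.2) :
    PReg L S.κ (range S.c) S.dstar S.Astar t.2 := by
  have H := S.ctx
  have := S.smMa
  have : Sm S.κ S.Astar := Sm.mono S.kc.sub
  obtain ⟨hr, hst, hi, -⟩ := S.dstar_spec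
  have ht := h.2.1.statS H
  exact ⟨h.1.regS H, ht, (((nOrth_of_not_typesOrthogonal H ht h.2.2).symm H).descend H
    S.range_c hi).symm H, hr, hst⟩

theorem WSetup.exists_finite_bound [hκ : Fact (ℵ₀ ≤ S.κ)]
    (hdim : DimFinite (L := L) (S.Astar ∪ range S.c) S.dstar S.Ma) {s : ℕ → Fin S.nd → M}
    (hsP : ∀ i, PReg L S.κ (range S.c) S.dstar (range (S.cseq i)) (s i))
    (hs : ∀ i, EqTp L (aclSet (L := L) S.C) (Sum.elim S.dstar S.c) (Sum.elim (s i) (S.cseq i))) :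
    ∃ F : Set M, F.Finite ∧ F ⊆ S.Ma ∧ (∀ i < S.k, range (S.cseq i) ⊆ F) ∧
      ∀ i < S.k, ∀ f : Fin S.nd → M, range f ⊆ S.Ma →
        EqTp L (range (S.cseq i)) (s i) f → ¬ SInd L (range f) (range (S.cseq i)) (S.Astar ∪ F) := by
  have H := S.ctx
  have := S.smMa
  have : Sm S.κ S.Astar := Sm.mono S.kc.sub
  have : Sm S.κ (range S.c) := Sm.mono S.range_c
  have hcN : ∀ i, range (S.cseq i) ⊆ S.Ma := fun i => range_subset_iff.2 (S.cseqMa i)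
  obtain ⟨hr, hst, hi, -⟩ := S.dstar_spec
  obtain ⟨F, hF, hFN, hb⟩ := Benign.exists_finite_bound H (Y := S.Astar) S.kc.elem S.kc.sat hcN hsP
    (by
      rintro ⟨f, hf⟩
      refine hdim ⟨f, fun j => ?_⟩
      obtain ⟨h1, h2, h3⟩ := hf j
      have hpre : pre (fun i => range (f i)) j ⊆ S.Ma := pre_subset fun i _ => (hf i).1
      rw [S.cseq0] at h2 h3
      have h4 := hs 0
      rw [S.cseq0] at h4
      have h5 : EqTp L (range S.c) S.dstar (f j) :=
        ((eqTp_sum_iff.1 h4).mono subset_union_right).trans h2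
      have hD : S.Astar ∪ range S.c ⊆ S.Ma := union_subset S.kc.sub S.range_c
      have : Sm S.κ (S.Astar ∪ range S.c) := Sm.mono hD
      refine ⟨range_subset_iff.1 h1, sameTypeOver_iff.2 (hst _ inferInstance subset_union_right _ _
        (EqTp.refl _) h5 (hi.mono le_rfl (hD.trans subset_union_right)) h3.weak), ?_⟩
      have : Sm S.κ (S.Astar ∪ range S.c ∪ ⋃ l ∈ Iio j, range (f l)) :=
        Sm.mono (union_subset hD hpre)
      have h6 : SInd L (range (f j)) (S.Astar ∪ range S.c)
          (S.Astar ∪ range S.c ∪ pre (fun i => range (f i)) j) := h3.weak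
      exact (not_tupForksOver_iff H subset_union_left).2 h6) S.k
  refine ⟨F ∪ ⋃ i ∈ Iio S.k, range (S.cseq i),
    hF.union ((finite_Iio S.k).biUnion fun i _ => finite_range _),
    union_subset hFN (iUnion₂_subset fun i _ => hcN i),
    fun i h => (subset_biUnion_of_mem (u := fun i => range (S.cseq i)) (mem_Iio.2 h)).trans
      subset_union_right,
    fun i h f h1 h2 h3 => hb i h f h1 h2 h3.weak⟩

theorem WSetup.exists_bound [hκ : Fact (ℵ₀ ≤ S.κ)]
    (hdim : DimFinite (L := L) (S.Astar ∪ range S.c) S.dstar S.Ma) :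
    ∃ n : ℕ, ∀ (m : ℕ) (g : ℕ → Σ m : ℕ, Fin m → M),
      (∀ i < m, PReg L S.κ (range S.c) S.dstar S.Astar (g i).2) →
      (∀ i < m, ¬ SInd L (range (g i).2) S.Astar (qSet (L := L) (aclSet (L := L) S.C) S.e S.Ma)) →
      (∀ i < m, SInd L (range (g i).2) S.Astar (pre (fun i => range (g i).2) i)) → m ≤ n := by
  have H := S.ctx
  have := S.smMa
  have : Sm S.κ S.Astar := Sm.mono S.kc.sub
  have : Sm S.κ (range S.c) := Sm.mono S.range_c
  have hcN : ∀ i, range (S.cseq i) ⊆ S.Ma := fun i => range_subset_iff.2 (S.cseqMa i)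
  obtain ⟨s, hsP, hs⟩ := S.exists_conj
  obtain ⟨F, hF, hFN, hcF, hb⟩ := S.exists_finite_bound hdim hsP hs
  refine PReg.exists_bound H hF fun t ht htF => PReg.indep_of_acl H S.kc.elem S.kc.sat hcN hsP
    S.kc.sub hFN (aclSet_mono S.hCsub) hcF hb (fun x hx => hx.1) (fun x hx => S.qAcl x hx.2) ?_ ht htF
  rintro y ⟨d, i, hi, hd, hy⟩
  exact ⟨d, i, hi, (eqTp_sum_iff.1 ((hs i).symm.trans (sameTypeOver_iff.1 hd).symm)).mono
    subset_union_right, hy⟩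

end Setup

/-- If `dim(r₀ ↾ (A_* ∪ c₀), M_a)` is finite, then `w_P(q(M_a), A_*)`
is finite. -/
theorem wP_finite_over_Astar {L : FirstOrder.Language.{u, u}} {M : Type u}
    [L.Structure M] (S : WSetup L M)
    (hdim : DimFinite (L := L) (S.Astar ∪ Set.range S.c) S.dstar S.Ma) :
    wP (L := L) S.Ma S.dstar (qSet (L := L) (aclSet (L := L) S.C) S.e S.Ma) S.Astar
      < ℵ₀ := by
  have : Fact (ℵ₀ ≤ S.κ) := ⟨S.reg.aleph0_le⟩
  have H := S.ctx
  have := S.smMa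
  have hY : Sm S.κ S.Astar := Sm.mono S.kc.sub
  obtain ⟨n, hn⟩ := S.exists_bound hdim
  refine lt_of_le_of_lt (csSup_le' ?_) (natCast_lt_aleph0 (n := n))
  rintro _ ⟨I, rfl, hI, hIX⟩
  by_contra hlt
  rw [not_le] at hlt
  have hle : ((n + 1 : ℕ) : Cardinal.{u}) ≤ #I := by
    rw [Nat.cast_succ]; exact add_one_le_of_lt hlt
  obtain ⟨⟨e, he⟩⟩ : Nonempty (Fin (n + 1) ↪ I) := by
    rw [← Cardinal.lift_mk_le']
    simpa using hle
  let g : ℕ → Σ m : ℕ, Fin m → M := fun i => (e (Fin.ofNat (n + 1) i)).1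
  have hgI : ∀ i, g i ∈ I := fun i => (e _).2
  have hne : ∀ i < n + 1, ∀ j < i, g j ≠ g i := fun i hi j hj h => by
    have := congrArg Fin.val (he (Subtype.ext h))
    simp only [Fin.ofNat, Nat.mod_eq_of_lt hi, Nat.mod_eq_of_lt (hj.trans hi)] at this
    omega
  have hle := hn (n + 1) g (fun i _ => S.preg_of_inP (hIX _ (hgI i)).1) (fun i _ h => ?_)
    (fun i hi => ?_)
  · omega
  · have : Sm S.κ (S.Astar ∪ qSet (L := L) (aclSet (L := L) S.C) S.e S.Ma) :=
      Sm.mono (Set.union_subset S.kc.sub fun x hx => hx.1)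
    exact (not_tupForksOver_iff H Set.subset_union_left).2
      (h.weak) (hIX _ (hgI i)).2
  · have : Sm S.κ (pre (fun i => Set.range (g i).2) i ∪ S.Astar) := by
      have : Sm S.κ (pre (fun i => Set.range (g i).2) i) :=
        Sm.of_finite ((Set.finite_Iio i).biUnion fun i _ => Set.finite_range _)
      infer_instance
    have h1 : SInd L (Set.range (g i).2) S.Astar (pre (fun i => Set.range (g i).2) i ∪ S.Astar) := by
      refine (not_tupForksOver_iff H Set.subset_union_right).1 fun h => hI _ (hgI i)
        (h.mono (Set.union_subset_union_left _ (pre_subset fun j hj => ?_)))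
      exact Set.subset_biUnion_of_mem (u := fun s : Σ m : ℕ, Fin m → M => Set.range s.2)
        (show g j ∈ I \ {g i} from ⟨hgI j, hne i hi j hj⟩)
    exact h1.weak

end Benign
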